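/- arXiv:1805.09188 — 6 statements merged into one kernel-verified Lean document; each statement's English description precedes it below -/
import Mathlib

section
/- There is an absolute constant C > 0 such that the following holds for every positive integer n: if L₁, L₂, L₃, L₄ are four n-pencils in the real projective plane whose four centres are pairwise distinct and do not all lie on a common line, then the set P of 4-rich points determined by these pencils satisfies |P| ≤ C · n^{11/6}. -/
/-- A point of the real projective plane: a 1-dimensional linear subspace of `ℝ³`. -/
def IsProjPoint (p : Submodule ℝ (Fin 3 → ℝ)) : Prop := Module.finrank ℝ p = 1

/-- A line of the real projective plane: a 2-dimensional linear subspace of `ℝ³`. -/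
def IsProjLine (l : Submodule ℝ (Fin 3 → ℝ)) : Prop := Module.finrank ℝ l = 2

/-- An `n`-pencil with centre `p`: a set of `n` distinct projective lines all through `p`. -/
def IsPencil (n : ℕ) (p : Submodule ℝ (Fin 3 → ℝ))
    (L : Finset (Submodule ℝ (Fin 3 → ℝ))) : Prop :=
  IsProjPoint p ∧ L.card = n ∧ ∀ l ∈ L, IsProjLine l ∧ p ≤ l

/-- The set of 4-rich points of four pencils: points lying on one line from each pencil. -/
def RichPoints4 (L₁ L₂ L₃ L₄ : Finset (Submodule ℝ (Fin 3 → ℝ))) :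
    Set (Submodule ℝ (Fin 3 → ℝ)) :=
  {q | IsProjPoint q ∧ (∃ l ∈ L₁, q ≤ l) ∧ (∃ l ∈ L₂, q ≤ l) ∧
    (∃ l ∈ L₃, q ≤ l) ∧ (∃ l ∈ L₄, q ≤ l)}

/-- A finite set is no larger than its image plus the number of colliding ordered pairs. -/
lemma card_le_card_image_add_card_collisions {α β : Type*} [DecidableEq α] [DecidableEq β]
    (f : α → β) (F : Finset α) :
    F.card ≤ (F.image f).card +
      ((F ×ˢ F).filter (fun p => p.1 ≠ p.2 ∧ f p.1 = f p.2)).card := by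
  induction F using Finset.induction_on with
  | empty => simp
  | insert x F hx ih =>
    rw [Finset.card_insert_of_notMem hx, Finset.image_insert]
    have hsub : (F ×ˢ F).filter (fun p => p.1 ≠ p.2 ∧ f p.1 = f p.2) ⊆
        ((insert x F) ×ˢ (insert x F)).filter (fun p => p.1 ≠ p.2 ∧ f p.1 = f p.2) := by
      intro p
      simp only [Finset.mem_filter, Finset.mem_product, Finset.mem_insert]
      tauto
    by_cases h : f x ∈ F.image f
    · obtain ⟨y, hy, hxy⟩ := Finset.mem_image.1 h
      have hne : x ≠ y := fun e => hx (e ▸ hy)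
      have : ((F ×ˢ F).filter (fun p => p.1 ≠ p.2 ∧ f p.1 = f p.2)).card <
          (((insert x F) ×ˢ (insert x F)).filter
            (fun p => p.1 ≠ p.2 ∧ f p.1 = f p.2)).card := by
        apply Finset.card_lt_card
        refine (Finset.ssubset_iff_of_subset hsub).2 ⟨(x, y), ?_, ?_⟩
        · simp [hy, hne, hxy]
        · simp [hx]
      rw [Finset.insert_eq_of_mem h]
      omega
    · have := Finset.card_le_card hsub
      rw [Finset.card_insert_of_notMem h]
      omega

/-- The index of the block containing `b` when `B` is cut into consecutive blocks of size `q`. -/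
noncomputable def blockIndex (B : Finset ℝ) (q : ℕ) (b : ℝ) : ℕ :=
  (B.filter (fun t => t < b)).card / q

lemma blockIndex_mono (B : Finset ℝ) (q : ℕ) : Monotone (blockIndex B q) := by
  intro b c h
  refine Nat.div_le_div_right (Finset.card_le_card fun t => ?_)
  simp only [Finset.mem_filter]
  exact fun ht => ⟨ht.1, ht.2.trans_le h⟩

lemma blockIndex_le (B : Finset ℝ) (q : ℕ) (b : ℝ) : blockIndex B q b ≤ B.card / q :=
  Nat.div_le_div_right (Finset.card_filter_le _ _)

lemma card_block_le (B : Finset ℝ) {q : ℕ} (hq : 0 < q) (j : ℕ) :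
    (B.filter (fun b => blockIndex B q b = j)).card ≤ q := by
  have hstrict : ∀ b ∈ B, ∀ c, b < c →
      (B.filter (fun t => t < b)).card < (B.filter (fun t => t < c)).card := by
    intro b hb c hbc
    apply Finset.card_lt_card
    refine (Finset.ssubset_iff_of_subset fun t => ?_).2 ⟨b, ?_, ?_⟩
    · simp only [Finset.mem_filter]
      exact fun ht => ⟨ht.1, ht.2.trans hbc⟩
    · simp [hb, hbc]
    · simp
  have : (B.filter (fun b => blockIndex B q b = j)).card ≤ (Finset.Ico (q * j) (q * j + q)).card := by
    refine Finset.card_le_card_of_injOn (fun b => (B.filter (fun t => t < b)).card) ?_ ?_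
    · intro b hb
      have hb' := (Finset.mem_filter.1 hb).2
      unfold blockIndex at hb'
      simp only [Finset.coe_Ico, Set.mem_Ico]
      rw [Nat.div_eq_iff hq] at hb'
      constructor
      · nlinarith [hb'.1]
      · have := hb'.2
        have : (j + 1) * q = q * j + q := by ring
        grind
    · intro b hb c hc h
      have hb' := (Finset.mem_filter.1 hb).1
      have hc' := (Finset.mem_filter.1 hc).1
      rcases lt_trichotomy b c with hlt | heq | hlt
      · exact absurd h (hstrict b hb' c hlt).ne
      · exact heq
      · exact absurd h (hstrict c hc' b hlt).ne'
  simpa using this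

/-- The points of the grid `B × B` on the line with slope `l.1` and intercept `l.2`. -/
noncomputable def gridLine (B : Finset ℝ) (l : ℝ × ℝ) : Finset (ℝ × ℝ) :=
  (B ×ˢ B).filter (fun p => p.2 = l.1 * p.1 + l.2)

lemma mem_gridLine {B : Finset ℝ} {l p : ℝ × ℝ} :
    p ∈ gridLine B l ↔ (p.1 ∈ B ∧ p.2 ∈ B) ∧ p.2 = l.1 * p.1 + l.2 := by
  simp [gridLine]

/-- A non-horizontal line meets few cells of the block partition of a grid. -/
lemma card_cells_le (B : Finset ℝ) (q : ℕ) {l : ℝ × ℝ} (hl : l.1 ≠ 0) :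
    ((gridLine B l).image (fun p => (blockIndex B q p.1, blockIndex B q p.2))).card ≤
      2 * (B.card / q) + 1 := by
  set s := B.card / q with hs
  have hle := blockIndex_le B q
  have hmono := blockIndex_mono B q
  rw [← Finset.card_range (2 * s + 1)]
  rcases lt_or_gt_of_ne hl with hneg | hpos
  · refine Finset.card_le_card_of_injOn (fun c => c.1 + (s - c.2)) ?_ ?_
    · intro c hc
      obtain ⟨p, -, rfl⟩ := Finset.mem_image.1 hc
      have := hle p.1
      simp only [Finset.coe_range, Set.mem_Iio]
      omega
    · intro c hc c' hc' h
      obtain ⟨p, hp, rfl⟩ := Finset.mem_image.1 hc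
      obtain ⟨p', hp', rfl⟩ := Finset.mem_image.1 hc'
      have e := (mem_gridLine.1 hp).2
      have e' := (mem_gridLine.1 hp').2
      have h1 := hle p.2
      have h2 := hle p'.2
      simp only at h
      rcases le_total p.1 p'.1 with hlt | hlt
      · have a1 := hmono hlt
        have a2 := hmono (show p'.2 ≤ p.2 by nlinarith)
        ext <;> simp only <;> omega
      · have a1 := hmono hlt
        have a2 := hmono (show p.2 ≤ p'.2 by nlinarith)
        ext <;> simp only <;> omega
  · refine Finset.card_le_card_of_injOn (fun c => c.1 + c.2) ?_ ?_
    · intro c hc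
      obtain ⟨p, -, rfl⟩ := Finset.mem_image.1 hc
      have := hle p.1
      have := hle p.2
      simp only [Finset.coe_range, Set.mem_Iio]
      omega
    · intro c hc c' hc' h
      obtain ⟨p, hp, rfl⟩ := Finset.mem_image.1 hc
      obtain ⟨p', hp', rfl⟩ := Finset.mem_image.1 hc'
      have e := (mem_gridLine.1 hp).2
      have e' := (mem_gridLine.1 hp').2
      simp only at h
      rcases le_total p.1 p'.1 with hlt | hlt
      · have a1 := hmono hlt
        have a2 := hmono (show p.2 ≤ p'.2 by nlinarith)
        ext <;> simp only <;> omega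
      · have a1 := hmono hlt
        have a2 := hmono (show p'.2 ≤ p.2 by nlinarith)
        ext <;> simp only <;> omega

/-- A Szemerédi–Trotter type bound for incidences between a square grid and lines. -/
lemma sum_card_gridLine_le (B : Finset ℝ) (L : Finset (ℝ × ℝ)) (hL : ∀ l ∈ L, l.1 ≠ 0)
    {q : ℕ} (hq : 0 < q) :
    ∑ l ∈ L, (gridLine B l).card ≤
      L.card * (2 * (B.card / q) + 1) + q ^ 2 * B.card ^ 2 := by
  classical
  set cell : ℝ × ℝ → ℕ × ℕ := fun p => (blockIndex B q p.1, blockIndex B q p.2) with hcell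
  set pairs : ℝ × ℝ → Finset ((ℝ × ℝ) × (ℝ × ℝ)) := fun l =>
    ((gridLine B l) ×ˢ (gridLine B l)).filter (fun p => p.1 ≠ p.2 ∧ cell p.1 = cell p.2)
    with hpairs
  set T := ((B ×ˢ B) ×ˢ (B ×ˢ B)).filter (fun p => cell p.1 = cell p.2) with hT
  have hTcard : T.card ≤ q ^ 2 * B.card ^ 2 := by
    have := Finset.card_le_mul_card_image_of_maps_to (f := Prod.fst) (s := T) (t := B ×ˢ B)
      (fun p hp => (Finset.mem_product.1 (Finset.mem_filter.1 hp).1).1) (q ^ 2) ?_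
    · rwa [Finset.card_product, ← sq] at this
    · intro c _
      calc _ ≤ ((B.filter (fun b => blockIndex B q b = blockIndex B q c.1)) ×ˢ
              (B.filter (fun b => blockIndex B q b = blockIndex B q c.2))).card := by
            refine Finset.card_le_card_of_injOn Prod.snd ?_ ?_
            · rintro ⟨p, p'⟩ hp
              simp only [hT, hcell, Finset.coe_filter, Finset.mem_filter, Finset.mem_product,
                Set.mem_ofPred_eq, Prod.mk.injEq] at hp
              obtain ⟨⟨⟨-, h2⟩, h3, h4⟩, rfl⟩ := hp
              simp [h2.1, h2.2, h3, h4]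
            · rintro ⟨p, p'⟩ hp ⟨r, r'⟩ hr h
              simp only [Finset.coe_filter, Set.mem_ofPred_eq] at hp hr
              simp only at h
              rw [Prod.mk.injEq]
              exact ⟨hp.2.trans hr.2.symm, h⟩
        _ ≤ q ^ 2 := by
            rw [Finset.card_product, sq]
            exact Nat.mul_le_mul (card_block_le B hq _) (card_block_le B hq _)
  have hdisj : ∀ l ∈ L, ∀ l' ∈ L, l ≠ l' → Disjoint (pairs l) (pairs l') := by
    intro l _ l' _ hne
    rw [Finset.disjoint_left]
    rintro ⟨p, p'⟩ h h'
    simp only [hpairs, Finset.mem_filter, Finset.mem_product, mem_gridLine] at h h'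
    obtain ⟨⟨⟨-, h1⟩, -, h2⟩, h3, -⟩ := h
    obtain ⟨⟨⟨-, h4⟩, -, h5⟩, -⟩ := h'
    have hx : p.1 - p'.1 ≠ 0 := by
      intro e
      have e' : p.1 = p'.1 := sub_eq_zero.1 e
      exact h3 (Prod.ext e' (by rw [h1, h2, e']))
    have hm : l.1 = l'.1 := mul_right_cancel₀ hx (by linarith)
    exact hne (Prod.ext hm (by rw [hm] at h1; linarith))
  calc ∑ l ∈ L, (gridLine B l).card
      ≤ ∑ l ∈ L, ((2 * (B.card / q) + 1) + (pairs l).card) :=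
        Finset.sum_le_sum fun l hl =>
          (card_le_card_image_add_card_collisions cell (gridLine B l)).trans
            (Nat.add_le_add_right (card_cells_le B q (hL l hl)) _)
    _ = L.card * (2 * (B.card / q) + 1) + (L.biUnion pairs).card := by
        rw [Finset.sum_add_distrib, Finset.sum_const, smul_eq_mul, Finset.card_biUnion hdisj]
    _ ≤ L.card * (2 * (B.card / q) + 1) + T.card := by
        refine Nat.add_le_add_left (Finset.card_le_card ?_) _
        intro p hp
        obtain ⟨l, -, hp⟩ := Finset.mem_biUnion.1 hp
        simp only [hpairs, hT, Finset.mem_filter, Finset.mem_product, mem_gridLine] at hp ⊢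
        tauto
    _ ≤ _ := Nat.add_le_add_left hTcard _

/-- Energy bound for points of the plane that are rich for four pencils in normal position. -/
lemma sq_card_affine_rich_le {n : ℕ} (γ : ℝ) (A B C D : Finset ℝ) (hA : A.card ≤ n)
    (hB : B.card ≤ n) (hC : C.card ≤ n) (hD : D.card ≤ n) (S : Finset (ℝ × ℝ))
    (hS : ∀ p ∈ S, p.1 ≠ 0 ∧ p.1 + 1 ≠ 0 ∧ p.2 ≠ 0 ∧ p.2 - γ ≠ 0 ∧ p.1 ∈ D ∧ p.2 ∈ B ∧
      p.2 / p.1 ∈ A ∧ (p.2 - γ) / (p.1 + 1) ∈ C) {q : ℕ} (hq : 0 < q) :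
    S.card ^ 2 ≤ n * (n ^ 2 * (2 * (n / q) + 1) + q ^ 2 * n ^ 2) := by
  classical
  set L : Finset (ℝ × ℝ) := ((A ×ˢ C).filter (fun p => p.1 ≠ 0 ∧ p.2 ≠ 0)).image
    (fun p => (p.2 / p.1, p.2 + γ)) with hLdef
  have hLcard : L.card ≤ n ^ 2 := by
    refine Finset.card_image_le.trans ((Finset.card_filter_le _ _).trans ?_)
    rw [Finset.card_product, sq]
    exact Nat.mul_le_mul hA hC
  have hLne : ∀ l ∈ L, l.1 ≠ 0 := by
    intro l hl
    obtain ⟨p, hp, rfl⟩ := Finset.mem_image.1 hl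
    have := (Finset.mem_filter.1 hp).2
    exact div_ne_zero this.2 this.1
  set R := (S ×ˢ S).filter (fun p => p.1.1 = p.2.1) with hR
  have hRcard : R.card = ∑ d ∈ D, (S.filter (fun p => p.1 = d)).card ^ 2 := by
    rw [Finset.card_eq_sum_card_fiberwise (f := fun p => p.1.1) (t := D)]
    · refine Finset.sum_congr rfl fun d _ => ?_
      rw [sq, ← Finset.card_product]
      congr 1
      ext ⟨p, p'⟩
      simp only [hR, Finset.mem_filter, Finset.mem_product]
      constructor
      · rintro ⟨⟨⟨h1, h2⟩, h3⟩, h4⟩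
        exact ⟨⟨h1, h4⟩, h2, h3 ▸ h4⟩
      · rintro ⟨⟨h1, h4⟩, h2, h3⟩
        exact ⟨⟨⟨h1, h2⟩, h4.trans h3.symm⟩, h4⟩
    · intro p hp
      exact (hS p.1 (Finset.mem_product.1 (Finset.mem_filter.1 hp).1).1).2.2.2.2.1
  have hScard : S.card = ∑ d ∈ D, (S.filter (fun p => p.1 = d)).card :=
    Finset.card_eq_sum_card_fiberwise (fun p hp => (hS p hp).2.2.2.2.1)
  have hCS : S.card ^ 2 ≤ D.card * R.card := by
    rw [hScard, hRcard]
    exact sq_sum_le_card_mul_sum_sq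
  have hRle : R.card ≤ ∑ l ∈ L, (gridLine B l).card := by
    rw [← Finset.card_sigma]
    refine Finset.card_le_card_of_injOn
      (fun p => ⟨(((p.2.2 - γ) / (p.2.1 + 1)) / (p.1.2 / p.1.1),
        (p.2.2 - γ) / (p.2.1 + 1) + γ), (p.1.2, p.2.2)⟩) ?_ ?_
    · rintro ⟨⟨x, y⟩, x', y'⟩ hp
      simp only [hR, Finset.coe_filter, Finset.mem_product, Set.mem_ofPred_eq] at hp
      obtain ⟨⟨h1, h2⟩, rfl⟩ := hp
      have g1 := hS _ h1
      have g2 := hS _ h2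
      simp only at g1 g2
      obtain ⟨a1, a2, a3, a4, a5, a6, a7, a8⟩ := g1
      obtain ⟨b1, b2, b3, b4, b5, b6, b7, b8⟩ := g2
      simp only [Finset.coe_sigma, Set.mem_sigma_iff, Finset.mem_coe]
      refine ⟨Finset.mem_image.2 ⟨(y / x, (y' - γ) / (x + 1)), ?_, rfl⟩, ?_⟩
      · simp only [Finset.mem_filter, Finset.mem_product]
        exact ⟨⟨a7, b8⟩, div_ne_zero a3 a1, div_ne_zero b4 a2⟩
      · rw [mem_gridLine]
        refine ⟨⟨a6, b6⟩, ?_⟩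
        simp only
        field_simp
        ring
    · rintro ⟨⟨x, y⟩, x₁, y₁⟩ hp ⟨⟨z, w⟩, z₁, w₁⟩ hp' h
      simp only [hR, Finset.coe_filter, Finset.mem_product, Set.mem_ofPred_eq] at hp hp'
      obtain ⟨⟨h1, h2⟩, rfl⟩ := hp
      obtain ⟨⟨h3, h4⟩, rfl⟩ := hp'
      have g1 := hS _ h1
      have g2 := hS _ h2
      have g3 := hS _ h3
      have g4 := hS _ h4
      simp only at g1 g2 g3 g4
      simp only [Sigma.mk.injEq, Prod.mk.injEq, heq_eq_eq, add_left_inj] at h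
      obtain ⟨⟨e1, e2⟩, rfl, rfl⟩ := h
      have hc : (y₁ - γ) / (x + 1) ≠ 0 := div_ne_zero g2.2.2.2.1 g1.2.1
      have : x = z := by
        have := g2.2.2.2.1
        have := g1.2.1
        have := g3.2.1
        field_simp at e2
        linarith
      rw [this]
  calc S.card ^ 2 ≤ D.card * R.card := hCS
    _ ≤ n * (L.card * (2 * (B.card / q) + 1) + q ^ 2 * B.card ^ 2) :=
        Nat.mul_le_mul hD (hRle.trans (sum_card_gridLine_le B L hLne hq))
    _ ≤ _ := by gcongr

/-- The numerical form of the bound with the optimal block size. -/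
lemma card_affine_rich_le {n : ℕ} (hn : 0 < n) (γ : ℝ) (A B C D : Finset ℝ) (hA : A.card ≤ n)
    (hB : B.card ≤ n) (hC : C.card ≤ n) (hD : D.card ≤ n) (S : Finset (ℝ × ℝ))
    (hS : ∀ p ∈ S, p.1 ≠ 0 ∧ p.1 + 1 ≠ 0 ∧ p.2 ≠ 0 ∧ p.2 - γ ≠ 0 ∧ p.1 ∈ D ∧ p.2 ∈ B ∧
      p.2 / p.1 ∈ A ∧ (p.2 - γ) / (p.1 + 1) ∈ C) :
    (S.card : ℝ) ≤ 3 * (n : ℝ) ^ ((11 : ℝ) / 6) := by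
  have hn1 : (1 : ℝ) ≤ n := by exact_mod_cast hn
  set t : ℝ := (n : ℝ) ^ ((1 : ℝ) / 6) with ht
  have ht1 : 1 ≤ t := Real.one_le_rpow hn1 (by norm_num)
  have ht0 : 0 < t := by linarith
  have htn : (n : ℝ) = t ^ 6 := by
    rw [ht, ← Real.rpow_natCast, ← Real.rpow_mul (by positivity)]
    norm_num
  have ht11 : (n : ℝ) ^ ((11 : ℝ) / 6) = t ^ 11 := by
    rw [ht, ← Real.rpow_natCast, ← Real.rpow_mul (by positivity)]
    norm_num
  obtain ⟨q, hq⟩ : ∃ q, q = ⌈t ^ 2⌉₊ := ⟨_, rfl⟩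
  have hq1 : t ^ 2 ≤ q := hq ▸ Nat.le_ceil _
  have hq2 : (q : ℝ) ≤ 2 * t ^ 2 := by
    have := (Nat.ceil_lt_add_one (show 0 ≤ t ^ 2 by positivity)).le
    rw [← hq] at this
    nlinarith
  have hq0 : 0 < q := by
    have : (0 : ℝ) < q := lt_of_lt_of_le (by positivity) hq1
    exact_mod_cast this
  have key := sq_card_affine_rich_le γ A B C D hA hB hC hD S hS hq0
  have key' : (S.card : ℝ) ^ 2 ≤ n * (n ^ 2 * (2 * ((n / q : ℕ) : ℝ) + 1) + q ^ 2 * n ^ 2) := by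
    exact_mod_cast key
  have hdiv : ((n / q : ℕ) : ℝ) ≤ t ^ 4 := by
    refine Nat.cast_div_le.trans ?_
    rw [div_le_iff₀ (by exact_mod_cast hq0), htn]
    calc t ^ 6 = t ^ 4 * t ^ 2 := by ring
      _ ≤ t ^ 4 * q := by gcongr
  have h4 : 1 ≤ t ^ 4 := one_le_pow₀ ht1
  rw [ht11]
  refine le_of_sq_le_sq ?_ (by positivity)
  calc (S.card : ℝ) ^ 2 ≤ n * (n ^ 2 * (2 * ((n / q : ℕ) : ℝ) + 1) + q ^ 2 * n ^ 2) := key'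
    _ ≤ t ^ 6 * ((t ^ 6) ^ 2 * (2 * t ^ 4 + t ^ 4) + (2 * t ^ 2) ^ 2 * (t ^ 6) ^ 2) := by
        rw [htn]
        gcongr
    _ = 7 * t ^ 22 := by ring
    _ ≤ (3 * t ^ 11) ^ 2 := by
        have : 0 < t ^ 22 := by positivity
        nlinarith

/-- On a line through `v`, the ratio of two functionals vanishing at `v` is constant. -/
lemma exists_ratio_on_line {v : Fin 3 → ℝ} (hv : v ≠ 0) {l : Submodule ℝ (Fin 3 → ℝ)}
    (hl : IsProjLine l) (hvl : v ∈ l) (f g : (Fin 3 → ℝ) →ₗ[ℝ] ℝ) (hf : f v = 0) (hg : g v = 0) :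
    ∃ a : ℝ, ∀ u ∈ l, g u ≠ 0 → f u / g u = a := by
  by_cases h : ∃ u ∈ l, g u ≠ 0
  · obtain ⟨u, hu, hgu⟩ := h
    have hind : LinearIndependent ℝ ![v, u] := by
      rw [LinearIndependent.pair_iff]
      intro s t hst
      have ht : t = 0 := by
        have := congrArg g hst
        simpa [hg, hgu] using this
      subst ht
      exact ⟨by simpa [hv] using hst, rfl⟩
    have hspan : Submodule.span ℝ {v, u} = l := by
      apply Submodule.eq_of_le_of_finrank_eq
      · rw [Submodule.span_le]
        rintro x (rfl | rfl) <;> assumption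
      · have := finrank_span_eq_card hind
        rw [Matrix.range_cons_cons_empty, Fintype.card_fin] at this
        rw [this, hl]
    refine ⟨f u / g u, fun w hw hgw => ?_⟩
    rw [← hspan, Submodule.mem_span_pair] at hw
    obtain ⟨s, t, rfl⟩ := hw
    simp only [map_add, map_smul, hf, hg, smul_eq_mul, mul_zero, zero_add] at hgw ⊢
    exact mul_div_mul_left _ _ (left_ne_zero_of_mul hgw)
  · push Not at h
    exact ⟨0, fun u hu hgu => absurd (h u hu) hgu⟩

/-- The ratio of two functionals vanishing at the centre of an `n`-pencil takes at most `n`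
values on the points of the pencil. -/
lemma exists_ratios_of_pencil {n : ℕ} {v : Fin 3 → ℝ} (hv : v ≠ 0)
    {L : Finset (Submodule ℝ (Fin 3 → ℝ))} (hL : IsPencil n (Submodule.span ℝ {v}) L)
    (f g : (Fin 3 → ℝ) →ₗ[ℝ] ℝ) (hf : f v = 0) (hg : g v = 0) :
    ∃ A : Finset ℝ, A.card ≤ n ∧ ∀ l ∈ L, ∀ u ∈ l, g u ≠ 0 → f u / g u ∈ A := by
  have h : ∀ l : Submodule ℝ (Fin 3 → ℝ), ∃ a : ℝ, l ∈ L → ∀ u ∈ l, g u ≠ 0 → f u / g u = a := by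
    intro l
    by_cases hl : l ∈ L
    · obtain ⟨h1, h2⟩ := hL.2.2 l hl
      obtain ⟨a, ha⟩ := exists_ratio_on_line hv h1
        (h2 (Submodule.mem_span_singleton_self v)) f g hf hg
      exact ⟨a, fun _ => ha⟩
    · exact ⟨0, fun h => absurd h hl⟩
  choose a ha using h
  refine ⟨L.image a, Finset.card_image_le.trans hL.2.1.le, fun l hl u hu hgu => ?_⟩
  rw [ha l hl u hu hgu]
  exact Finset.mem_image_of_mem a hl

/-- A line missing the centre of an `n`-pencil contains at most `n` points of the pencil. -/
lemma exists_points_on_transversal {n : ℕ} {v : Fin 3 → ℝ}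
    {L : Finset (Submodule ℝ (Fin 3 → ℝ))} (hL : IsPencil n (Submodule.span ℝ {v}) L)
    (f : (Fin 3 → ℝ) →ₗ[ℝ] ℝ) (hf : f v ≠ 0) :
    ∃ Q : Finset (Submodule ℝ (Fin 3 → ℝ)), Q.card ≤ n ∧
      ∀ q, IsProjPoint q → (∃ l ∈ L, q ≤ l) → q ≤ LinearMap.ker f → q ∈ Q := by
  classical
  refine ⟨L.image (fun l => l ⊓ LinearMap.ker f), Finset.card_image_le.trans hL.2.1.le, ?_⟩
  rintro q hq ⟨l, hl, hql⟩ hqf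
  refine Finset.mem_image.2 ⟨l, hl, ?_⟩
  obtain ⟨h1, h2⟩ := hL.2.2 l hl
  have hlt : l ⊓ LinearMap.ker f < l := by
    refine lt_of_le_of_ne inf_le_left fun h => hf ?_
    exact (inf_eq_left.1 h) (h2 (Submodule.mem_span_singleton_self v))
  have hfin := Submodule.finrank_lt_finrank_of_lt hlt
  unfold IsProjPoint at hq
  unfold IsProjLine at h1
  exact (Submodule.eq_of_le_of_finrank_le (le_inf hql hqf) (by omega)).symm

/-- The conclusion of the main theorem for a quadruple of pencils. -/
def FewRichPoints (n : ℕ) (L₁ L₂ L₃ L₄ : Finset (Submodule ℝ (Fin 3 → ℝ))) : Prop :=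
  (RichPoints4 L₁ L₂ L₃ L₄).Finite ∧
    ((RichPoints4 L₁ L₂ L₃ L₄).ncard : ℝ) ≤ 8 * (n : ℝ) ^ ((11 : ℝ) / 6)

lemma FewRichPoints.of_eq {n : ℕ} {L₁ L₂ L₃ L₄ M₁ M₂ M₃ M₄ : Finset (Submodule ℝ (Fin 3 → ℝ))}
    (h : FewRichPoints n M₁ M₂ M₃ M₄)
    (e : RichPoints4 L₁ L₂ L₃ L₄ = RichPoints4 M₁ M₂ M₃ M₄) : FewRichPoints n L₁ L₂ L₃ L₄ := by
  unfold FewRichPoints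
  rw [e]
  exact h

/-- The bound for pencils whose centres are, in some basis, `(1,0,0)`, `(1,1,γ)`, `(0,1,0)`
and `(0,0,1)`. -/
lemma fewRichPoints_of_basis {n : ℕ} (hn : 0 < n) (b : Module.Basis (Fin 3) ℝ (Fin 3 → ℝ)) (γ : ℝ)
    {L₁ L₂ L₃ L₄ : Finset (Submodule ℝ (Fin 3 → ℝ))}
    (h₁ : IsPencil n (Submodule.span ℝ {b 0}) L₁)
    (h₂ : IsPencil n (Submodule.span ℝ {b 0 + b 1 + γ • b 2}) L₂)
    (h₃ : IsPencil n (Submodule.span ℝ {b 1}) L₃)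
    (h₄ : IsPencil n (Submodule.span ℝ {b 2}) L₄) : FewRichPoints n L₁ L₂ L₃ L₄ := by
  classical
  have hv₂ : b 0 + b 1 + γ • b 2 ≠ 0 := by
    intro h
    have := congrArg (b.coord 0) h
    simp at this
  set f₀ := b.coord 0 with hf₀
  set f₁ := b.coord 1 with hf₁
  set f₂ := b.coord 2 with hf₂
  obtain ⟨A, hA, hA'⟩ := exists_ratios_of_pencil (b.ne_zero 0) h₁ (f₂ - γ • f₁) f₁
    (by simp [hf₁, hf₂]) (by simp [hf₁])
  obtain ⟨B, hB, hB'⟩ := exists_ratios_of_pencil hv₂ h₂ (f₂ - γ • f₁) (f₀ - f₁)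
    (by simp [hf₁, hf₂]) (by simp [hf₀, hf₁])
  obtain ⟨C, hC, hC'⟩ := exists_ratios_of_pencil (b.ne_zero 1) h₃ (f₂ - γ • f₀) f₀
    (by simp [hf₀, hf₂]) (by simp [hf₀])
  obtain ⟨D, hD, hD'⟩ := exists_ratios_of_pencil (b.ne_zero 2) h₄ f₁ (f₀ - f₁)
    (by simp [hf₁]) (by simp [hf₀, hf₁])
  obtain ⟨Q₁, hQ₁, hQ₁'⟩ := exists_points_on_transversal h₁ (f₀ - f₁) (by simp [hf₀, hf₁])
  obtain ⟨Q₂, hQ₂, hQ₂'⟩ := exists_points_on_transversal h₂ f₁ (by simp [hf₁])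
  obtain ⟨Q₃, hQ₃, hQ₃'⟩ := exists_points_on_transversal h₂ f₀ (by simp [hf₀])
  obtain ⟨Q₄, hQ₄, hQ₄'⟩ := exists_points_on_transversal h₄ (f₂ - γ • f₁) (by simp [hf₁, hf₂])
  obtain ⟨Q₅, hQ₅, hQ₅'⟩ := exists_points_on_transversal h₄ (f₂ - γ • f₀) (by simp [hf₀, hf₂])
  set S := (D ×ˢ B).filter (fun p => p.1 ≠ 0 ∧ p.1 + 1 ≠ 0 ∧ p.2 ≠ 0 ∧ p.2 - γ ≠ 0 ∧
    p.2 / p.1 ∈ A ∧ (p.2 - γ) / (p.1 + 1) ∈ C) with hS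
  have hScard := card_affine_rich_le hn γ A B C D hA hB hC hD S (by
    intro p hp
    simp only [hS, Finset.mem_filter, Finset.mem_product] at hp
    tauto)
  set ψ : ℝ × ℝ → Submodule ℝ (Fin 3 → ℝ) := fun p =>
    Submodule.span ℝ {(p.1 + 1) • b 0 + p.1 • b 1 + (p.2 + γ * p.1) • b 2} with hψ
  set Q := Q₁ ∪ (Q₂ ∪ (Q₃ ∪ (Q₄ ∪ (Q₅ ∪ S.image ψ)))) with hQ
  have hsub : RichPoints4 L₁ L₂ L₃ L₄ ⊆ Q := by
    rintro q ⟨hq, hq₁, hq₂, hq₃, hq₄⟩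
    obtain ⟨w, hw, hspan⟩ : ∃ w ∈ q, ∀ u ∈ q, ∃ c : ℝ, c • w = u := by
      obtain ⟨w, -, hw⟩ := finrank_eq_one_iff'.1 hq
      refine ⟨w, w.2, fun u hu => ?_⟩
      obtain ⟨c, hc⟩ := hw ⟨u, hu⟩
      exact ⟨c, congrArg Subtype.val hc⟩
    have hker : ∀ f : (Fin 3 → ℝ) →ₗ[ℝ] ℝ, f w = 0 → q ≤ LinearMap.ker f := by
      intro f hf u hu
      obtain ⟨c, rfl⟩ := hspan u hu
      simp [hf]
    simp only [hQ, Finset.coe_union, Set.mem_union, Finset.mem_coe]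
    by_contra hnot
    push Not at hnot
    obtain ⟨n₁, n₂, n₃, n₄, n₅, n₆⟩ := hnot
    have k₁ : (f₀ - f₁) w ≠ 0 := fun h => n₁ (hQ₁' q hq hq₁ (hker _ h))
    have k₂ : f₁ w ≠ 0 := fun h => n₂ (hQ₂' q hq hq₂ (hker _ h))
    have k₃ : f₀ w ≠ 0 := fun h => n₃ (hQ₃' q hq hq₂ (hker _ h))
    have k₄ : (f₂ - γ • f₁) w ≠ 0 := fun h => n₄ (hQ₄' q hq hq₄ (hker _ h))
    have k₅ : (f₂ - γ • f₀) w ≠ 0 := fun h => n₅ (hQ₅' q hq hq₄ (hker _ h))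
    obtain ⟨l₁, hl₁, hql₁⟩ := hq₁
    obtain ⟨l₂, hl₂, hql₂⟩ := hq₂
    obtain ⟨l₃, hl₃, hql₃⟩ := hq₃
    obtain ⟨l₄, hl₄, hql₄⟩ := hq₄
    have rA := hA' l₁ hl₁ w (hql₁ hw) k₂
    have rB := hB' l₂ hl₂ w (hql₂ hw) k₁
    have rC := hC' l₃ hl₃ w (hql₃ hw) k₃
    have rD := hD' l₄ hl₄ w (hql₄ hw) k₁
    have hexp : w = f₀ w • b 0 + f₁ w • b 1 + f₂ w • b 2 := by
      have := (b.sum_repr w).symm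
      rwa [Fin.sum_univ_three] at this
    simp only [LinearMap.sub_apply, LinearMap.smul_apply, smul_eq_mul] at k₁ k₄ k₅ rA rB rC rD
    generalize f₀ w = x at *
    generalize f₁ w = y at *
    generalize f₂ w = z at *
    apply n₆
    have e1 : y / (x - y) + 1 = x / (x - y) := by field_simp; ring
    have e2 : (z - γ * y) / (x - y) - γ = (z - γ * x) / (x - y) := by field_simp; ring
    refine Finset.mem_image.2 ⟨(y / (x - y), (z - γ * y) / (x - y)), ?_, ?_⟩
    · simp only [hS, Finset.mem_filter, Finset.mem_product]
      rw [e1, e2]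
      refine ⟨⟨rD, rB⟩, div_ne_zero k₂ k₁, div_ne_zero k₃ k₁, div_ne_zero k₄ k₁,
        div_ne_zero k₅ k₁, ?_, ?_⟩
      · rwa [div_div_div_cancel_right₀ k₁]
      · rwa [div_div_div_cancel_right₀ k₁]
    · have e3 : (z - γ * y) / (x - y) + γ * (y / (x - y)) = z / (x - y) := by
        field_simp; ring
      have e4 : (y / (x - y) + 1) • b 0 + (y / (x - y)) • b 1 +
          ((z - γ * y) / (x - y) + γ * (y / (x - y))) • b 2 = (x - y)⁻¹ • w := by
        rw [e1, e3, hexp]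
        simp only [smul_add, smul_smul, div_eq_inv_mul]
      simp only [hψ]
      rw [e4, Submodule.span_singleton_smul_eq (IsUnit.mk0 _ (inv_ne_zero k₁))]
      apply le_antisymm
      · rwa [Submodule.span_singleton_le_iff_mem]
      · intro u hu
        exact Submodule.mem_span_singleton.2 (hspan u hu)
  refine ⟨Q.finite_toSet.subset hsub, ?_⟩
  have hncard : (RichPoints4 L₁ L₂ L₃ L₄).ncard ≤ 5 * n + S.card := by
    refine (Set.ncard_le_ncard hsub Q.finite_toSet).trans ?_
    rw [Set.ncard_coe_finset]
    have c₁ := Finset.card_union_le Q₁ (Q₂ ∪ (Q₃ ∪ (Q₄ ∪ (Q₅ ∪ S.image ψ))))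
    have c₂ := Finset.card_union_le Q₂ (Q₃ ∪ (Q₄ ∪ (Q₅ ∪ S.image ψ)))
    have c₃ := Finset.card_union_le Q₃ (Q₄ ∪ (Q₅ ∪ S.image ψ))
    have c₄ := Finset.card_union_le Q₄ (Q₅ ∪ S.image ψ)
    have c₅ := Finset.card_union_le Q₅ (S.image ψ)
    have c₆ : (S.image ψ).card ≤ S.card := Finset.card_image_le
    rw [← hQ] at c₁
    omega
  have hncard' : ((RichPoints4 L₁ L₂ L₃ L₄).ncard : ℝ) ≤ 5 * n + S.card := by
    exact_mod_cast hncard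
  have hn1 : (1 : ℝ) ≤ n := by exact_mod_cast hn
  have : (n : ℝ) ≤ (n : ℝ) ^ ((11 : ℝ) / 6) := by
    conv_lhs => rw [← Real.rpow_one (n : ℝ)]
    exact Real.rpow_le_rpow_of_exponent_le hn1 (by norm_num)
  linarith

/-- The bound for pencils with centres `u`, `α • u + β • v + γ • w`, `v`, `w`, where `u`, `v`, `w`
are linearly independent and `α`, `β` are nonzero. -/
lemma fewRichPoints_of_coeff_ne_zero {n : ℕ} (hn : 0 < n) {u v w : Fin 3 → ℝ}
    (hind : ∀ a b c : ℝ, a • u + b • v + c • w = 0 → a = 0 ∧ b = 0 ∧ c = 0)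
    {α β : ℝ} (γ : ℝ) (hα : α ≠ 0) (hβ : β ≠ 0)
    {L₁ L₂ L₃ L₄ : Finset (Submodule ℝ (Fin 3 → ℝ))}
    (h₁ : IsPencil n (Submodule.span ℝ {u}) L₁)
    (h₂ : IsPencil n (Submodule.span ℝ {α • u + β • v + γ • w}) L₂)
    (h₃ : IsPencil n (Submodule.span ℝ {v}) L₃)
    (h₄ : IsPencil n (Submodule.span ℝ {w}) L₄) : FewRichPoints n L₁ L₂ L₃ L₄ := by
  have hli : LinearIndependent ℝ ![α • u, β • v, w] := by
    rw [Fintype.linearIndependent_iff]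
    intro g hg
    simp only [Fin.sum_univ_three, Matrix.cons_val_zero, Matrix.cons_val_one, Matrix.cons_val,
      smul_smul] at hg
    obtain ⟨e1, e2, e3⟩ := hind _ _ _ hg
    intro i
    fin_cases i
    · exact (mul_eq_zero.1 e1).resolve_right hα
    · exact (mul_eq_zero.1 e2).resolve_right hβ
    · exact e3
  let b := basisOfLinearIndependentOfCardEqFinrank hli (by simp)
  have b0 : b 0 = α • u := by simp [b]
  have b1 : b 1 = β • v := by simp [b]
  have b2 : b 2 = w := by simp [b]
  apply fewRichPoints_of_basis hn b γ
  · rwa [b0, Submodule.span_singleton_smul_eq (IsUnit.mk0 _ hα)]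
  · rwa [b0, b1, b2]
  · rwa [b1, Submodule.span_singleton_smul_eq (IsUnit.mk0 _ hβ)]
  · rwa [b2]

/-- The bound for four pencils with distinct centres, the first three of which are not collinear. -/
lemma fewRichPoints_of_not_le_sup {n : ℕ} (hn : 0 < n) {p₁ p₂ p₃ p₄ : Submodule ℝ (Fin 3 → ℝ)}
    {L₁ L₂ L₃ L₄ : Finset (Submodule ℝ (Fin 3 → ℝ))}
    (h₁ : IsPencil n p₁ L₁) (h₂ : IsPencil n p₂ L₂) (h₃ : IsPencil n p₃ L₃)
    (h₄ : IsPencil n p₄ L₄) (h12 : p₁ ≠ p₂) (h14 : p₁ ≠ p₄) (h24 : p₂ ≠ p₄) (h34 : p₃ ≠ p₄)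
    (hnc : ¬ p₃ ≤ p₁ ⊔ p₂) : FewRichPoints n L₁ L₂ L₃ L₄ := by
  have hgen : ∀ p : Submodule ℝ (Fin 3 → ℝ), IsProjPoint p →
      ∃ v : Fin 3 → ℝ, v ≠ 0 ∧ p = Submodule.span ℝ {v} := by
    intro p hp
    obtain ⟨v, hv, h⟩ := finrank_eq_one_iff'.1 hp
    refine ⟨v, by simpa using hv, le_antisymm (fun u hu => ?_) ?_⟩
    · obtain ⟨c, hc⟩ := h ⟨u, hu⟩
      exact Submodule.mem_span_singleton.2 ⟨c, congrArg Subtype.val hc⟩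
    · rw [Submodule.span_singleton_le_iff_mem]
      exact v.2
  obtain ⟨u, hu, rfl⟩ := hgen p₁ h₁.1
  obtain ⟨v, hv, rfl⟩ := hgen p₂ h₂.1
  obtain ⟨w, hw, rfl⟩ := hgen p₃ h₃.1
  obtain ⟨x, hx, rfl⟩ := hgen p₄ h₄.1
  have hspan : ∀ {y z : Fin 3 → ℝ} {c : ℝ}, z ≠ 0 → z = c • y →
      Submodule.span ℝ {y} = Submodule.span ℝ {z} := by
    rintro y z c hz rfl
    have hc : c ≠ 0 := by rintro rfl; simp at hz
    exact (Submodule.span_singleton_smul_eq (IsUnit.mk0 _ hc) y).symm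
  have hind : ∀ a b c : ℝ, a • u + b • v + c • w = 0 → a = 0 ∧ b = 0 ∧ c = 0 := by
    intro a b c h
    have hc : c = 0 := by
      by_contra hc
      apply hnc
      rw [Submodule.span_singleton_le_iff_mem, ← Submodule.span_union, Set.singleton_union,
        Submodule.mem_span_pair]
      refine ⟨-(c⁻¹ * a), -(c⁻¹ * b), ?_⟩
      have : c⁻¹ • (a • u + b • v + c • w) = 0 := by rw [h, smul_zero]
      simp only [smul_add, smul_smul, inv_mul_cancel₀ hc, one_smul] at this
      rw [neg_smul, neg_smul, ← neg_add, neg_eq_iff_add_eq_zero]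
      exact this
    subst hc
    have hb : b = 0 := by
      by_contra hb
      apply h12
      refine hspan (c := -(b⁻¹ * a)) hv ?_
      have : b⁻¹ • (a • u + b • v + (0 : ℝ) • w) = 0 := by rw [h, smul_zero]
      simp only [smul_add, smul_smul, inv_mul_cancel₀ hb, one_smul, zero_smul,
        add_zero] at this
      rw [neg_smul]
      exact (neg_eq_of_add_eq_zero_right this).symm
    subst hb
    refine ⟨?_, rfl, rfl⟩
    simpa [hu] using h
  have hli : LinearIndependent ℝ ![u, v, w] := by
    rw [Fintype.linearIndependent_iff]
    intro g hg
    simp only [Fin.sum_univ_three, Matrix.cons_val_zero, Matrix.cons_val_one,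
      Matrix.cons_val] at hg
    obtain ⟨e1, e2, e3⟩ := hind _ _ _ hg
    intro i
    fin_cases i
    · exact e1
    · exact e2
    · exact e3
  obtain ⟨α, β, γ, rfl⟩ : ∃ α β γ : ℝ, x = α • u + β • v + γ • w := by
    let b := basisOfLinearIndependentOfCardEqFinrank hli (by simp)
    refine ⟨b.repr x 0, b.repr x 1, b.repr x 2, ?_⟩
    conv_lhs => rw [← b.sum_repr x]
    simp [Fin.sum_univ_three, b]
  by_cases hα : α = 0
  · subst hα
    have hβ : β ≠ 0 := by
      rintro rfl
      exact h34 (hspan (c := γ) hx (by simp))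
    have hγ : γ ≠ 0 := by
      rintro rfl
      exact h24 (hspan (c := β) hx (by simp))
    refine (fewRichPoints_of_coeff_ne_zero hn (u := v) (v := w) (w := u) (α := β) (β := γ) ?_
      0 hβ hγ h₂ (L₂ := L₄) ?_ h₃ h₁).of_eq ?_
    · intro a b c h
      have := hind c a b (by rw [← h]; abel)
      tauto
    · convert h₄ using 3
      simp
    · ext q
      simp only [RichPoints4, Set.mem_ofPred_eq]
      tauto
  by_cases hβ : β = 0
  · subst hβ
    have hγ : γ ≠ 0 := by
      rintro rfl
      exact h14 (hspan (c := α) hx (by simp))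
    refine (fewRichPoints_of_coeff_ne_zero hn (u := u) (v := w) (w := v) (α := α) (β := γ) ?_
      0 hα hγ h₁ (L₂ := L₄) ?_ h₃ h₂).of_eq ?_
    · intro a b c h
      have := hind a c b (by rw [← h]; abel)
      tauto
    · convert h₄ using 3
      simp
    · ext q
      simp only [RichPoints4, Set.mem_ofPred_eq]
      tauto
  · refine (fewRichPoints_of_coeff_ne_zero hn hind γ hα hβ h₁ h₄ h₂ h₃).of_eq ?_
    ext q
    simp only [RichPoints4, Set.mem_ofPred_eq]
    tauto

theorem four_rich_points_upper_bound :
    ∃ C : ℝ, 0 < C ∧ ∀ (n : ℕ), 0 < n →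
      ∀ (p₁ p₂ p₃ p₄ : Submodule ℝ (Fin 3 → ℝ))
        (L₁ L₂ L₃ L₄ : Finset (Submodule ℝ (Fin 3 → ℝ))),
        IsPencil n p₁ L₁ → IsPencil n p₂ L₂ → IsPencil n p₃ L₃ → IsPencil n p₄ L₄ →
        p₁ ≠ p₂ → p₁ ≠ p₃ → p₁ ≠ p₄ → p₂ ≠ p₃ → p₂ ≠ p₄ → p₃ ≠ p₄ →
        (¬ ∃ l, IsProjLine l ∧ p₁ ≤ l ∧ p₂ ≤ l ∧ p₃ ≤ l ∧ p₄ ≤ l) →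
        (RichPoints4 L₁ L₂ L₃ L₄).Finite ∧
          ((RichPoints4 L₁ L₂ L₃ L₄).ncard : ℝ) ≤ C * (n : ℝ) ^ ((11 : ℝ) / 6) := by
  refine ⟨8, by norm_num, ?_⟩
  intro n hn p₁ p₂ p₃ p₄ L₁ L₂ L₃ L₄ h₁ h₂ h₃ h₄ h12 h13 h14 h23 h24 h34 hnc
  by_cases h3 : p₃ ≤ p₁ ⊔ p₂
  · by_cases h4 : p₄ ≤ p₁ ⊔ p₂
    · refine absurd ⟨p₁ ⊔ p₂, ?_, le_sup_left, le_sup_right, h3, h4⟩ hnc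
      have hinf : p₁ ⊓ p₂ < p₁ := by
        refine lt_of_le_of_ne inf_le_left fun h => h12 ?_
        exact Submodule.eq_of_le_of_finrank_eq (inf_eq_left.1 h) (h₁.1.trans h₂.1.symm)
      have hlt := Submodule.finrank_lt_finrank_of_lt hinf
      have hsum := Submodule.finrank_sup_add_finrank_inf_eq p₁ p₂
      have e₁ : Module.finrank ℝ p₁ = 1 := h₁.1
      have e₂ : Module.finrank ℝ p₂ = 1 := h₂.1
      unfold IsProjLine
      omega
    · refine (fewRichPoints_of_not_le_sup hn h₁ h₂ h₄ h₃ h12 h13 h23 h34.symm h4).of_eq ?_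
      ext q
      simp only [RichPoints4, Set.mem_ofPred_eq]
      tauto
  · exact fewRichPoints_of_not_le_sup hn h₁ h₂ h₃ h₄ h12 h14 h24 h34 h3
end

section
/- There is an absolute constant c > 0 such that for every N there exists an integer n ≥ N and four n-pencils in the real projective plane, with pairwise distinct centres that do not all lie on a common line, which determine at least c · n^{3/2} · (log n)^{43/1000} 4-rich points. -/
/-- The number of elements of `P` dividing `m`. -/
def divisorCountIn (P : Finset ℕ) (m : ℕ) : ℕ := (P.filter (· ∣ m)).card

/-- The sum of the reciprocals of the elements of `P`. -/
noncomputable def recipSum (P : Finset ℕ) : ℝ := ∑ p ∈ P, (1 / p : ℝ)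

lemma recipSum_nonneg (P : Finset ℕ) : 0 ≤ recipSum P :=
  Finset.sum_nonneg fun _ _ => by positivity

lemma card_multiples (N d : ℕ) : ((Finset.Icc 1 N).filter (d ∣ ·)).card = N / d := by
  rw [← Nat.Ioc_filter_dvd_card_eq_div]; rfl

lemma card_multiples_le (N d : ℕ) :
    (((Finset.Icc 1 N).filter (d ∣ ·)).card : ℝ) ≤ N / d := by
  rw [card_multiples]; exact Nat.cast_div_le

lemma prod_primes_dvd_iff_subset {P : Finset ℕ} (hP : ∀ p ∈ P, p.Prime) {s : Finset ℕ} (hs : s ⊆ P) (m : ℕ) :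
    ∏ p ∈ s, p ∣ m ↔ s ⊆ P.filter (· ∣ m) := by
  constructor
  · intro h p hp
    exact Finset.mem_filter.2 ⟨hs hp, (Finset.dvd_prod_of_mem _ hp).trans h⟩
  · intro h
    exact Finset.prod_primes_dvd m (fun p hp => (hP p (hs hp)).prime)
      fun p hp => (Finset.mem_filter.1 (h hp)).2

lemma sum_two_pow_divisorCountIn_le {P : Finset ℕ} (hP : ∀ p ∈ P, p.Prime) (X : ℕ) :
    ∑ m ∈ Finset.Icc 1 X, (2 : ℝ) ^ divisorCountIn P m ≤ X * Real.exp (recipSum P) := by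
  have h (m : ℕ) : (2 : ℝ) ^ divisorCountIn P m =
      ∑ s ∈ P.powerset, if ∏ p ∈ s, p ∣ m then (1 : ℝ) else 0 := by
    rw [← Finset.sum_filter, Finset.sum_const, nsmul_eq_mul, mul_one, divisorCountIn]
    have : P.powerset.filter (fun s => ∏ p ∈ s, p ∣ m) = (P.filter (· ∣ m)).powerset := by
      ext s
      simp only [Finset.mem_filter, Finset.mem_powerset]
      constructor
      · rintro ⟨h1, h2⟩; exact (prod_primes_dvd_iff_subset hP h1 m).1 h2
      · intro h1
        have h2 := h1.trans (Finset.filter_subset _ _)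
        exact ⟨h2, (prod_primes_dvd_iff_subset hP h2 m).2 h1⟩
    rw [this, Finset.card_powerset]; push_cast; rfl
  simp_rw [h]
  rw [Finset.sum_comm]
  calc _ ≤ ∑ s ∈ P.powerset, (X : ℝ) * ∏ p ∈ s, (1 / p : ℝ) := by
        refine Finset.sum_le_sum fun s _ => ?_
        rw [← Finset.sum_filter, Finset.sum_const, nsmul_eq_mul, mul_one]
        refine (card_multiples_le X _).trans_eq ?_
        rw [Nat.cast_prod, div_eq_mul_inv]
        simp
    _ = X * ∏ p ∈ P, (1 + 1 / p : ℝ) := by rw [← Finset.mul_sum, Finset.prod_one_add]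
    _ ≤ _ := by
        gcongr
        exact Real.prod_one_add_le_exp_sum P fun p => by positivity

lemma card_large_divisorCountIn_le {P : Finset ℕ} (hP : ∀ p ∈ P, p.Prime) (X : ℕ) (K : ℝ) :
    (((Finset.Icc 1 X).filter fun m => K ≤ divisorCountIn P m).card : ℝ) * 2 ^ K ≤
      X * Real.exp (recipSum P) := by
  refine le_trans ?_ (sum_two_pow_divisorCountIn_le hP X)
  rw [← nsmul_eq_mul, ← Finset.sum_const]
  refine (Finset.sum_le_sum fun m hm => ?_).trans
    (Finset.sum_le_sum_of_subset_of_nonneg (Finset.filter_subset _ _) fun _ _ _ => by positivity)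
  rw [← Real.rpow_natCast]
  exact Real.rpow_le_rpow_of_exponent_le (by norm_num) (Finset.mem_filter.1 hm).2

lemma divisorCountIn_eq_sum (P : Finset ℕ) (m : ℕ) :
    (divisorCountIn P m : ℝ) = ∑ p ∈ P, if p ∣ m then (1 : ℝ) else 0 := by
  rw [← Finset.sum_filter, Finset.sum_const, nsmul_eq_mul, mul_one, divisorCountIn]

lemma le_sum_divisorCountIn {P : Finset ℕ} (N : ℕ) :
    N * recipSum P - P.card ≤ ∑ m ∈ Finset.Icc 1 N, (divisorCountIn P m : ℝ) := by
  simp_rw [divisorCountIn_eq_sum]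
  rw [Finset.sum_comm, recipSum, Finset.mul_sum, Finset.cast_card, ← Finset.sum_sub_distrib]
  refine Finset.sum_le_sum fun p _ => ?_
  rw [← Finset.sum_filter, Finset.sum_const, nsmul_eq_mul, mul_one, card_multiples]
  have := Nat.lt_floor_add_one ((N : ℝ) / p)
  rw [Nat.floor_div_eq_div] at this
  rw [mul_one_div]; linarith

lemma sum_divisorCountIn_sq_le {P : Finset ℕ} (hP : ∀ p ∈ P, p.Prime) (N : ℕ) :
    ∑ m ∈ Finset.Icc 1 N, (divisorCountIn P m : ℝ) ^ 2 ≤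
      N * recipSum P ^ 2 + N * recipSum P := by
  simp_rw [divisorCountIn_eq_sum, sq, Finset.sum_mul_sum]
  rw [Finset.sum_comm, recipSum, Finset.sum_mul_sum, Finset.mul_sum, Finset.mul_sum,
    ← Finset.sum_add_distrib]
  refine Finset.sum_le_sum fun p hp => ?_
  rw [Finset.sum_comm, ← Finset.add_sum_erase _ _ hp, Finset.mul_sum,
    ← Finset.add_sum_erase (a := p) _ (fun q : ℕ => (N : ℝ) * (1 / p * (1 / q))) hp]
  have h1 : ∑ m ∈ Finset.Icc 1 N,
      ((if p ∣ m then (1 : ℝ) else 0) * if p ∣ m then (1 : ℝ) else 0) ≤ N * (1 / p) := by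
    simp only [mul_ite, mul_one, mul_zero]
    rw [mul_one_div]
    refine le_trans (le_of_eq ?_) (card_multiples_le N p)
    rw [Finset.cast_card, Finset.sum_filter]
    exact Finset.sum_congr rfl fun m _ => by split_ifs <;> rfl
  have h2 : ∑ q ∈ P.erase p, ∑ m ∈ Finset.Icc 1 N,
      ((if p ∣ m then (1 : ℝ) else 0) * if q ∣ m then (1 : ℝ) else 0) ≤
      ∑ q ∈ P.erase p, (N : ℝ) * (1 / p * (1 / q)) := by
    refine Finset.sum_le_sum fun q hq => ?_
    obtain ⟨hqp, hq⟩ := Finset.mem_erase.1 hq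
    have hc : Nat.Coprime p q := (Nat.coprime_primes (hP p hp) (hP q hq)).2 hqp.symm
    rw [one_div_mul_one_div, mul_one_div, ← Nat.cast_mul]
    refine le_trans (le_of_eq ?_) (card_multiples_le N (p * q))
    rw [Finset.cast_card, Finset.sum_filter]
    refine Finset.sum_congr rfl fun m _ => ?_
    have : p * q ∣ m ↔ p ∣ m ∧ q ∣ m :=
      ⟨fun h => ⟨(dvd_mul_right _ _).trans h, (dvd_mul_left _ _).trans h⟩,
        fun h => hc.mul_dvd_of_dvd_of_dvd h.1 h.2⟩
    simp only [this]
    split_ifs <;> simp_all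
  have h3 : 0 ≤ (N : ℝ) * (1 / p * (1 / p)) := by positivity
  linarith

/-- **Turán's inequality** for the number of divisors in a set of primes. -/
lemma sum_divisorCountIn_sub_sq_le {P : Finset ℕ} (hP : ∀ p ∈ P, p.Prime) {N : ℕ}
    (hN : P.card ≤ N) :
    ∑ m ∈ Finset.Icc 1 N, ((divisorCountIn P m : ℝ) - recipSum P) ^ 2 ≤
      3 * N * recipSum P := by
  have h1 := sum_divisorCountIn_sq_le hP N
  have h2 := le_sum_divisorCountIn (P := P) N
  have hS := recipSum_nonneg P
  have h3 : (P.card : ℝ) ≤ N := by exact_mod_cast hN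
  have : ∑ m ∈ Finset.Icc 1 N, ((divisorCountIn P m : ℝ) - recipSum P) ^ 2 =
      ∑ m ∈ Finset.Icc 1 N, (divisorCountIn P m : ℝ) ^ 2 -
        2 * recipSum P * ∑ m ∈ Finset.Icc 1 N, (divisorCountIn P m : ℝ) +
        N * recipSum P ^ 2 := by
    rw [Finset.mul_sum, ← Finset.sum_sub_distrib]
    have : (N : ℝ) * recipSum P ^ 2 = ∑ m ∈ Finset.Icc 1 N, recipSum P ^ 2 := by simp
    rw [this, ← Finset.sum_add_distrib]
    exact Finset.sum_congr rfl fun m _ => by ring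
  rw [this]
  nlinarith [mul_le_mul_of_nonneg_left h2 hS, mul_le_mul_of_nonneg_left h3 hS]

lemma card_small_divisorCountIn_le {P : Finset ℕ} (hP : ∀ p ∈ P, p.Prime) {N : ℕ}
    (hN : P.card ≤ N) (hS : 0 < recipSum P) :
    (((Finset.Icc 1 N).filter fun m =>
      (divisorCountIn P m : ℝ) < 9 / 10 * recipSum P).card : ℝ) ≤ 300 * N / recipSum P := by
  have h := sum_divisorCountIn_sub_sq_le hP hN
  have h2 : (((Finset.Icc 1 N).filter fun m =>
      (divisorCountIn P m : ℝ) < 9 / 10 * recipSum P).card : ℝ) * (recipSum P / 10) ^ 2 ≤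
      3 * N * recipSum P := by
    refine le_trans ?_ h
    rw [← nsmul_eq_mul, ← Finset.sum_const]
    refine (Finset.sum_le_sum fun m hm => ?_).trans
      (Finset.sum_le_sum_of_subset_of_nonneg (Finset.filter_subset _ _)
        fun _ _ _ => by positivity)
    have := (Finset.mem_filter.1 hm).2
    nlinarith
  rw [le_div_iff₀ hS]
  have : 0 < recipSum P / 100 := by positivity
  refine le_of_mul_le_mul_right ?_ this
  linarith

lemma sum_inv_sq_le (Q : ℕ) : ∑ d ∈ Finset.Icc 2 Q, (1 / (d : ℝ) ^ 2) ≤ 3 / 4 := by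
  have h (k : ℕ) : ∑ d ∈ Finset.Icc 2 (k + 2), (1 / (d : ℝ) ^ 2) ≤ 3 / 4 - 1 / (k + 2 : ℝ) := by
    induction k with
    | zero => norm_num
    | succ k ih =>
      rw [show k + 1 + 2 = (k + 2) + 1 by ring, Finset.sum_Icc_succ_top (by omega)]
      refine (add_le_add_left ih _).trans ?_
      push_cast
      have : 1 / ((k : ℝ) + 2 + 1) ^ 2 ≤ 1 / (k + 2 : ℝ) - 1 / (k + 1 + 2) := by
        rw [div_sub_div _ _ (by positivity) (by positivity),
          div_le_div_iff₀ (by positivity) (by positivity)]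
        nlinarith
      linarith
  rcases Nat.lt_or_ge Q 2 with hQ | hQ
  · rw [Finset.Icc_eq_empty (by omega)]; norm_num
  · obtain ⟨k, rfl⟩ := Nat.exists_eq_add_of_le' hQ
    have : 0 ≤ 1 / (k + 2 : ℝ) := by positivity
    linarith [h k]

/-- At least a quarter of the pairs in `[1, Q]²` are coprime. -/
lemma card_coprime_pairs_ge (Q : ℕ) :
    (Q : ℝ) ^ 2 / 4 ≤ (((Finset.Icc 1 Q ×ˢ Finset.Icc 1 Q).filter
      fun x => Nat.Coprime x.1 x.2).card : ℝ) := by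
  have h1 := Finset.card_filter_add_card_filter_not (s := Finset.Icc 1 Q ×ˢ Finset.Icc 1 Q)
    (fun x => Nat.Coprime x.1 x.2)
  have h2 : (((Finset.Icc 1 Q ×ˢ Finset.Icc 1 Q).filter
      fun x => ¬ Nat.Coprime x.1 x.2).card : ℝ) ≤ ∑ d ∈ Finset.Icc 2 Q, (Q / d : ℝ) ^ 2 := by
    have : (Finset.Icc 1 Q ×ˢ Finset.Icc 1 Q).filter (fun x => ¬ Nat.Coprime x.1 x.2) ⊆
        (Finset.Icc 2 Q).biUnion fun d =>
          (Finset.Icc 1 Q).filter (d ∣ ·) ×ˢ (Finset.Icc 1 Q).filter (d ∣ ·) := by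
      rintro ⟨a, b⟩ h
      simp only [Finset.mem_filter, Finset.mem_product, Finset.mem_Icc] at h
      obtain ⟨⟨⟨ha, haQ⟩, hb, hbQ⟩, h⟩ := h
      simp only [Finset.mem_biUnion, Finset.mem_product, Finset.mem_filter, Finset.mem_Icc]
      refine ⟨Nat.gcd a b, ⟨?_, (Nat.gcd_le_left b ha).trans haQ⟩, ⟨⟨ha, haQ⟩, Nat.gcd_dvd_left a b⟩,
        ⟨hb, hbQ⟩, Nat.gcd_dvd_right a b⟩
      have : 0 < Nat.gcd a b := Nat.gcd_pos_of_pos_left b ha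
      have : Nat.gcd a b ≠ 1 := h
      omega
    have h3 := (Finset.card_le_card this).trans Finset.card_biUnion_le
    refine (Nat.cast_le.2 h3).trans ?_
    push_cast
    refine Finset.sum_le_sum fun d _ => ?_
    rw [Finset.card_product, sq]
    push_cast
    have := card_multiples_le Q d
    gcongr
  have h4 : ∑ d ∈ Finset.Icc 2 Q, (Q / d : ℝ) ^ 2 ≤ (Q : ℝ) ^ 2 * (3 / 4) := by
    refine le_trans (le_of_eq ?_) (mul_le_mul_of_nonneg_left (sum_inv_sq_le Q) (sq_nonneg _))
    rw [Finset.mul_sum]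
    exact Finset.sum_congr rfl fun d _ => by rw [div_pow, mul_one_div]
  have h5 : ((Finset.Icc 1 Q ×ˢ Finset.Icc 1 Q).card : ℝ) = (Q : ℝ) ^ 2 := by
    simp [Finset.card_product, sq]
  rw [← h1, Nat.cast_add] at h5
  linarith

lemma sum_divisorCountIn_gcd_le {P : Finset ℕ} (hP : ∀ p ∈ P, p.Prime) (N T : ℕ) :
    ∑ x ∈ Finset.Icc 1 N ×ˢ Finset.Icc 1 T, (divisorCountIn P (Nat.gcd x.1 x.2) : ℝ) ≤
      N * T := by
  simp_rw [divisorCountIn_eq_sum]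
  rw [Finset.sum_comm]
  have h1 : ∑ p ∈ P, (1 / (p : ℝ) ^ 2) ≤ 1 := by
    have : P ⊆ Finset.Icc 2 (P.sup id) := fun p hp =>
      Finset.mem_Icc.2 ⟨(hP p hp).two_le, Finset.le_sup (f := id) hp⟩
    refine (Finset.sum_le_sum_of_subset_of_nonneg this fun _ _ _ => by positivity).trans ?_
    linarith [sum_inv_sq_le (P.sup id)]
  calc _ ≤ ∑ p ∈ P, (N * T : ℝ) * (1 / (p : ℝ) ^ 2) := by
        refine Finset.sum_le_sum fun p _ => ?_
        have : (Finset.Icc 1 N ×ˢ Finset.Icc 1 T).filter (fun x => p ∣ Nat.gcd x.1 x.2) =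
            (Finset.Icc 1 N).filter (p ∣ ·) ×ˢ (Finset.Icc 1 T).filter (p ∣ ·) := by
          ext x
          simp only [Finset.mem_filter, Finset.mem_product, Nat.dvd_gcd_iff]
          tauto
        rw [← Finset.sum_filter, Finset.sum_const, nsmul_eq_mul, mul_one, this,
          Finset.card_product]
        push_cast
        refine (mul_le_mul (card_multiples_le N p) (card_multiples_le T p) (by positivity)
          (by positivity)).trans_eq ?_
        rw [div_mul_div_comm, mul_one_div, sq]
    _ ≤ _ := by
        rw [← Finset.mul_sum]
        exact mul_le_of_le_one_right (by positivity) h1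

lemma card_large_divisorCountIn_gcd_le {P : Finset ℕ} (hP : ∀ p ∈ P, p.Prime) (N T : ℕ)
    (hS : 0 < recipSum P) :
    (((Finset.Icc 1 N ×ˢ Finset.Icc 1 T).filter fun x =>
      recipSum P / 10 ≤ divisorCountIn P (Nat.gcd x.1 x.2)).card : ℝ) ≤
      10 * (N * T) / recipSum P := by
  rw [le_div_iff₀ hS]
  have : (((Finset.Icc 1 N ×ˢ Finset.Icc 1 T).filter fun x =>
      recipSum P / 10 ≤ divisorCountIn P (Nat.gcd x.1 x.2)).card : ℝ) * (recipSum P / 10) ≤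
      N * T := by
    refine le_trans ?_ (sum_divisorCountIn_gcd_le hP N T)
    rw [← nsmul_eq_mul, ← Finset.sum_const]
    exact (Finset.sum_le_sum fun x hx => (Finset.mem_filter.1 hx).2).trans
      (Finset.sum_le_sum_of_subset_of_nonneg (Finset.filter_subset _ _)
        fun _ _ _ => by positivity)
  linarith

lemma divisorCountIn_add_le {P : Finset ℕ} (a b : ℕ) :
    divisorCountIn P a + divisorCountIn P b ≤
      divisorCountIn P (a * b) + divisorCountIn P (Nat.gcd a b) := by
  unfold divisorCountIn
  rw [← Finset.card_union_add_card_inter]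
  refine add_le_add (Finset.card_le_card ?_) (Finset.card_le_card ?_)
  · intro p
    simp only [Finset.mem_union, Finset.mem_filter]
    rintro (⟨h1, h2⟩ | ⟨h1, h2⟩)
    · exact ⟨h1, h2.mul_right _⟩
    · exact ⟨h1, h2.mul_left _⟩
  · intro p
    simp only [Finset.mem_inter, Finset.mem_filter]
    rintro ⟨⟨h1, h2⟩, -, h3⟩
    exact ⟨h1, Nat.dvd_gcd h2 h3⟩

lemma card_pairs_small_mul_le {P : Finset ℕ} (hP : ∀ p ∈ P, p.Prime) {N T : ℕ}
    (hN : P.card ≤ N) (hT : P.card ≤ T) (hS : 0 < recipSum P) :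
    (((Finset.Icc 1 N ×ˢ Finset.Icc 1 T).filter fun x =>
      (divisorCountIn P (x.1 * x.2) : ℝ) < 17 / 10 * recipSum P).card : ℝ) ≤
      610 * (N * T) / recipSum P := by
  set A := (Finset.Icc 1 N).filter fun m => (divisorCountIn P m : ℝ) < 9 / 10 * recipSum P
  set B := (Finset.Icc 1 T).filter fun m => (divisorCountIn P m : ℝ) < 9 / 10 * recipSum P
  set C := (Finset.Icc 1 N ×ˢ Finset.Icc 1 T).filter fun x =>
      recipSum P / 10 ≤ divisorCountIn P (Nat.gcd x.1 x.2)
  have hsub : ((Finset.Icc 1 N ×ˢ Finset.Icc 1 T).filter fun x =>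
      (divisorCountIn P (x.1 * x.2) : ℝ) < 17 / 10 * recipSum P) ⊆
      (A ×ˢ Finset.Icc 1 T ∪ Finset.Icc 1 N ×ˢ B) ∪ C := by
    rintro ⟨a, t⟩ h
    simp only [Finset.mem_filter, Finset.mem_product] at h
    by_contra hc
    simp only [A, B, C, Finset.mem_union, Finset.mem_filter, Finset.mem_product, not_or, h.1,
      true_and, and_true, not_lt, not_le] at hc
    have h2 : (divisorCountIn P a : ℝ) + divisorCountIn P t ≤
      divisorCountIn P (a * t) + divisorCountIn P (Nat.gcd a t) := by
      exact_mod_cast divisorCountIn_add_le a t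
    linarith [hc.1.1, hc.1.2, hc.2, h.2]
  have h1 : (A.card : ℝ) ≤ _ := card_small_divisorCountIn_le hP hN hS
  have h2 : (B.card : ℝ) ≤ _ := card_small_divisorCountIn_le hP hT hS
  have h3 : (C.card : ℝ) ≤ _ := card_large_divisorCountIn_gcd_le hP N T hS
  have h4 := (Finset.card_le_card hsub).trans
    ((Finset.card_union_le _ _).trans (Nat.add_le_add_right (Finset.card_union_le _ _) _))
  simp only [Finset.card_product, Nat.card_Icc, Nat.add_sub_cancel] at h4
  refine (Nat.cast_le.2 h4).trans ?_
  push_cast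
  calc _ ≤ 300 * N / recipSum P * T + N * (300 * T / recipSum P) +
        10 * (N * T) / recipSum P := by gcongr
    _ = _ := by ring

/-- Most pairs of coprime `p, q ≤ Q` and `t ≤ T` are such that `p t`, `q t` and `(p + q) t` all
have many divisors in `P`. -/
lemma card_good_triples_ge {P : Finset ℕ} (hP : ∀ p ∈ P, p.Prime) {Q T : ℕ}
    (hQ : P.card ≤ Q) (hT : P.card ≤ T) (hS : 19520 ≤ recipSum P) :
    (Q : ℝ) ^ 2 * T / 8 ≤
      (((Finset.Icc 1 Q ×ˢ Finset.Icc 1 Q ×ˢ Finset.Icc 1 T).filter fun x =>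
        Nat.Coprime x.1 x.2.1 ∧ 17 / 10 * recipSum P ≤ divisorCountIn P (x.1 * x.2.2) ∧
        17 / 10 * recipSum P ≤ divisorCountIn P (x.2.1 * x.2.2) ∧
        17 / 10 * recipSum P ≤ divisorCountIn P ((x.1 + x.2.1) * x.2.2)).card : ℝ) := by
  have hS0 : 0 < recipSum P := by linarith
  set K := 17 / 10 * recipSum P
  set G := (Finset.Icc 1 Q ×ˢ Finset.Icc 1 Q ×ˢ Finset.Icc 1 T).filter fun x =>
        Nat.Coprime x.1 x.2.1 ∧ K ≤ divisorCountIn P (x.1 * x.2.2) ∧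
        K ≤ divisorCountIn P (x.2.1 * x.2.2) ∧
        K ≤ divisorCountIn P ((x.1 + x.2.1) * x.2.2)
  let B (N : ℕ) := (Finset.Icc 1 N ×ˢ Finset.Icc 1 T).filter fun x =>
      (divisorCountIn P (x.1 * x.2) : ℝ) < K
  let C := (Finset.Icc 1 Q ×ˢ Finset.Icc 1 Q).filter fun x => Nat.Coprime x.1 x.2
  have hsub : (C ×ˢ Finset.Icc 1 T).card ≤
      G.card + (B Q ×ˢ Finset.Icc 1 Q).card + (B Q ×ˢ Finset.Icc 1 Q).card +
        (B (2 * Q) ×ˢ Finset.Icc 1 Q).card := by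
    have : C ×ˢ Finset.Icc 1 T ⊆
        ((G.image (fun x => ((x.1, x.2.1), x.2.2)) ∪
          (B Q ×ˢ Finset.Icc 1 Q).image (fun x => ((x.1.1, x.2), x.1.2))) ∪
          (B Q ×ˢ Finset.Icc 1 Q).image (fun x => ((x.2, x.1.1), x.1.2))) ∪
          (B (2 * Q) ×ˢ Finset.Icc 1 Q).image (fun x => ((x.2, x.1.1 - x.2), x.1.2)) := by
      rintro ⟨⟨p, q⟩, t⟩ h
      simp only [C, Finset.mem_product, Finset.mem_filter, Finset.mem_Icc] at h
      obtain ⟨⟨⟨hp, hq⟩, hpq⟩, ht⟩ := h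
      simp only [Finset.mem_union, Finset.mem_image]
      by_cases h1 : K ≤ divisorCountIn P (p * t)
      · by_cases h2 : K ≤ divisorCountIn P (q * t)
        · by_cases h3 : K ≤ divisorCountIn P ((p + q) * t)
          · refine Or.inl <| Or.inl <| Or.inl ⟨(p, q, t), ?_, rfl⟩
            simp only [G, Finset.mem_product, Finset.mem_filter, Finset.mem_Icc]
            exact ⟨⟨hp, hq, ht⟩, hpq, h1, h2, h3⟩
          · refine Or.inr ⟨((p + q, t), p), ?_, by simp⟩
            simp only [B, Finset.mem_product, Finset.mem_filter, Finset.mem_Icc]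
            exact ⟨⟨⟨⟨by omega, by omega⟩, ht⟩, not_le.1 h3⟩, hp⟩
        · refine Or.inl <| Or.inr ⟨((q, t), p), ?_, rfl⟩
          simp only [B, Finset.mem_product, Finset.mem_filter, Finset.mem_Icc]
          exact ⟨⟨⟨hq, ht⟩, not_le.1 h2⟩, hp⟩
      · refine Or.inl <| Or.inl <| Or.inr ⟨((p, t), q), ?_, rfl⟩
        simp only [B, Finset.mem_product, Finset.mem_filter, Finset.mem_Icc]
        exact ⟨⟨⟨hp, ht⟩, not_le.1 h1⟩, hq⟩
    refine (Finset.card_le_card this).trans ?_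
    refine (Finset.card_union_le _ _).trans (add_le_add ?_ Finset.card_image_le)
    refine (Finset.card_union_le _ _).trans (add_le_add ?_ Finset.card_image_le)
    exact (Finset.card_union_le _ _).trans (add_le_add Finset.card_image_le Finset.card_image_le)
  simp only [Finset.card_product, Nat.card_Icc, Nat.add_sub_cancel] at hsub
  have hC : (Q : ℝ) ^ 2 / 4 ≤ C.card := card_coprime_pairs_ge Q
  have hB1 : ((B Q).card : ℝ) ≤ _ := card_pairs_small_mul_le hP hQ hT hS0
  have hB2 : ((B (2 * Q)).card : ℝ) ≤ _ :=
    card_pairs_small_mul_le hP (hQ.trans (by omega)) hT hS0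
  have hsub' : (C.card * T : ℝ) ≤
      G.card + (B Q).card * Q + (B Q).card * Q + (B (2 * Q)).card * Q := by exact_mod_cast hsub
  have hb (x : ℝ) (hx : 0 ≤ x) : 610 * x / recipSum P ≤ x / 32 := by
    rw [div_le_div_iff₀ hS0 (by norm_num)]
    nlinarith
  have hB1' := mul_le_mul_of_nonneg_right (hB1.trans (hb _ (by positivity)))
    (Nat.cast_nonneg (α := ℝ) Q)
  have hB2' := mul_le_mul_of_nonneg_right (hB2.trans (hb _ (by positivity)))
    (Nat.cast_nonneg (α := ℝ) Q)
  have hC' := mul_le_mul_of_nonneg_right hC (Nat.cast_nonneg (α := ℝ) T)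
  push_cast at hB2'
  linarith

/-- A weak form of Mertens' second theorem. -/
lemma log_le_exp_recipSum (Q : ℕ) :
    Real.log (Q + 1) ≤ Real.exp (2 * recipSum (Q + 1).primesBelow) := by
  let f : ℕ →* ℝ :=
    { toFun := fun n => (n : ℝ)⁻¹
      map_one' := by simp
      map_mul' := fun a b => by push_cast; rw [mul_inv] }
  have hf {p : ℕ} (hp : p.Prime) : ‖f p‖ < 1 := by
    change ‖(p : ℝ)⁻¹‖ < 1
    rw [norm_inv, Real.norm_natCast]
    exact inv_lt_one_of_one_lt₀ (by exact_mod_cast hp.one_lt)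
  obtain ⟨hs, hsum⟩ :=
    EulerProduct.summable_and_hasSum_smoothNumbers_prod_primesBelow_geometric hf (Q + 1)
  calc Real.log (Q + 1) ≤ ∑ n ∈ Finset.Icc 1 Q, (n : ℝ)⁻¹ := by
        have := log_add_one_le_harmonic Q
        rw [harmonic_eq_sum_Icc] at this
        push_cast at this
        exact this
    _ = ∑ m ∈ (Finset.Icc 1 Q).subtype (· ∈ (Q + 1).smoothNumbers), f m := by
        rw [Finset.sum_subtype_of_mem (fun m => f m)]
        · rfl
        · intro m hm
          obtain ⟨h1, h2⟩ := Finset.mem_Icc.1 hm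
          exact Nat.mem_smoothNumbers_of_lt h1 (by omega)
    _ ≤ ∏ p ∈ (Q + 1).primesBelow, (1 - f p)⁻¹ :=
        sum_le_hasSum _ (fun m _ => inv_nonneg.2 (Nat.cast_nonneg _)) hsum
    _ ≤ ∏ p ∈ (Q + 1).primesBelow, Real.exp (2 * (1 / p)) := by
        refine Finset.prod_le_prod (fun p hp => ?_) fun p hp => ?_
        · have := hf (Nat.prime_of_mem_primesBelow hp)
          exact inv_nonneg.2 (by linarith [Real.le_norm_self (f p)])
        · have hp2 : (2 : ℝ) ≤ p := by exact_mod_cast (Nat.prime_of_mem_primesBelow hp).two_le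
          rw [one_div]
          change (1 - (p : ℝ)⁻¹)⁻¹ ≤ _
          have hx : (p : ℝ)⁻¹ ≤ 1 / 2 := by rw [one_div]; gcongr
          have hx0 : 0 ≤ (p : ℝ)⁻¹ := by positivity
          set x := (p : ℝ)⁻¹
          rw [inv_le_iff_one_le_mul₀ (by linarith)]
          nlinarith [Real.add_one_le_exp (2 * x)]
    _ = _ := by rw [← Real.exp_sum, recipSum, Finset.mul_sum]

/-- The projective line with equation `a x + b y + c z = 0`. -/
def projLine (a b c : ℝ) : Submodule ℝ (Fin 3 → ℝ) :=
  LinearMap.ker (a • LinearMap.proj 0 + b • LinearMap.proj 1 + c • LinearMap.proj 2 :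
    (Fin 3 → ℝ) →ₗ[ℝ] ℝ)

/-- The projective point with homogeneous coordinates `[x : y : z]`. -/
def projPoint (x y z : ℝ) : Submodule ℝ (Fin 3 → ℝ) := Submodule.span ℝ {![x, y, z]}

lemma mem_projLine {a b c : ℝ} {v : Fin 3 → ℝ} :
    v ∈ projLine a b c ↔ a * v 0 + b * v 1 + c * v 2 = 0 := by
  simp [projLine]

lemma projPoint_le_iff {x y z : ℝ} {l : Submodule ℝ (Fin 3 → ℝ)} :
    projPoint x y z ≤ l ↔ ![x, y, z] ∈ l := by
  rw [projPoint, Submodule.span_singleton_le_iff_mem]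

lemma projPoint_le_projLine {x y z a b c : ℝ} :
    projPoint x y z ≤ projLine a b c ↔ a * x + b * y + c * z = 0 := by
  rw [projPoint_le_iff, mem_projLine]; simp

lemma isProjPoint_projPoint {x y z : ℝ} (h : ![x, y, z] ≠ 0) : IsProjPoint (projPoint x y z) :=
  finrank_span_singleton h

lemma isProjLine_projLine {a b c : ℝ} {v : Fin 3 → ℝ} (h : v ∉ projLine a b c) :
    IsProjLine (projLine a b c) := by
  have := Module.Dual.finrank_ker_add_one_of_ne_zero (K := ℝ)
    (f := (a • LinearMap.proj 0 + b • LinearMap.proj 1 + c • LinearMap.proj 2 :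
    (Fin 3 → ℝ) →ₗ[ℝ] ℝ)) (by
      intro h0
      apply h
      rw [projLine, h0]
      simp)
  rw [Module.finrank_fin_fun] at this
  unfold IsProjLine projLine
  omega

lemma isPencil_map {M : Finset ℝ} {x y z : ℝ} (hp : ![x, y, z] ≠ 0)
    (f : ℝ ↪ Submodule ℝ (Fin 3 → ℝ)) (hf : ∀ m, IsProjLine (f m) ∧ projPoint x y z ≤ f m) :
    IsPencil M.card (projPoint x y z) (M.map f) := by
  refine ⟨isProjPoint_projPoint hp, Finset.card_map _, fun l hl => ?_⟩
  obtain ⟨m, -, rfl⟩ := Finset.mem_map.1 hl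
  exact hf m

lemma eq_projPoint_of_le {q : Submodule ℝ (Fin 3 → ℝ)} (hq : IsProjPoint q) {x y : ℝ}
    (h1 : q ≤ projLine 1 0 (-x)) (h2 : q ≤ projLine 0 1 (-y)) : q = projPoint x y 1 := by
  refine Submodule.eq_of_le_of_finrank_eq (fun v hv => ?_)
    (hq.trans (isProjPoint_projPoint (by simp)).symm)
  have e1 := mem_projLine.1 (h1 hv)
  have e2 := mem_projLine.1 (h2 hv)
  refine Submodule.mem_span_singleton.2 ⟨v 2, ?_⟩
  ext i
  fin_cases i <;> simp <;> linarith

lemma projPoint_one_injective : Function.Injective fun x : ℝ × ℝ => projPoint x.1 x.2 1 := by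
  rintro ⟨x, y⟩ ⟨x', y'⟩ h
  have h1 : projPoint x y 1 ≤ projLine 1 0 (-x') := by
    rw [show projPoint x y 1 = projPoint x' y' 1 from h, projPoint_le_projLine]; ring
  have h2 : projPoint x y 1 ≤ projLine 0 1 (-y') := by
    rw [show projPoint x y 1 = projPoint x' y' 1 from h, projPoint_le_projLine]; ring
  rw [projPoint_le_projLine] at h1 h2
  ext <;> simp <;> linarith

/-- A planar point set whose horizontal, vertical and diagonal projections lie in `M` and whose
slopes lie in `D` is a set of 4-rich points of four pencils. -/
lemma exists_pencils_of_projections {n : ℕ} {M D : Finset ℝ} (hM : M.card = n) (hD : D.card = n)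
    (G : Finset (ℝ × ℝ)) (hG : ∀ x ∈ G, x.1 ∈ M ∧ x.2 ∈ M ∧ x.1 + x.2 ∈ M ∧
      ∃ r ∈ D, x.2 = r * x.1) :
    ∃ (p₁ p₂ p₃ p₄ : Submodule ℝ (Fin 3 → ℝ))
        (L₁ L₂ L₃ L₄ : Finset (Submodule ℝ (Fin 3 → ℝ))),
        IsPencil n p₁ L₁ ∧ IsPencil n p₂ L₂ ∧ IsPencil n p₃ L₃ ∧ IsPencil n p₄ L₄ ∧
        p₁ ≠ p₂ ∧ p₁ ≠ p₃ ∧ p₁ ≠ p₄ ∧ p₂ ≠ p₃ ∧ p₂ ≠ p₄ ∧ p₃ ≠ p₄ ∧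
        (¬ ∃ l, IsProjLine l ∧ p₁ ≤ l ∧ p₂ ≤ l ∧ p₃ ≤ l ∧ p₄ ≤ l) ∧
        G.card ≤ (RichPoints4 L₁ L₂ L₃ L₄).ncard := by
  let f₁ : ℝ ↪ Submodule ℝ (Fin 3 → ℝ) := ⟨fun m => projLine 1 0 (-m), fun m m' h => by
    have : projPoint m 0 1 ≤ projLine 1 0 (-m') := by
      rw [← show projLine 1 0 (-m) = projLine 1 0 (-m') from h, projPoint_le_projLine]; ring
    rw [projPoint_le_projLine] at this; linarith⟩
  let f₂ : ℝ ↪ Submodule ℝ (Fin 3 → ℝ) := ⟨fun m => projLine 0 1 (-m), fun m m' h => by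
    have : projPoint 0 m 1 ≤ projLine 0 1 (-m') := by
      rw [← show projLine 0 1 (-m) = projLine 0 1 (-m') from h, projPoint_le_projLine]; ring
    rw [projPoint_le_projLine] at this; linarith⟩
  let f₃ : ℝ ↪ Submodule ℝ (Fin 3 → ℝ) := ⟨fun m => projLine 1 1 (-m), fun m m' h => by
    have : projPoint m 0 1 ≤ projLine 1 1 (-m') := by
      rw [← show projLine 1 1 (-m) = projLine 1 1 (-m') from h, projPoint_le_projLine]; ring
    rw [projPoint_le_projLine] at this; linarith⟩
  let f₄ : ℝ ↪ Submodule ℝ (Fin 3 → ℝ) := ⟨fun r => projLine r (-1) 0, fun r r' h => by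
    have : projPoint 1 r 0 ≤ projLine r' (-1) 0 := by
      rw [← show projLine r (-1) 0 = projLine r' (-1) 0 from h, projPoint_le_projLine]; ring
    rw [projPoint_le_projLine] at this; linarith⟩
  have ne_of_line {p q : Submodule ℝ (Fin 3 → ℝ)} (a b c : ℝ) (h1 : p ≤ projLine a b c)
      (h2 : ¬ q ≤ projLine a b c) : p ≠ q := fun h => h2 (h ▸ h1)
  refine ⟨projPoint 0 1 0, projPoint 1 0 0, projPoint 1 (-1) 0, projPoint 0 0 1,
    M.map f₁, M.map f₂, M.map f₃, D.map f₄, ?_, ?_, ?_, ?_, ?_, ?_, ?_, ?_, ?_, ?_, ?_, ?_⟩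
  · rw [← hM]
    refine isPencil_map (by simp) f₁ fun m => ⟨isProjLine_projLine (v := ![1, 0, 0]) ?_, ?_⟩
    · simp [mem_projLine]
    · exact projPoint_le_projLine.2 (by ring)
  · rw [← hM]
    refine isPencil_map (by simp) f₂ fun m => ⟨isProjLine_projLine (v := ![0, 1, 0]) ?_, ?_⟩
    · simp [mem_projLine]
    · exact projPoint_le_projLine.2 (by ring)
  · rw [← hM]
    refine isPencil_map (by simp) f₃ fun m => ⟨isProjLine_projLine (v := ![0, 1, 0]) ?_, ?_⟩
    · simp [mem_projLine]
    · exact projPoint_le_projLine.2 (by ring)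
  · rw [← hD]
    refine isPencil_map (by simp) f₄ fun m => ⟨isProjLine_projLine (v := ![0, 1, 0]) ?_, ?_⟩
    · simp [mem_projLine]
    · exact projPoint_le_projLine.2 (by ring)
  · refine ne_of_line 1 0 0 ?_ ?_ <;> simp [projPoint_le_projLine]
  · refine ne_of_line 1 0 0 ?_ ?_ <;> simp [projPoint_le_projLine]
  · refine ne_of_line 0 0 1 ?_ ?_ <;> simp [projPoint_le_projLine]
  · refine ne_of_line 0 1 0 ?_ ?_ <;> simp [projPoint_le_projLine]
  · refine ne_of_line 0 0 1 ?_ ?_ <;> simp [projPoint_le_projLine]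
  · refine ne_of_line 0 0 1 ?_ ?_ <;> simp [projPoint_le_projLine]
  · rintro ⟨l, hl, h1, h2, -, h4⟩
    rw [projPoint_le_iff] at h1 h2 h4
    have : l = ⊤ := by
      refine Submodule.eq_top_iff'.2 fun v => ?_
      have : v = v 0 • ![1, 0, 0] + v 1 • ![0, 1, 0] + v 2 • ![0, 0, 1] := by
        ext i; fin_cases i <;> simp
      rw [this]
      exact l.add_mem (l.add_mem (l.smul_mem _ h2) (l.smul_mem _ h1)) (l.smul_mem _ h4)
    rw [IsProjLine, this, finrank_top, Module.finrank_fin_fun] at hl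
    omega
  · have hfin : (RichPoints4 (M.map f₁) (M.map f₂) (M.map f₃) (D.map f₄)).Finite := by
      refine ((M ×ˢ M).finite_toSet.image fun x => projPoint x.1 x.2 1).subset ?_
      rintro q ⟨hq, ⟨l, hl, hql⟩, ⟨l', hl', hql'⟩, -⟩
      obtain ⟨x, hx, rfl⟩ := Finset.mem_map.1 hl
      obtain ⟨y, hy, rfl⟩ := Finset.mem_map.1 hl'
      exact ⟨(x, y), by simp [hx, hy], (eq_projPoint_of_le hq hql hql').symm⟩
    rw [← Set.ncard_coe_finset, ← Set.ncard_image_of_injective _ projPoint_one_injective]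
    refine Set.ncard_le_ncard ?_ hfin
    rintro _ ⟨⟨x, y⟩, hxy, rfl⟩
    obtain ⟨h1, h2, h3, r, hr, h4⟩ := hG _ hxy
    dsimp only at h1 h2 h3 h4
    refine ⟨isProjPoint_projPoint (by simp), ⟨_, Finset.mem_map_of_mem f₁ h1, ?_⟩,
      ⟨_, Finset.mem_map_of_mem f₂ h2, ?_⟩, ⟨_, Finset.mem_map_of_mem f₃ h3, ?_⟩,
      ⟨_, Finset.mem_map_of_mem f₄ hr, ?_⟩⟩
    · exact projPoint_le_projLine.2 (by ring)
    · exact projPoint_le_projLine.2 (by ring)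
    · exact projPoint_le_projLine.2 (by ring)
    · exact projPoint_le_projLine.2 (by dsimp only; rw [h4]; ring)

/-- Coprime `p, q ≤ Q` and `t ≤ T` are determined by the point `(q t, p t)`; if the multiples
`p t`, `q t`, `(p + q) t` all lie in a set of at most `Q²` integers, these points give many 4-rich
points. -/
lemma exists_pencils_of_triples {Q : ℕ} {A : Finset ℕ} (hA : A.card ≤ Q ^ 2)
    (G : Finset (ℕ × ℕ × ℕ)) (hG : ∀ x ∈ G, x.1 ∈ Finset.Icc 1 Q ∧ x.2.1 ∈ Finset.Icc 1 Q ∧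
      1 ≤ x.2.2 ∧ Nat.Coprime x.1 x.2.1 ∧ x.1 * x.2.2 ∈ A ∧ x.2.1 * x.2.2 ∈ A ∧
      (x.1 + x.2.1) * x.2.2 ∈ A) :
    ∃ (p₁ p₂ p₃ p₄ : Submodule ℝ (Fin 3 → ℝ))
        (L₁ L₂ L₃ L₄ : Finset (Submodule ℝ (Fin 3 → ℝ))),
        IsPencil (Q ^ 2) p₁ L₁ ∧ IsPencil (Q ^ 2) p₂ L₂ ∧ IsPencil (Q ^ 2) p₃ L₃ ∧
        IsPencil (Q ^ 2) p₄ L₄ ∧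
        p₁ ≠ p₂ ∧ p₁ ≠ p₃ ∧ p₁ ≠ p₄ ∧ p₂ ≠ p₃ ∧ p₂ ≠ p₄ ∧ p₃ ≠ p₄ ∧
        (¬ ∃ l, IsProjLine l ∧ p₁ ≤ l ∧ p₂ ≤ l ∧ p₃ ≤ l ∧ p₄ ≤ l) ∧
        G.card ≤ (RichPoints4 L₁ L₂ L₃ L₄).ncard := by
  classical
  obtain ⟨M, hAM, hM⟩ := Infinite.exists_superset_card_eq (A.image (Nat.cast : ℕ → ℝ)) (Q ^ 2)
    (Finset.card_image_le.trans hA)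
  obtain ⟨D, hQD, hD⟩ := Infinite.exists_superset_card_eq
    ((Finset.Icc 1 Q ×ˢ Finset.Icc 1 Q).image fun x => (x.1 / x.2 : ℝ)) (Q ^ 2)
    (Finset.card_image_le.trans (by simp [sq]))
  have hAM' {a : ℕ} (ha : a ∈ A) : (a : ℝ) ∈ M := hAM (Finset.mem_image_of_mem _ ha)
  let φ (x : ℕ × ℕ × ℕ) : ℝ × ℝ := ((x.2.1 * x.2.2 : ℕ), (x.1 * x.2.2 : ℕ))
  have hφ : Set.InjOn φ G := by
    rintro ⟨p, q, t⟩ h ⟨p', q', t'⟩ h' he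
    obtain ⟨h1, h2, h3, hc, -⟩ := hG _ h
    obtain ⟨h1', h2', h3', hc', -⟩ := hG _ h'
    simp only [φ, Prod.mk.injEq, Nat.cast_inj] at he
    dsimp only at h3 hc h3' hc'
    have ht : t = t' := by
      have e : Nat.gcd (p * t) (q * t) = Nat.gcd (p' * t') (q' * t') := by rw [he.1, he.2]
      rwa [Nat.gcd_mul_right, Nat.gcd_mul_right, hc.gcd_eq_one, hc'.gcd_eq_one, one_mul,
        one_mul] at e
    subst ht
    rw [Nat.eq_of_mul_eq_mul_right h3 he.1, Nat.eq_of_mul_eq_mul_right h3 he.2]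
  rw [← Finset.card_image_of_injOn hφ]
  refine exists_pencils_of_projections hM hD _ fun x hx => ?_
  obtain ⟨⟨p, q, t⟩, hg, rfl⟩ := Finset.mem_image.1 hx
  obtain ⟨h1, h2, -, -, h4, h5, h6⟩ := hG _ hg
  dsimp only at h1 h2 h4 h5 h6
  refine ⟨hAM' h5, hAM' h4, ?_, p / q, hQD (Finset.mem_image.2 ⟨(p, q), by simp_all, rfl⟩), ?_⟩
  · have := hAM' h6
    simp only [φ]
    convert this using 1
    push_cast
    ring
  · have : (q : ℝ) ≠ 0 := by
      have := (Finset.mem_Icc.1 h2).1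
      positivity
    simp only [φ]
    push_cast
    field_simp

lemma exp_mul_exp_le_two_rpow {S : ℝ} (hS : 0 ≤ S) :
    Real.exp (17 / 100 * S) * Real.exp S ≤ 2 ^ (17 / 10 * S) := by
  rw [← Real.exp_add, Real.rpow_def_of_pos (by norm_num)]
  refine Real.exp_le_exp.2 ?_
  nlinarith [Real.log_two_gt_d9]

lemma tendsto_log_log_nat :
    Filter.Tendsto (fun Q : ℕ => Real.log (Real.log (Q + 1))) Filter.atTop Filter.atTop :=
  Real.tendsto_log_atTop.comp <| Real.tendsto_log_atTop.comp <|
    Filter.tendsto_atTop_add_const_right _ _ tendsto_natCast_atTop_atTop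

theorem four_rich_points_lower_bound_log :
    ∃ c : ℝ, 0 < c ∧ ∀ N : ℕ, ∃ n : ℕ, N ≤ n ∧
      ∃ (p₁ p₂ p₃ p₄ : Submodule ℝ (Fin 3 → ℝ))
        (L₁ L₂ L₃ L₄ : Finset (Submodule ℝ (Fin 3 → ℝ))),
        IsPencil n p₁ L₁ ∧ IsPencil n p₂ L₂ ∧ IsPencil n p₃ L₃ ∧ IsPencil n p₄ L₄ ∧
        p₁ ≠ p₂ ∧ p₁ ≠ p₃ ∧ p₁ ≠ p₄ ∧ p₂ ≠ p₃ ∧ p₂ ≠ p₄ ∧ p₃ ≠ p₄ ∧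
        (¬ ∃ l, IsProjLine l ∧ p₁ ≤ l ∧ p₂ ≤ l ∧ p₃ ≤ l ∧ p₄ ≤ l) ∧
        c * (n : ℝ) ^ ((3 : ℝ) / 2) * (Real.log n) ^ ((43 : ℝ) / 1000) ≤
          ((RichPoints4 L₁ L₂ L₃ L₄).ncard : ℝ) := by
  refine ⟨1 / 64, by norm_num, fun N => ?_⟩
  obtain ⟨Q, hQN, hQ⟩ := ((Filter.eventually_ge_atTop (N + 3)).and
    (tendsto_log_log_nat.eventually_ge_atTop (2 * 19520))).exists
  set P := (Q + 1).primesBelow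
  have hP : ∀ p ∈ P, p.Prime := fun p hp => Nat.prime_of_mem_primesBelow hp
  have hPQ : P.card ≤ Q := by
    have : P ⊆ Finset.Icc 1 Q := fun p hp => Finset.mem_Icc.2
      ⟨(hP p hp).one_le, Nat.lt_succ_iff.1 (Nat.lt_of_mem_primesBelow hp)⟩
    simpa using Finset.card_le_card this
  set S := recipSum P
  have hQ1 : (1 : ℝ) ≤ Real.log Q := by
    rw [Real.le_log_iff_exp_le (by exact_mod_cast (by omega : 0 < Q))]
    have : (3 : ℝ) ≤ Q := by exact_mod_cast (by omega : 3 ≤ Q)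
    linarith [Real.exp_one_lt_three]
  have hlogQ : Real.log Q ≤ Real.log (Q + 1) :=
    Real.log_le_log (by exact_mod_cast (by omega : 0 < Q)) (by linarith)
  have hexp : Real.log Q ≤ Real.exp (2 * S) := hlogQ.trans (log_le_exp_recipSum Q)
  have hS : 19520 ≤ S := by
    have := (Real.log_le_iff_le_exp (by linarith)).2 (log_le_exp_recipSum Q)
    linarith
  set E := Real.exp (17 / 100 * S)
  have hE : 2 ≤ E := by linarith [Real.add_one_le_exp (17 / 100 * S)]
  set j := ⌊E / 2⌋₊
  have hj : (j : ℝ) ≤ E / 2 := Nat.floor_le (by positivity)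
  have hj1 : 1 ≤ j := Nat.le_floor (by push_cast; linarith)
  have hj4 : E / 4 ≤ j := by
    have h1 : E / 2 < j + 1 := Nat.lt_floor_add_one _
    have h2 : (1 : ℝ) ≤ j := by exact_mod_cast hj1
    linarith
  have hElog : Real.log Q ^ ((43 : ℝ) / 1000) ≤ E := by
    calc Real.log Q ^ ((43 : ℝ) / 1000) ≤ Real.log Q ^ ((85 : ℝ) / 1000) :=
          Real.rpow_le_rpow_of_exponent_le hQ1 (by norm_num)
      _ ≤ Real.exp (2 * S) ^ ((85 : ℝ) / 1000) := by gcongr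
      _ = E := by rw [← Real.exp_mul]; congr 1; ring
  set A := (Finset.Icc 1 (2 * Q * (Q * j))).filter fun m =>
    17 / 10 * S ≤ (divisorCountIn P m : ℝ)
  have hA : A.card ≤ Q ^ 2 := by
    have h1 : (A.card : ℝ) * 2 ^ (17 / 10 * S) ≤ (2 * Q * (Q * j) : ℕ) * Real.exp S :=
      card_large_divisorCountIn_le hP _ _
    have h2 : ((2 * Q * (Q * j) : ℕ) : ℝ) * Real.exp S ≤ (Q : ℝ) ^ 2 * 2 ^ (17 / 10 * S) := by
      calc ((2 * Q * (Q * j) : ℕ) : ℝ) * Real.exp S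
          = (Q : ℝ) ^ 2 * ((2 * j) * Real.exp S) := by push_cast; ring
        _ ≤ (Q : ℝ) ^ 2 * (E * Real.exp S) := by gcongr; linarith
        _ ≤ _ := by gcongr; exact exp_mul_exp_le_two_rpow (by linarith)
    have h3 := le_of_mul_le_mul_right (h1.trans h2) (by positivity)
    exact_mod_cast h3
  set G := (Finset.Icc 1 Q ×ˢ Finset.Icc 1 Q ×ˢ Finset.Icc 1 (Q * j)).filter fun x =>
        Nat.Coprime x.1 x.2.1 ∧ 17 / 10 * recipSum P ≤ divisorCountIn P (x.1 * x.2.2) ∧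
        17 / 10 * recipSum P ≤ divisorCountIn P (x.2.1 * x.2.2) ∧
        17 / 10 * recipSum P ≤ divisorCountIn P ((x.1 + x.2.1) * x.2.2)
  have hG : (Q : ℝ) ^ 2 * (Q * j : ℕ) / 8 ≤ G.card :=
    card_good_triples_ge hP hPQ (hPQ.trans (Nat.le_mul_of_pos_right _ hj1)) hS
  obtain ⟨p₁, p₂, p₃, p₄, L₁, L₂, L₃, L₄, h1, h2, h3, h4, h5, h6, h7, h8, h9, h10, h11, h12⟩ :=
    exists_pencils_of_triples hA G (by
      rintro ⟨p, q, t⟩ h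
      simp only [G, Finset.mem_filter, Finset.mem_product, Finset.mem_Icc] at h
      obtain ⟨⟨⟨hp, hp'⟩, ⟨hq, hq'⟩, ht, ht'⟩, hc, h1, h2, h3⟩ := h
      simp only [A, Finset.mem_filter, Finset.mem_Icc]
      refine ⟨⟨hp, hp'⟩, ⟨hq, hq'⟩, ht, hc, ⟨⟨Nat.mul_pos hp ht, ?_⟩, h1⟩,
        ⟨⟨Nat.mul_pos hq ht, ?_⟩, h2⟩, ⟨⟨Nat.mul_pos (by omega) ht, ?_⟩, h3⟩⟩ <;>
      exact Nat.mul_le_mul (by omega) ht')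
  refine ⟨Q ^ 2, ?_, p₁, p₂, p₃, p₄, L₁, L₂, L₃, L₄, h1, h2, h3, h4, h5, h6, h7, h8, h9, h10,
    h11, ?_⟩
  · nlinarith
  · refine le_trans ?_ (Nat.cast_le.2 h12)
    refine le_trans ?_ hG
    have e1 : ((Q ^ 2 : ℕ) : ℝ) ^ ((3 : ℝ) / 2) = (Q : ℝ) ^ 3 := by
      rw [Nat.cast_pow, ← Real.rpow_natCast, ← Real.rpow_natCast,
        ← Real.rpow_mul (Nat.cast_nonneg _)]
      norm_num
    have e2 : Real.log ((Q ^ 2 : ℕ) : ℝ) ^ ((43 : ℝ) / 1000) ≤ 2 * E := by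
      rw [Nat.cast_pow, Real.log_pow, Real.mul_rpow (by positivity) (by linarith)]
      refine mul_le_mul ?_ hElog (by positivity) (by norm_num)
      calc ((2 : ℕ) : ℝ) ^ ((43 : ℝ) / 1000) ≤ ((2 : ℕ) : ℝ) ^ (1 : ℝ) :=
            Real.rpow_le_rpow_of_exponent_le (by norm_num) (by norm_num)
        _ = 2 := by norm_num
    rw [e1]
    calc 1 / 64 * (Q : ℝ) ^ 3 * Real.log ((Q ^ 2 : ℕ) : ℝ) ^ ((43 : ℝ) / 1000)
        ≤ 1 / 64 * (Q : ℝ) ^ 3 * (2 * E) := by gcongr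
      _ = (Q : ℝ) ^ 3 * (E / 4) / 8 := by ring
      _ ≤ (Q : ℝ) ^ 3 * j / 8 := by gcongr
      _ = _ := by push_cast; ring
end

section
/- There is an absolute constant c > 0 such that for every N there exists an integer n ≥ N and four n-pencils in the real projective plane, whose four centres are pairwise distinct and in general position (no three of the centres collinear), which determine at least c · n^{3/2} 4-rich points. -/
/-- Three projective points are collinear: they lie on a common projective line. -/
def Collinear3 (p q r : Submodule ℝ (Fin 3 → ℝ)) : Prop :=
  ∃ l, IsProjLine l ∧ p ≤ l ∧ q ≤ l ∧ r ≤ l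

open Module Submodule

/-- Every projective point and every vector lie on a common projective line. -/
lemma IsProjPoint.exists_line {p : Submodule ℝ (Fin 3 → ℝ)} (hp : IsProjPoint p)
    (w : Fin 3 → ℝ) : ∃ l, IsProjLine l ∧ p ≤ l ∧ w ∈ l := by
  have key : ∀ x ∉ p, IsProjLine (p ⊔ span ℝ {x}) := by
    intro x hx
    have hx0 : x ≠ 0 := fun h => hx (h ▸ p.zero_mem)
    have h := finrank_sup_add_finrank_inf_eq p (span ℝ {x})
    have hd : p ⊓ span ℝ {x} = ⊥ :=
      disjoint_iff.mp ((disjoint_span_singleton' hx0).mpr hx)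
    rw [hd, finrank_bot, finrank_span_singleton hx0, hp] at h
    exact h
  by_cases hw : w ∈ p
  · obtain ⟨x, hx⟩ : ∃ x, x ∉ p := by
      by_contra! hall
      have htop : p = ⊤ := eq_top_iff'.mpr hall
      have h3 : finrank ℝ p = 3 := by rw [htop, finrank_top]; simp
      rw [hp] at h3
      omega
    exact ⟨_, key x hx, le_sup_left, mem_sup_left hw⟩
  · exact ⟨_, key w hw, le_sup_left, mem_sup_right (mem_span_singleton_self w)⟩

/-- Infinitely many projective lines pass through a given projective point. -/
lemma IsProjPoint.infinite_lines {p : Submodule ℝ (Fin 3 → ℝ)} (hp : IsProjPoint p) :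
    {l | IsProjLine l ∧ p ≤ l}.Infinite := by
  intro hfin
  have htop : (⊤ : Submodule ℝ (Fin 3 → ℝ)) ∉ hfin.toFinset := by
    intro h
    have h2 : finrank ℝ (⊤ : Submodule ℝ (Fin 3 → ℝ)) = 2 := (hfin.mem_toFinset.mp h).1
    simp at h2
  refine Subspace.biUnion_ne_univ_of_top_notMem htop (Set.eq_univ_of_forall fun w => ?_)
  obtain ⟨l, hl, hpl, hw⟩ := hp.exists_line w
  exact Set.mem_biUnion (hfin.mem_toFinset.mpr ⟨hl, hpl⟩) hw

/-- At most `n` vectors can be covered by the lines of an `n`-pencil with prescribed centre. -/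
lemma IsProjPoint.exists_pencil {p : Submodule ℝ (Fin 3 → ℝ)} (hp : IsProjPoint p) {n : ℕ}
    (S : Finset (Fin 3 → ℝ)) (hS : S.card ≤ n) :
    ∃ L, IsPencil n p L ∧ ∀ w ∈ S, ∃ l ∈ L, w ∈ l := by
  classical
  choose f hf hpf hwf using hp.exists_line
  have := hp.infinite_lines.to_subtype
  let F : (Fin 3 → ℝ) → {l | IsProjLine l ∧ p ≤ l} := fun w => ⟨f w, hf w, hpf w⟩
  obtain ⟨T, hT, hcard⟩ :=
    Infinite.exists_superset_card_eq (S.image F) n (Finset.card_image_le.trans hS)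
  refine ⟨T.map (Function.Embedding.subtype _), ⟨hp, by simpa using hcard, ?_⟩, fun w hw => ?_⟩
  · intro l hl
    obtain ⟨x, -, rfl⟩ := Finset.mem_map.mp hl
    exact x.2
  · exact ⟨f w, Finset.mem_map.mpr ⟨F w, hT (Finset.mem_image_of_mem F hw), rfl⟩, hwf w⟩

/-- A projective point on two distinct projective lines is their intersection. -/
lemma IsProjPoint.eq_inf {q l m : Submodule ℝ (Fin 3 → ℝ)} (hq : IsProjPoint q)
    (hl : IsProjLine l) (hm : IsProjLine m) (hne : l ≠ m) (hql : q ≤ l) (hqm : q ≤ m) :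
    q = l ⊓ m := by
  refine eq_of_le_of_finrank_le (le_inf hql hqm) ?_
  have hlt : l ⊓ m < l := by
    refine lt_of_le_of_ne inf_le_left fun h => hne ?_
    exact eq_of_le_of_finrank_eq (inf_eq_left.mp h) (hl.trans hm.symm)
  have h := finrank_lt_finrank_of_lt hlt
  unfold IsProjLine IsProjPoint at *
  omega

/-- Pencils with non-collinear centres determine only finitely many rich points. -/
lemma finite_richPoints4 {n : ℕ} {p₁ p₂ p₃ : Submodule ℝ (Fin 3 → ℝ)}
    {L₁ L₂ L₃ : Finset (Submodule ℝ (Fin 3 → ℝ))} (L₄ : Finset (Submodule ℝ (Fin 3 → ℝ)))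
    (h₁ : IsPencil n p₁ L₁) (h₂ : IsPencil n p₂ L₂) (h₃ : IsPencil n p₃ L₃)
    (h : ¬ Collinear3 p₁ p₂ p₃) : (RichPoints4 L₁ L₂ L₃ L₄).Finite := by
  classical
  refine ((L₁ ×ˢ (L₂ ∪ L₃)).image fun x => x.1 ⊓ x.2).finite_toSet.subset ?_
  rintro q ⟨hq, ⟨l, hl, hql⟩, ⟨m, hm, hqm⟩, ⟨k, hk, hqk⟩, -⟩
  have hl' := h₁.2.2 l hl
  have hm' := h₂.2.2 m hm
  have hk' := h₃.2.2 k hk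
  simp only [Finset.coe_image, Set.mem_image, Finset.mem_coe, Finset.mem_product,
    Finset.mem_union, Prod.exists]
  by_cases hlm : l = m
  · have hlk : l ≠ k := by
      rintro rfl
      exact h ⟨l, hl'.1, hl'.2, hlm ▸ hm'.2, hk'.2⟩
    exact ⟨l, k, ⟨hl, Or.inr hk⟩, (hq.eq_inf hl'.1 hk'.1 hlk hql hqk).symm⟩
  · exact ⟨l, m, ⟨hl, Or.inl hm⟩, (hq.eq_inf hl'.1 hm'.1 hlm hql hqm).symm⟩

/-- Points spanned by the rows of an invertible matrix are not collinear. -/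
lemma not_collinear3_of_det_ne_zero {u v w : Fin 3 → ℝ}
    (h : (Matrix.of ![u, v, w]).det ≠ 0) :
    ¬ Collinear3 (span ℝ {u}) (span ℝ {v}) (span ℝ {w}) := by
  rintro ⟨l, hl, hu, hv, hw⟩
  have hli : LinearIndependent ℝ ![u, v, w] :=
    Matrix.linearIndependent_rows_of_det_ne_zero h
  have hspan : span ℝ (Set.range ![u, v, w]) ≤ l := by
    rw [span_le]
    rintro _ ⟨i, rfl⟩
    fin_cases i
    · exact hu (mem_span_singleton_self u)
    · exact hv (mem_span_singleton_self v)
    · exact hw (mem_span_singleton_self w)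
  have h3 := finrank_mono hspan
  rw [finrank_span_eq_card hli, hl] at h3
  simp at h3

lemma IsProjPoint.collinear3_self {p : Submodule ℝ (Fin 3 → ℝ)} (hp : IsProjPoint p)
    {w : Fin 3 → ℝ} : Collinear3 p p (span ℝ {w}) := by
  obtain ⟨l, hl, hpl, hw⟩ := hp.exists_line w
  exact ⟨l, hl, hpl, hpl, (span_singleton_le_iff_mem w l).mpr hw⟩

/-- For irrational `θ`, the vectors `(i + 1, j + 1, θ + k)` span distinct projective points. -/
lemma Irrational.injective_span_vec {θ : ℝ} (hθ : Irrational θ) :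
    Function.Injective fun x : ℕ × ℕ × ℕ =>
      span ℝ {![(x.1 : ℝ) + 1, (x.2.1 : ℝ) + 1, θ + x.2.2]} := by
  have key : ∀ i k i' k' : ℕ, ∀ t : ℝ, t * (i + 1) = i' + 1 → t * (θ + k) = θ + k' →
      i = i' ∧ k = k' := by
    intro i k i' k' t h1 h2
    have h : θ * ((i' : ℝ) - i) = (i + 1) * k' - (i' + 1) * k := by
      linear_combination (i + 1 : ℝ) * h2 - (θ + k) * h1
    have hi : i = i' := by
      by_contra hne
      have hne' : ((i' : ℝ) - i) ≠ 0 := by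
        rw [sub_ne_zero]; exact_mod_cast Ne.symm hne
      refine hθ ⟨((i + 1) * k' - (i' + 1) * k) / ((i' : ℚ) - i), ?_⟩
      push_cast
      rw [div_eq_iff hne', h]
    subst hi
    refine ⟨rfl, ?_⟩
    have hpos : (i : ℝ) + 1 ≠ 0 := by positivity
    have : (i + 1 : ℝ) * k' = (i + 1) * k := by linear_combination -h
    exact_mod_cast (mul_left_cancel₀ hpos this).symm
  rintro ⟨i, j, k⟩ ⟨i', j', k'⟩ h
  have hmem : ![(i' : ℝ) + 1, (j' : ℝ) + 1, θ + k'] ∈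
      span ℝ {![(i : ℝ) + 1, (j : ℝ) + 1, θ + k]} := by
    rw [show span ℝ {![(i : ℝ) + 1, (j : ℝ) + 1, θ + k]} = _ from h]
    exact mem_span_singleton_self _
  obtain ⟨t, ht⟩ := mem_span_singleton.mp hmem
  have h0 := congrFun ht 0
  have h1 := congrFun ht 1
  have h2 := congrFun ht 2
  simp at h0 h1 h2
  obtain ⟨hi, hk⟩ := key i k i' k' t h0 h2
  obtain ⟨hj, -⟩ := key j k j' k' t h1 h2
  rw [hi, hj, hk]

/-- A pencil centred at `v` covering the vectors `g i j`, `i, j < m`. -/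
lemma exists_pencil_grid {v : Fin 3 → ℝ} (hv : v ≠ 0) {m n : ℕ} (hmn : m * m ≤ n)
    (g : ℕ → ℕ → Fin 3 → ℝ) :
    ∃ L, IsPencil n (span ℝ {v}) L ∧ ∀ x : Fin 3 → ℝ, ∀ i < m, ∀ j < m, ∀ t : ℝ,
      x = t • v + g i j → ∃ l ∈ L, span ℝ {x} ≤ l := by
  classical
  have hp : IsProjPoint (span ℝ {v}) := finrank_span_singleton hv
  obtain ⟨L, hL, hgL⟩ := hp.exists_pencil (n := n)
    ((Finset.range m ×ˢ Finset.range m).image fun x => g x.1 x.2)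
    (Finset.card_image_le.trans (by simpa using hmn))
  refine ⟨L, hL, fun x i hi j hj t hx => ?_⟩
  obtain ⟨l, hl, hgl⟩ := hgL (g i j)
    (Finset.mem_image.mpr ⟨(i, j), by simp [hi, hj], rfl⟩)
  refine ⟨l, hl, (span_singleton_le_iff_mem x l).mpr ?_⟩
  rw [hx]
  exact l.add_mem (l.smul_mem t ((hL.2.2 l hl).2 (mem_span_singleton_self v))) hgl


theorem four_rich_points_lower_bound_general_position :
    ∃ c : ℝ, 0 < c ∧ ∀ N : ℕ, ∃ n : ℕ, N ≤ n ∧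
      ∃ (p₁ p₂ p₃ p₄ : Submodule ℝ (Fin 3 → ℝ))
        (L₁ L₂ L₃ L₄ : Finset (Submodule ℝ (Fin 3 → ℝ))),
        IsPencil n p₁ L₁ ∧ IsPencil n p₂ L₂ ∧ IsPencil n p₃ L₃ ∧ IsPencil n p₄ L₄ ∧
        p₁ ≠ p₂ ∧ p₁ ≠ p₃ ∧ p₁ ≠ p₄ ∧ p₂ ≠ p₃ ∧ p₂ ≠ p₄ ∧ p₃ ≠ p₄ ∧
        ¬ Collinear3 p₁ p₂ p₃ ∧ ¬ Collinear3 p₁ p₂ p₄ ∧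
        ¬ Collinear3 p₁ p₃ p₄ ∧ ¬ Collinear3 p₂ p₃ p₄ ∧
        c * (n : ℝ) ^ ((3 : ℝ) / 2) ≤ ((RichPoints4 L₁ L₂ L₃ L₄).ncard : ℝ) := by
  refine ⟨1 / 8, by norm_num, fun N => ?_⟩
  set M : ℕ := N + 1 with hM
  refine ⟨2 * M * (2 * M), by nlinarith, ?_⟩
  have hθ := irrational_sqrt_two
  have hvec : ∀ (u : Fin 3 → ℝ) (i : Fin 3), u i = 1 → u ≠ 0 := by
    rintro u i hi rfl
    simp at hi
  have hMM : M * M ≤ 2 * M * (2 * M) := by nlinarith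
  obtain ⟨L₁, hL₁, hr₁⟩ := exists_pencil_grid (hvec ![1, 0, 0] 0 rfl) hMM
    fun j k => ![0, (j : ℝ) + 1, √2 + k]
  obtain ⟨L₂, hL₂, hr₂⟩ := exists_pencil_grid (hvec ![0, 1, 0] 1 rfl) hMM
    fun i k => ![(i : ℝ) + 1, 0, √2 + k]
  obtain ⟨L₃, hL₃, hr₃⟩ := exists_pencil_grid (hvec ![0, 0, 1] 2 rfl) hMM
    fun i j => ![(i : ℝ) + 1, (j : ℝ) + 1, 0]
  obtain ⟨L₄, hL₄, hr₄⟩ := exists_pencil_grid (hvec ![1, 1, 1] 0 rfl) le_rfl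
    fun a b => ![(a : ℝ) - M + 1 - √2, (b : ℝ) - M + 1 - √2, 0]
  have h123 := not_collinear3_of_det_ne_zero (u := ![1, 0, 0]) (v := ![0, 1, 0])
    (w := ![0, 0, 1]) (by simp [Matrix.det_fin_three])
  have h124 := not_collinear3_of_det_ne_zero (u := ![1, 0, 0]) (v := ![0, 1, 0])
    (w := ![1, 1, 1]) (by simp [Matrix.det_fin_three])
  have h134 := not_collinear3_of_det_ne_zero (u := ![1, 0, 0]) (v := ![0, 0, 1])
    (w := ![1, 1, 1]) (by simp [Matrix.det_fin_three])
  have h234 := not_collinear3_of_det_ne_zero (u := ![0, 1, 0]) (v := ![0, 0, 1])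
    (w := ![1, 1, 1]) (by simp [Matrix.det_fin_three])
  have hne : ∀ {p q : Submodule ℝ (Fin 3 → ℝ)} {w : Fin 3 → ℝ}, IsProjPoint p →
      ¬ Collinear3 p q (span ℝ {w}) → p ≠ q := by
    rintro p q w hp hc rfl
    exact hc hp.collinear3_self
  refine ⟨_, _, _, _, L₁, L₂, L₃, L₄, hL₁, hL₂, hL₃, hL₄, hne hL₁.1 h123, hne hL₁.1 h134,
    ?_, hne hL₂.1 h234, ?_, ?_, h123, h124, h134, h234, ?_⟩
  · intro h
    obtain ⟨l, hl, h1, h2⟩ := hL₁.1.exists_line ![0, 1, 0]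
    exact h124 ⟨l, hl, h1, (span_singleton_le_iff_mem _ l).mpr h2, h ▸ h1⟩
  · intro h
    obtain ⟨l, hl, h1, h2⟩ := hL₂.1.exists_line ![1, 0, 0]
    exact h124 ⟨l, hl, (span_singleton_le_iff_mem _ l).mpr h2, h1, h ▸ h1⟩
  · intro h
    obtain ⟨l, hl, h1, h2⟩ := hL₃.1.exists_line ![1, 0, 0]
    exact h134 ⟨l, hl, (span_singleton_le_iff_mem _ l).mpr h2, h1, h ▸ h1⟩
  · set R := Finset.range M
    have hsub : (fun x : ℕ × ℕ × ℕ => span ℝ {![(x.1 : ℝ) + 1, (x.2.1 : ℝ) + 1, √2 + x.2.2]}) ''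
        ((R ×ˢ R ×ˢ R : Finset (ℕ × ℕ × ℕ)) : Set (ℕ × ℕ × ℕ)) ⊆ RichPoints4 L₁ L₂ L₃ L₄ := by
      rintro _ ⟨⟨i, j, k⟩, hx, rfl⟩
      simp only [Finset.mem_coe, Finset.mem_product, R, Finset.mem_range] at hx
      obtain ⟨hi, hj, hk⟩ := hx
      refine ⟨finrank_span_singleton fun h => ?_, hr₁ _ j hj k hk (i + 1) ?_,
        hr₂ _ i hi k hk (j + 1) ?_, hr₃ _ i hi j hj (√2 + k) ?_,
        hr₄ _ (i + M - k) (by omega) (j + M - k) (by omega) (√2 + k) ?_⟩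
      · have h0 : (i : ℝ) + 1 = 0 := by simpa using congrFun h 0
        exact (by positivity : (i : ℝ) + 1 ≠ 0) h0
      · simp
      · simp
      · simp
      · rw [Nat.cast_sub (by omega), Nat.cast_sub (by omega)]
        ext a
        fin_cases a <;> simp <;> ring
    have hcard := Set.ncard_le_ncard hsub (finite_richPoints4 L₄ hL₁ hL₂ hL₃ h123)
    rw [Set.ncard_image_of_injective _ hθ.injective_span_vec, Set.ncard_coe_finset] at hcard
    have hR : (R ×ˢ R ×ˢ R).card = M * (M * M) := by simp [R]
    rw [hR] at hcard
    have hpow : ((2 * M * (2 * M) : ℕ) : ℝ) ^ ((3 : ℝ) / 2) = (2 * M) ^ 3 := by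
      have h0 : (0 : ℝ) ≤ 2 * M := by positivity
      rw [show ((2 * M * (2 * M) : ℕ) : ℝ) = (2 * M : ℝ) ^ (2 : ℝ) by
        rw [Real.rpow_two]; push_cast; ring, ← Real.rpow_mul h0, ← Real.rpow_natCast]
      norm_num
    rw [hpow]
    have hcard' : ((M * (M * M) : ℕ) : ℝ) ≤ (RichPoints4 L₁ L₂ L₃ L₄).ncard := by
      exact_mod_cast hcard
    push_cast at hcard'
    linarith
end

section
/- There is an absolute constant c > 0 such that the following holds. Let A, B be finite sets of real numbers with |A| = |B| = n, let (x₁,y₁) and (x₂,y₂) be two distinct points of ℝ² with y₁ ∉ B and y₂ ∉ B, and let E ⊆ A × B be any set of edges. Then |(A−x₁) /_E (B−y₁)| + |(A−x₂) /_E (B−y₂)| ≥ c · |E|^{3/2} / n^{7/4}. -/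
/-- The graph-restricted shifted ratio set `(A − x) /_E (B − y) = {(a − x)/(b − y) : (a, b) ∈ E}`. -/
noncomputable def ratioShift (E : Finset (ℝ × ℝ)) (x y : ℝ) : Finset ℝ :=
  E.image fun p => (p.1 - x) / (p.2 - y)

/-- The number of elements of `C` below `u`. -/
noncomputable def rankIn (C : Finset ℝ) (u : ℝ) : ℕ := (C.filter (· < u)).card

lemma rankIn_mono (C : Finset ℝ) : Monotone (rankIn C) := by
  intro u v h
  refine Finset.card_le_card fun w hw => ?_
  simp only [Finset.mem_filter] at hw ⊢
  exact ⟨hw.1, hw.2.trans_le h⟩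

lemma rankIn_lt_rankIn {C : Finset ℝ} {u v : ℝ} (hu : u ∈ C) (h : u < v) :
    rankIn C u < rankIn C v := by
  refine Finset.card_lt_card ((Finset.ssubset_iff_of_subset fun w hw => ?_).2 ⟨u, ?_, ?_⟩)
  · simp only [Finset.mem_filter] at hw ⊢
    exact ⟨hw.1, hw.2.trans h⟩
  · simp [hu, h]
  · simp

lemma rankIn_injOn (C : Finset ℝ) : Set.InjOn (rankIn C) C := by
  intro u hu v hv h
  rcases lt_trichotomy u v with huv | huv | huv
  · exact absurd h (rankIn_lt_rankIn hu huv).ne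
  · exact huv
  · exact absurd h (rankIn_lt_rankIn hv huv).ne'

lemma rankIn_lt_card {C : Finset ℝ} {u : ℝ} (hu : u ∈ C) : rankIn C u < C.card := by
  refine Finset.card_lt_card ((Finset.ssubset_iff_of_subset (Finset.filter_subset _ _)).2
    ⟨u, hu, ?_⟩)
  simp

/-- A finite set is bounded by the number of its classes under `key`, plus the number of codes
needed to encode injectively the pairs of distinct elements of the same class. -/
lemma card_le_card_image_add_card {α κ ω : Type*} [DecidableEq α] [DecidableEq κ]
    (J : Finset α) (key : α → κ) (W : Finset ω) (code : α → α → ω)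
    (hW : ∀ i ∈ J, ∀ j ∈ J, key i = key j → i ≠ j → code i j ∈ W)
    (hinj : ∀ i ∈ J, ∀ j ∈ J, ∀ i' ∈ J, ∀ j' ∈ J, key i = key j → i ≠ j → key i' = key j' →
      i' ≠ j' → code i j = code i' j' → i = i') :
    J.card ≤ (J.image key).card + W.card := by
  rcases J.eq_empty_or_nonempty with rfl | ⟨j₀, -⟩
  · simp
  have : Nonempty α := ⟨j₀⟩
  have hrep : ∀ k : κ, k ∈ J.image key → ∃ j ∈ J, key j = k := fun k hk => by
    simpa using hk
  choose! rep hrepJ hrepk using hrep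
  have hmem : ∀ j ∈ J, key j ∈ J.image key := fun j hj => Finset.mem_image_of_mem _ hj
  rw [← Finset.card_filter_add_card_filter_not (s := J) (fun j => j = rep (key j))]
  refine add_le_add ?_ ?_
  · refine Finset.card_le_card_of_injOn key (fun j hj => ?_) ?_
    · exact hmem j (Finset.mem_filter.1 hj).1
    · intro i hi j hj h
      have hi := (Finset.mem_filter.1 hi).2
      have hj := (Finset.mem_filter.1 hj).2
      rw [hi, hj, h]
  · refine Finset.card_le_card_of_injOn (fun j => code j (rep (key j))) (fun j hj => ?_) ?_
    · obtain ⟨hj, hne⟩ := Finset.mem_filter.1 hj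
      exact hW j hj _ (hrepJ _ (hmem j hj)) (hrepk _ (hmem j hj)).symm hne
    · intro i hi j hj h
      obtain ⟨hi, hne⟩ := Finset.mem_filter.1 hi
      obtain ⟨hj, hne'⟩ := Finset.mem_filter.1 hj
      exact hinj i hi _ (hrepJ _ (hmem i hi)) j hj _ (hrepJ _ (hmem j hj))
        (hrepk _ (hmem i hi)).symm hne (hrepk _ (hmem j hj)).symm hne' h

/-- Two distinct points lie on at most one of the lines `α u - β v = γ`. -/
lemma line_unique {γ : ℝ} (hγ : γ ≠ 0) {α β α' β' u v u' v' : ℝ} (hne : (u, v) ≠ (u', v'))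
    (h1 : α * u - β * v = γ) (h2 : α * u' - β * v' = γ)
    (h3 : α' * u - β' * v = γ) (h4 : α' * u' - β' * v' = γ) : (α, β) = (α', β') := by
  have hdet : α * β' = β * α' := by
    have hu : (u - u') * (α * β' - β * α') = 0 := by
      linear_combination β' * h1 - β' * h2 - β * h3 + β * h4
    have hv : (v - v') * (α * β' - β * α') = 0 := by
      linear_combination α' * h1 - α' * h2 - α * h3 + α * h4
    by_contra hcon
    have hcon' : α * β' - β * α' ≠ 0 := sub_ne_zero.2 hcon
    apply hne
    rw [sub_eq_zero.1 ((mul_eq_zero.1 hu).resolve_right hcon'),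
      sub_eq_zero.1 ((mul_eq_zero.1 hv).resolve_right hcon')]
  have ha : (α - α') * γ = 0 := by
    linear_combination α' * h1 - α * h3 - v * hdet
  have hb : (β - β') * γ = 0 := by
    linear_combination β' * h1 - β * h3 - u * hdet
  rw [sub_eq_zero.1 ((mul_eq_zero.1 ha).resolve_right hγ),
    sub_eq_zero.1 ((mul_eq_zero.1 hb).resolve_right hγ)]

/-- The incidences between the grid `C × D` and the lines `α u - β v = γ` with `(α, β) ∈ L`. -/
noncomputable def gridIncidences (γ : ℝ) (C D : Finset ℝ) (L : Finset (ℝ × ℝ)) :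
    Finset ((ℝ × ℝ) × (ℝ × ℝ)) :=
  ((C ×ˢ D) ×ˢ L).filter fun j => j.2.1 * j.1.1 - j.2.2 * j.1.2 = γ

lemma mem_gridIncidences {γ : ℝ} {C D : Finset ℝ} {L : Finset (ℝ × ℝ)} {u v α β : ℝ} :
    ((u, v), (α, β)) ∈ gridIncidences γ C D L ↔
      u ∈ C ∧ v ∈ D ∧ (α, β) ∈ L ∧ α * u - β * v = γ := by
  simp [gridIncidences, and_assoc]

/-- Lines meet few cells when the grid `C × D` is cut into cells of `s × s` points. -/
lemma card_image_cells_le {γ : ℝ} {C D : Finset ℝ} {L : Finset (ℝ × ℝ)} {m : ℕ} (s : ℕ)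
    (hL : ∀ l ∈ L, l.1 ≠ 0 ∧ l.2 ≠ 0) (hC : C.card ≤ m) (hD : D.card ≤ m) :
    ((gridIncidences γ C D L).image fun j =>
      ((rankIn C j.1.1 / s, rankIn D j.1.2 / s), j.2)).card ≤ 2 * (m / s + 1) * L.card := by
  set t := m / s + 1 with ht
  have hlt : ∀ k, k < m → k / s < t := fun k hk => Nat.lt_succ_of_le (Nat.div_le_div_right hk.le)
  calc _ ≤ (Finset.range (2 * t) ×ˢ L).card := ?_
    _ = 2 * t * L.card := by simp
  refine Finset.card_le_card_of_injOn
    (fun w => (if 0 < w.2.1 * w.2.2 then w.1.1 + w.1.2 else w.1.1 + (t - w.1.2), w.2)) ?_ ?_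
  · intro w hw
    obtain ⟨⟨⟨u, v⟩, ⟨α, β⟩⟩, hj, rfl⟩ := Finset.mem_image.1 hw
    obtain ⟨hu, hv, hl, -⟩ := mem_gridIncidences.1 hj
    have h1 := hlt _ ((rankIn_lt_card hu).trans_le hC)
    have h2 := hlt _ ((rankIn_lt_card hv).trans_le hD)
    simp only [Finset.coe_product, Set.mem_prod, Finset.mem_coe, Finset.mem_range]
    refine ⟨?_, hl⟩
    generalize rankIn C u / s = i at *
    generalize rankIn D v / s = j at *
    split_ifs <;> omega
  · intro w hw w' hw' h
    obtain ⟨⟨⟨u, v⟩, ⟨α, β⟩⟩, hj, rfl⟩ := Finset.mem_image.1 hw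
    obtain ⟨⟨⟨u', v'⟩, ⟨α', β'⟩⟩, hj', rfl⟩ := Finset.mem_image.1 hw'
    obtain ⟨hu, hv, hl, he⟩ := mem_gridIncidences.1 hj
    obtain ⟨hu', hv', hl', he'⟩ := mem_gridIncidences.1 hj'
    simp only [Prod.mk.injEq] at h
    obtain ⟨h, rfl, rfl⟩ := h
    obtain ⟨hα, hβ⟩ := hL _ hl
    simp only at hα hβ
    clear hw hw' hj hj' hl'
    wlog huu : u ≤ u' generalizing u v u' v'
    · exact (this u' v' u v hu' hv' he' hu hv he h.symm (le_of_not_ge huu)).symm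
    have h2 := hlt _ ((rankIn_lt_card hv).trans_le hD)
    have h2' := hlt _ ((rankIn_lt_card hv').trans_le hD)
    have m1 : rankIn C u / s ≤ rankIn C u' / s := Nat.div_le_div_right (rankIn_mono C huu)
    have hdiff : α * (u' - u) = β * (v' - v) := by linear_combination he' - he
    have hsq : α * β * (u' - u) = β ^ 2 * (v' - v) := by linear_combination β * hdiff
    have hβ2 : 0 < β ^ 2 := by positivity
    have hcells : rankIn C u / s = rankIn C u' / s ∧ rankIn D v / s = rankIn D v' / s := by
      split_ifs at h with hpos
      · have hvv : v ≤ v' := by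
          have : 0 ≤ β ^ 2 * (v' - v) := hsq ▸ mul_nonneg hpos.le (sub_nonneg.2 huu)
          exact sub_nonneg.1 (nonneg_of_mul_nonneg_right this hβ2)
        have m2 : rankIn D v / s ≤ rankIn D v' / s := Nat.div_le_div_right (rankIn_mono D hvv)
        omega
      · have hvv : v' ≤ v := by
          have : β ^ 2 * (v' - v) ≤ 0 :=
            hsq ▸ mul_nonpos_of_nonpos_of_nonneg (not_lt.1 hpos) (sub_nonneg.2 huu)
          exact sub_nonpos.1 (nonpos_of_mul_nonpos_right this hβ2)
        have m2 : rankIn D v' / s ≤ rankIn D v / s := Nat.div_le_div_right (rankIn_mono D hvv)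
        omega
    rw [hcells.1, hcells.2]

/-- An incidence bound of Szemerédi–Trotter type for grids, depending on a cell size `s`. -/
lemma card_gridIncidences_le {γ : ℝ} (hγ : γ ≠ 0) {C D : Finset ℝ} {L : Finset (ℝ × ℝ)} {m s : ℕ}
    (hs : 0 < s) (hL : ∀ l ∈ L, l.1 ≠ 0 ∧ l.2 ≠ 0) (hC : C.card ≤ m) (hD : D.card ≤ m) :
    (gridIncidences γ C D L).card ≤ 2 * (m / s + 1) * L.card + m ^ 2 * s ^ 2 := by
  set W := (C ×ˢ D) ×ˢ (Finset.range s ×ˢ Finset.range s) with hWdef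
  have hWcard : W.card ≤ m ^ 2 * s ^ 2 := by
    simp only [hWdef, Finset.card_product, Finset.card_range]
    calc _ ≤ (m * m) * (s * s) := by gcongr
      _ = _ := by ring
  have hmod : ∀ (F : Finset ℝ) {a b : ℝ}, a ∈ F → b ∈ F → rankIn F a / s = rankIn F b / s →
      rankIn F a % s = rankIn F b % s → a = b := fun F a b ha hb h h' =>
    rankIn_injOn F ha hb (by rw [← Nat.div_add_mod (rankIn F a) s, h, h', Nat.div_add_mod])
  refine (card_le_card_image_add_card (gridIncidences γ C D L)
    (fun j => ((rankIn C j.1.1 / s, rankIn D j.1.2 / s), j.2)) W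
    (fun i j => (i.1, (rankIn C j.1.1 % s, rankIn D j.1.2 % s))) ?_ ?_).trans
    (add_le_add (card_image_cells_le s hL hC hD) hWcard)
  · rintro ⟨⟨u, v⟩, ⟨α, β⟩⟩ hi j - - -
    obtain ⟨hu, hv, -, -⟩ := mem_gridIncidences.1 hi
    simp [hWdef, hu, hv, Nat.mod_lt _ hs]
  · rintro ⟨⟨u, v⟩, ⟨α, β⟩⟩ hi ⟨⟨p, q⟩, ⟨α₂, β₂⟩⟩ hj ⟨⟨u', v'⟩, ⟨α', β'⟩⟩ hi'
      ⟨⟨p', q'⟩, ⟨α₂', β₂'⟩⟩ hj' hk hne hk' hne' hc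
    simp only [Prod.mk.injEq] at hk hk' hc
    obtain ⟨⟨k1, k2⟩, rfl, rfl⟩ := hk
    obtain ⟨⟨k1', k2'⟩, rfl, rfl⟩ := hk'
    obtain ⟨⟨rfl, rfl⟩, c1, c2⟩ := hc
    obtain ⟨hu, hv, -, he⟩ := mem_gridIncidences.1 hi
    obtain ⟨hp, hq, -, hline⟩ := mem_gridIncidences.1 hj
    obtain ⟨-, -, -, he'⟩ := mem_gridIncidences.1 hi'
    obtain ⟨hp', hq', -, hline'⟩ := mem_gridIncidences.1 hj'
    obtain rfl := hmod C hp hp' (k1.symm.trans k1') c1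
    obtain rfl := hmod D hq hq' (k2.symm.trans k2') c2
    rw [line_unique hγ (fun h => hne (by rw [h])) he hline he' hline']

/-- The edges are determined by their ratio and their second coordinate. -/
lemma card_le_card_mul_card_ratioShift {A B : Finset ℝ} {x y : ℝ} {E : Finset (ℝ × ℝ)}
    (hy : y ∉ B) (hE : E ⊆ A ×ˢ B) : E.card ≤ B.card * (ratioShift E x y).card := by
  rw [← Finset.card_product]
  refine Finset.card_le_card_of_injOn (fun p => (p.2, (p.1 - x) / (p.2 - y))) ?_ ?_
  · intro p hp
    simp only [Finset.coe_product, Set.mem_prod, Finset.mem_coe]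
    exact ⟨(Finset.mem_product.1 (hE hp)).2, Finset.mem_image_of_mem _ hp⟩
  · rintro ⟨a, b⟩ hp ⟨a', b'⟩ - h
    simp only [Prod.mk.injEq] at h
    obtain ⟨rfl, h⟩ := h
    have hb : b - y ≠ 0 := by
      rintro h0
      exact hy (sub_eq_zero.1 h0 ▸ (Finset.mem_product.1 (hE hp)).2)
    rw [div_left_inj' hb, sub_left_inj] at h
    rw [h]

lemma card_sq_le_card_mul_gridIncidences {A B : Finset ℝ} {x₁ y₁ x₂ y₂ : ℝ}
    {E : Finset (ℝ × ℝ)} (h₁ : y₁ ∉ B) (h₂ : y₂ ∉ B) (hE : E ⊆ A ×ˢ B) :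
    E.card ^ 2 ≤ A.card * (gridIncidences (x₂ - x₁) (ratioShift E x₁ y₁) (ratioShift E x₂ y₂)
      ((B ×ˢ B).image fun q => (q.1 - y₁, q.2 - y₂))).card := by
  have hsum : E.card = ∑ a ∈ A, (E.filter fun p => p.1 = a).card :=
    Finset.card_eq_sum_card_fiberwise fun p hp => (Finset.mem_product.1 (hE hp)).1
  have hB : ∀ {a b}, (a, b) ∈ E → b ∈ B := fun h => (Finset.mem_product.1 (hE h)).2
  have hne₁ : ∀ {a b}, (a, b) ∈ E → b - y₁ ≠ 0 := fun h h0 => h₁ (sub_eq_zero.1 h0 ▸ hB h)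
  have hne₂ : ∀ {a b}, (a, b) ∈ E → b - y₂ ≠ 0 := fun h h0 => h₂ (sub_eq_zero.1 h0 ▸ hB h)
  set T := (E ×ˢ E).filter fun w => w.1.1 = w.2.1 with hT
  have hTmem : ∀ {a b a' b' : ℝ}, ((a, b), (a', b')) ∈ T ↔ (a, b) ∈ E ∧ (a', b') ∈ E ∧ a = a' := by
    intros; simp [hT, and_assoc]
  have hTcard : ∑ a ∈ A, (E.filter fun p => p.1 = a).card ^ 2 = T.card := by
    rw [Finset.card_eq_sum_card_fiberwise (f := fun w => w.1.1) (t := A)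
      fun w hw => (Finset.mem_product.1 (hE (Finset.mem_product.1 (Finset.mem_filter.1 hw).1).1)).1]
    refine Finset.sum_congr rfl fun a _ => ?_
    rw [sq, ← Finset.card_product]
    congr 1
    ext ⟨⟨a', b⟩, ⟨a'', b'⟩⟩
    rw [Finset.mem_product, Finset.mem_filter, Finset.mem_filter, Finset.mem_filter, hTmem]
    dsimp only
    constructor
    · rintro ⟨⟨h, rfl⟩, h', rfl⟩
      exact ⟨⟨h, h', rfl⟩, rfl⟩
    · rintro ⟨⟨h, h', rfl⟩, rfl⟩
      exact ⟨⟨h, rfl⟩, h', rfl⟩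
  calc E.card ^ 2 ≤ A.card * T.card := by
        rw [hsum, ← hTcard]
        exact sq_sum_le_card_mul_sum_sq
    _ ≤ _ := Nat.mul_le_mul_left _ ?_
  refine Finset.card_le_card_of_injOn (fun w =>
    (((w.1.1 - x₁) / (w.1.2 - y₁), (w.2.1 - x₂) / (w.2.2 - y₂)), (w.1.2 - y₁, w.2.2 - y₂))) ?_ ?_
  · rintro ⟨⟨a, b⟩, ⟨a', b'⟩⟩ hw
    obtain ⟨hb, hb', rfl⟩ := hTmem.1 hw
    refine mem_gridIncidences.2 ⟨Finset.mem_image.2 ⟨_, hb, rfl⟩, Finset.mem_image.2 ⟨_, hb', rfl⟩,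
      Finset.mem_image.2 ⟨(b, b'), Finset.mem_product.2 ⟨hB hb, hB hb'⟩, rfl⟩, ?_⟩
    rw [mul_div_cancel₀ _ (hne₁ hb), mul_div_cancel₀ _ (hne₂ hb')]
    ring
  · rintro ⟨⟨a, b⟩, ⟨a', b'⟩⟩ hw ⟨⟨d, e⟩, ⟨d', e'⟩⟩ hw' h
    obtain ⟨hb, hb', rfl⟩ := hTmem.1 hw
    obtain ⟨-, -, rfl⟩ := hTmem.1 hw'
    simp only [Prod.mk.injEq, sub_left_inj] at h
    obtain ⟨⟨h, -⟩, rfl, rfl⟩ := h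
    rw [div_left_inj' (hne₁ hb), sub_left_inj] at h
    rw [h]

/-- The choice of the cell size. -/
lemma exists_cell_size {n m : ℕ} (hm : 0 < m) (hmn : m ≤ n ^ 2) :
    ∃ s : ℕ, 0 < s ∧ ∀ e : ℝ, 0 ≤ e →
      e ^ 2 ≤ n * (2 * (m / s + 1) * n ^ 2 + m ^ 2 * s ^ 2) →
      e ^ 2 ≤ 4 * n ^ 3 ∨ e ^ 6 ≤ 1728 * (n ^ 7 * m ^ 4) := by
  have hm' : (0 : ℝ) < m := by exact_mod_cast hm
  have hmn' : (m : ℝ) ≤ n ^ 2 := by exact_mod_cast hmn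
  have hn' : (0 : ℝ) < n ^ 2 := hm'.trans_le hmn'
  set σ : ℝ := ((n : ℝ) ^ 2 / m) ^ ((1 : ℝ) / 3) with hσ
  have hσ1 : 1 ≤ σ := Real.one_le_rpow ((one_le_div hm').2 hmn') (by norm_num)
  have hσ3 : σ ^ 3 * m = n ^ 2 := by
    rw [hσ, ← Real.rpow_natCast, ← Real.rpow_mul (by positivity)]
    norm_num
    field_simp
  have hσ0 : 0 < σ := by linarith
  have hs1 : σ ≤ ⌈σ⌉₊ := Nat.le_ceil σ
  have hs2 : (⌈σ⌉₊ : ℝ) ≤ 2 * σ := by linarith [Nat.ceil_lt_add_one hσ0.le]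
  refine ⟨⌈σ⌉₊, Nat.ceil_pos.2 hσ0, fun e he h => ?_⟩
  set s : ℝ := (⌈σ⌉₊ : ℝ)
  have hms : (m : ℝ) / s ≤ m / σ := by gcongr
  have hms' : (m : ℝ) / σ * n ^ 2 = m ^ 2 * σ ^ 2 := by
    rw [← hσ3]; field_simp
  have hss : s ^ 2 ≤ 4 * σ ^ 2 := by nlinarith
  have hb : e ^ 2 ≤ 6 * (n * (m ^ 2 * σ ^ 2)) + 2 * n ^ 3 := by
    calc e ^ 2 ≤ n * (2 * (m / s + 1) * n ^ 2 + m ^ 2 * s ^ 2) := h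
      _ ≤ n * (2 * (m / σ + 1) * n ^ 2 + m ^ 2 * (4 * σ ^ 2)) := by gcongr
      _ = n * (2 * (m / σ * n ^ 2) + 4 * (m ^ 2 * σ ^ 2)) + 2 * n ^ 3 := by ring
      _ = _ := by rw [hms']; ring
  rcases le_total (e ^ 2) (4 * n ^ 3) with h4 | h4
  · exact Or.inl h4
  · right
    have h12 : e ^ 2 ≤ 12 * (n * (m ^ 2 * σ ^ 2)) := by linarith
    calc e ^ 6 = (e ^ 2) ^ 3 := by ring
      _ ≤ (12 * (n * (m ^ 2 * σ ^ 2))) ^ 3 := by gcongr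
      _ = 1728 * (n ^ 3 * m ^ 4 * (σ ^ 3 * m) ^ 2) := by ring
      _ = 1728 * (n ^ 7 * m ^ 4) := by rw [hσ3]; ring

/-- The bound for two points with different first coordinates, in polynomial form. -/
lemma card_pow_six_le_of_fst_ne {n m : ℕ} {A B : Finset ℝ} {x₁ y₁ x₂ y₂ : ℝ}
    {E : Finset (ℝ × ℝ)} (hA : A.card ≤ n) (hB : B.card ≤ n) (hx : x₁ ≠ x₂)
    (h₁ : y₁ ∉ B) (h₂ : y₂ ∉ B) (hE : E ⊆ A ×ˢ B)
    (hm₁ : (ratioShift E x₁ y₁).card ≤ m) (hm₂ : (ratioShift E x₂ y₂).card ≤ m) :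
    (E.card : ℝ) ^ 6 ≤ 1728 * (n ^ 7 * m ^ 4) := by
  have htriv : E.card ≤ n * m :=
    (card_le_card_mul_card_ratioShift h₁ hE).trans (Nat.mul_le_mul hB hm₁)
  have htriv' : (E.card : ℝ) ≤ n * m := by exact_mod_cast htriv
  have hsq : E.card ≤ n * n := by
    refine (Finset.card_le_card hE).trans ?_
    rw [Finset.card_product]
    exact Nat.mul_le_mul hA hB
  have hsq' : (E.card : ℝ) ≤ n * n := by exact_mod_cast hsq
  rcases Nat.eq_zero_or_pos m with rfl | hm
  · have : (E.card : ℝ) = 0 := by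
      exact_mod_cast Nat.le_zero.1 (by simpa using htriv)
    rw [this]; simp
  rcases Nat.lt_or_ge (n ^ 2) m with hlt | hge
  · have hlt' : (n : ℝ) ^ 2 ≤ m := by exact_mod_cast hlt.le
    have hpow : (n : ℝ) ^ 12 ≤ n ^ 15 := by
      rcases Nat.eq_zero_or_pos n with rfl | hn
      · simp
      · exact pow_le_pow_right₀ (by exact_mod_cast hn) (by norm_num)
    calc (E.card : ℝ) ^ 6 ≤ ((n : ℝ) * n) ^ 6 := by gcongr
      _ = (n : ℝ) ^ 12 := by ring
      _ ≤ (n : ℝ) ^ 15 := hpow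
      _ = (n : ℝ) ^ 7 * ((n : ℝ) ^ 2) ^ 4 := by ring
      _ ≤ (n : ℝ) ^ 7 * (m : ℝ) ^ 4 := by gcongr
      _ ≤ 1728 * ((n : ℝ) ^ 7 * (m : ℝ) ^ 4) := le_mul_of_one_le_left (by positivity) (by norm_num)
  obtain ⟨s, hs, hchoice⟩ := exists_cell_size hm hge
  set L := (B ×ˢ B).image fun q => (q.1 - y₁, q.2 - y₂)
  have hLcard : L.card ≤ n ^ 2 := by
    refine Finset.card_image_le.trans ?_
    rw [Finset.card_product, sq]
    exact Nat.mul_le_mul hB hB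
  have hL : ∀ l ∈ L, l.1 ≠ 0 ∧ l.2 ≠ 0 := by
    intro l hl
    obtain ⟨⟨b, b'⟩, hb, rfl⟩ := Finset.mem_image.1 hl
    obtain ⟨hb, hb'⟩ := Finset.mem_product.1 hb
    exact ⟨fun h => h₁ (sub_eq_zero.1 h ▸ hb), fun h => h₂ (sub_eq_zero.1 h ▸ hb')⟩
  have hinc : E.card ^ 2 ≤ n * (2 * (m / s + 1) * n ^ 2 + m ^ 2 * s ^ 2) :=
    (card_sq_le_card_mul_gridIncidences h₁ h₂ hE).trans <| Nat.mul_le_mul hA <|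
      (card_gridIncidences_le (sub_ne_zero.2 hx.symm) hs hL hm₁ hm₂).trans <| by gcongr
  have hinc' : (E.card : ℝ) ^ 2 ≤ n * (2 * (m / s + 1) * n ^ 2 + m ^ 2 * s ^ 2) := by
    calc (E.card : ℝ) ^ 2 ≤ n * (2 * ((m / s : ℕ) + 1) * n ^ 2 + m ^ 2 * s ^ 2) := by
          exact_mod_cast hinc
      _ ≤ _ := by gcongr; exact Nat.cast_div_le
  rcases hchoice _ (Nat.cast_nonneg _) hinc' with h | h
  · calc (E.card : ℝ) ^ 6 = (E.card : ℝ) ^ 2 * (E.card : ℝ) ^ 4 := by ring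
      _ ≤ (4 * (n : ℝ) ^ 3) * ((n : ℝ) * m) ^ 4 := by gcongr
      _ = 4 * ((n : ℝ) ^ 7 * (m : ℝ) ^ 4) := by ring
      _ ≤ 1728 * ((n : ℝ) ^ 7 * (m : ℝ) ^ 4) := by gcongr; norm_num
  · exact h

lemma card_ratioShift_swap (E : Finset (ℝ × ℝ)) (x y : ℝ) :
    (ratioShift (E.image Prod.swap) y x).card = (ratioShift E x y).card := by
  have : ratioShift (E.image Prod.swap) y x = (ratioShift E x y).image (·⁻¹) := by
    simp only [ratioShift, Finset.image_image]
    refine Finset.image_congr fun p _ => ?_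
    simp
  rw [this, Finset.card_image_of_injective _ inv_injective]

/-- The bound for two distinct points, in polynomial form. -/
lemma card_pow_six_le {n m : ℕ} {A B : Finset ℝ} {x₁ y₁ x₂ y₂ : ℝ}
    {E : Finset (ℝ × ℝ)} (hA : A.card ≤ n) (hB : B.card ≤ n) (hne : (x₁, y₁) ≠ (x₂, y₂))
    (h₁ : y₁ ∉ B) (h₂ : y₂ ∉ B) (hE : E ⊆ A ×ˢ B)
    (hm₁ : (ratioShift E x₁ y₁).card ≤ m) (hm₂ : (ratioShift E x₂ y₂).card ≤ m) :
    (E.card : ℝ) ^ 6 ≤ 110592 * (n ^ 7 * m ^ 4) := by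
  rcases ne_or_eq x₁ x₂ with hx | rfl
  · exact (card_pow_six_le_of_fst_ne hA hB hx h₁ h₂ hE hm₁ hm₂).trans (by gcongr; norm_num)
  have hy : y₁ ≠ y₂ := fun h => hne (by rw [h])
  set F := E.filter fun p => p.1 ≠ x₁
  have hmono : ∀ y, (ratioShift (F.image Prod.swap) y x₁).card ≤ (ratioShift E x₁ y).card := by
    intro y
    rw [card_ratioShift_swap]
    exact Finset.card_le_card (Finset.image_subset_image (Finset.filter_subset _ _))
  have hFcard : ((F.image Prod.swap).card : ℝ) = F.card := by
    rw [Finset.card_image_of_injective _ Prod.swap_injective]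
  have hFE : F.image Prod.swap ⊆ B ×ˢ A.erase x₁ := by
    rintro ⟨b, a⟩ h
    obtain ⟨⟨a', b'⟩, hF', hab⟩ := Finset.mem_image.1 h
    simp only [Prod.swap_prod_mk, Prod.mk.injEq] at hab
    obtain ⟨rfl, rfl⟩ := hab
    obtain ⟨h, ha⟩ := Finset.mem_filter.1 hF'
    obtain ⟨h, h'⟩ := Finset.mem_product.1 (hE h)
    exact Finset.mem_product.2 ⟨h', Finset.mem_erase.2 ⟨ha, h⟩⟩
  have hmain := card_pow_six_le_of_fst_ne hB ((Finset.card_le_card (Finset.erase_subset x₁ A)).trans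
    hA) hy (Finset.notMem_erase x₁ A) (Finset.notMem_erase x₁ A) hFE
    ((hmono y₁).trans hm₁) ((hmono y₂).trans hm₂)
  rw [hFcard] at hmain
  have hrest : (E.filter fun p => ¬ p.1 ≠ x₁).card ≤ n := by
    refine (Finset.card_le_card_of_injOn Prod.snd (t := B) ?_ ?_).trans hB
    · intro p hp
      exact (Finset.mem_product.1 (hE (Finset.mem_filter.1 hp).1)).2
    · intro p hp q hq h
      have hp := not_not.1 (Finset.mem_filter.1 hp).2
      have hq := not_not.1 (Finset.mem_filter.1 hq).2
      exact Prod.ext (hp.trans hq.symm) h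
  have hsplit : (E.card : ℝ) ≤ F.card + n := by
    have := Finset.card_filter_add_card_filter_not (s := E) (fun p : ℝ × ℝ => p.1 ≠ x₁)
    exact_mod_cast this ▸ Nat.add_le_add_left hrest _
  rcases le_total ((F.card : ℝ)) n with h | h
  · rcases Nat.eq_zero_or_pos n with rfl | hn
    · have : (E.card : ℝ) ≤ 0 := by simpa using hsplit.trans (add_le_add_left h _)
      rw [le_antisymm this (Nat.cast_nonneg _)]; simp
    have hn' : (1 : ℝ) ≤ n := by exact_mod_cast hn
    have htriv : (E.card : ℝ) ≤ n * m := by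
      exact_mod_cast (card_le_card_mul_card_ratioShift h₁ hE).trans (Nat.mul_le_mul hB hm₁)
    calc (E.card : ℝ) ^ 6 = (E.card : ℝ) ^ 2 * (E.card : ℝ) ^ 4 := by ring
      _ ≤ (2 * (n : ℝ)) ^ 2 * ((n : ℝ) * m) ^ 4 := by gcongr; linarith
      _ = 4 * ((n : ℝ) ^ 6 * (m : ℝ) ^ 4) := by ring
      _ ≤ 110592 * ((n : ℝ) ^ 7 * (m : ℝ) ^ 4) := by gcongr <;> norm_num
  · calc (E.card : ℝ) ^ 6 ≤ (2 * F.card) ^ 6 := by gcongr; linarith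
      _ = 64 * (F.card : ℝ) ^ 6 := by ring
      _ ≤ 64 * (1728 * ((n : ℝ) ^ 7 * (m : ℝ) ^ 4)) := by gcongr
      _ = _ := by ring

theorem two_shifted_ratio_sets_lower_bound :
    ∃ c : ℝ, 0 < c ∧ ∀ (n : ℕ) (A B : Finset ℝ) (x₁ y₁ x₂ y₂ : ℝ) (E : Finset (ℝ × ℝ)),
      A.card = n → B.card = n → (x₁, y₁) ≠ (x₂, y₂) → y₁ ∉ B → y₂ ∉ B → E ⊆ A ×ˢ B →
      c * (E.card : ℝ) ^ ((3 : ℝ) / 2) / (n : ℝ) ^ ((7 : ℝ) / 4) ≤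
        (((ratioShift E x₁ y₁).card + (ratioShift E x₂ y₂).card : ℕ) : ℝ) := by
  refine ⟨1 / 20, by norm_num, ?_⟩
  intro n A B x₁ y₁ x₂ y₂ E hA hB hne h₁ h₂ hE
  set m := (ratioShift E x₁ y₁).card + (ratioShift E x₂ y₂).card
  have key := card_pow_six_le (m := m) hA.le hB.le hne h₁ h₂ hE (Nat.le_add_right _ _)
    (Nat.le_add_left _ _)
  rcases Nat.eq_zero_or_pos n with rfl | hn
  · rw [Nat.cast_zero, Real.zero_rpow (by norm_num), div_zero]
    positivity
  have hn' : (0 : ℝ) < n := by exact_mod_cast hn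
  rw [div_le_iff₀ (by positivity)]
  refine le_of_pow_le_pow_left₀ (n := 4) (by norm_num) (by positivity) ?_
  have e1 : ((E.card : ℝ) ^ ((3 : ℝ) / 2)) ^ 4 = (E.card : ℝ) ^ 6 := by
    rw [← Real.rpow_natCast, ← Real.rpow_mul (by positivity), ← Real.rpow_natCast]
    norm_num
  have e2 : ((n : ℝ) ^ ((7 : ℝ) / 4)) ^ 4 = (n : ℝ) ^ 7 := by
    rw [← Real.rpow_natCast, ← Real.rpow_mul (by positivity), ← Real.rpow_natCast]
    norm_num
  rw [mul_pow, mul_pow, e1, e2]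
  calc (1 / 20 : ℝ) ^ 4 * (E.card : ℝ) ^ 6 ≤
        (1 / 20) ^ 4 * (110592 * ((n : ℝ) ^ 7 * (m : ℝ) ^ 4)) := by gcongr
    _ ≤ (m : ℝ) ^ 4 * (n : ℝ) ^ 7 := by
      have : (0 : ℝ) ≤ n ^ 7 * m ^ 4 := by positivity
      nlinarith
end

section
/- There is an absolute constant C > 0 such that the following holds. Let A, B be finite sets of real numbers with |A| = |B| = n, let (x₁,y₁) and (x₂,y₂) be two distinct points of ℝ² with y₁ ∉ B and y₂ ∉ B, and let E ⊆ A × B. If |(A−x₁) /_E (B−y₁)| ≤ n and |(A−x₂) /_E (B−y₂)| ≤ n, then |E| ≤ C · n^{11/6}. -/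
/-- A finite set of reals can be cut into consecutive blocks of size at most `s`. -/
lemma exists_monotone_blocks (A : Finset ℝ) {s : ℕ} (hs : 0 < s) :
    ∃ f : ℝ → ℕ, Monotone f ∧ (∀ t, f t ≤ A.card / s) ∧
      ∀ j, (A.filter fun t => f t = j).card ≤ s := by
  classical
  have hmono : Monotone fun t : ℝ => (A.filter fun a => a < t).card := fun t u htu =>
    Finset.card_le_card fun a ha => by
      simp only [Finset.mem_filter] at ha ⊢
      exact ⟨ha.1, ha.2.trans_le htu⟩
  have hstrict : ∀ t ∈ A, ∀ u, t < u →
      (A.filter fun a => a < t).card < (A.filter fun a => a < u).card := by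
    intro t ht u htu
    apply Finset.card_lt_card
    rw [Finset.ssubset_iff_of_subset]
    · exact ⟨t, by simp [ht, htu], by simp⟩
    · intro a ha
      simp only [Finset.mem_filter] at ha ⊢
      exact ⟨ha.1, ha.2.trans htu⟩
  refine ⟨fun t => (A.filter fun a => a < t).card / s, ?_, ?_, ?_⟩
  · exact fun t u htu => Nat.div_le_div_right (hmono htu)
  · exact fun t => Nat.div_le_div_right (Finset.card_le_card (Finset.filter_subset _ _))
  · intro j
    have h := Finset.card_le_card_of_injOn (s := A.filter fun t =>
        (A.filter fun a => a < t).card / s = j) (t := Finset.Ico (j * s) (j * s + s))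
      (fun t : ℝ => (A.filter fun a => a < t).card) ?_ ?_
    · simpa using h
    · intro t ht
      simp only [Finset.coe_filter, Set.mem_ofPred_eq] at ht
      have := (Nat.div_eq_iff hs).1 ht.2
      simp only [Finset.coe_Ico, Set.mem_Ico]
      omega
    · intro t ht u hu htu
      simp only [Finset.coe_filter, Set.mem_ofPred_eq] at ht hu htu
      rcases lt_trichotomy t u with h | h | h
      · exact absurd htu (hstrict t ht.1 u h).ne
      · exact h
      · exact absurd htu (hstrict u hu.1 t h).ne'

/-- A line that is neither horizontal nor vertical meets at most `2 * r + 1` cells of an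
`(r + 1) × (r + 1)` grid of cells. -/
lemma card_image_cells_le_s7 {f : ℝ → ℕ} (hf : Monotone f) {r : ℕ} (hr : ∀ t, f t ≤ r)
    {m k : ℝ} (hm : m ≠ 0) (P : Finset (ℝ × ℝ)) (hP : ∀ p ∈ P, p.2 = m * p.1 + k) :
    (P.image fun p => (f p.1, f p.2)).card ≤ 2 * r + 1 := by
  classical
  rcases lt_or_gt_of_ne hm with hm | hm
  · have h := Finset.card_le_card_of_injOn (s := P.image fun p => (f p.1, f p.2))
      (t := Finset.range (2 * r + 1)) (fun c => c.1 + (r - c.2)) ?_ ?_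
    · simpa using h
    · intro c hc
      obtain ⟨p, -, rfl⟩ := Finset.mem_image.1 (Finset.mem_coe.1 hc)
      have := hr p.1
      simp only [Finset.coe_range, Set.mem_Iio]
      omega
    · intro c hc d hd hcd
      obtain ⟨p, hp, rfl⟩ := Finset.mem_image.1 (Finset.mem_coe.1 hc)
      obtain ⟨q, hq, rfl⟩ := Finset.mem_image.1 (Finset.mem_coe.1 hd)
      have h1 := hr p.2
      have h2 := hr q.2
      simp only at hcd
      rw [Prod.mk.injEq]
      rcases le_total p.1 q.1 with h | h
      · have h3 := hf h
        have h4 : f q.2 ≤ f p.2 := hf (by rw [hP p hp, hP q hq]; nlinarith)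
        omega
      · have h3 := hf h
        have h4 : f p.2 ≤ f q.2 := hf (by rw [hP p hp, hP q hq]; nlinarith)
        omega
  · have h := Finset.card_le_card_of_injOn (s := P.image fun p => (f p.1, f p.2))
      (t := Finset.range (2 * r + 1)) (fun c => c.1 + c.2) ?_ ?_
    · simpa using h
    · intro c hc
      obtain ⟨p, -, rfl⟩ := Finset.mem_image.1 (Finset.mem_coe.1 hc)
      have := hr p.1
      have := hr p.2
      simp only [Finset.coe_range, Set.mem_Iio]
      omega
    · intro c hc d hd hcd
      obtain ⟨p, hp, rfl⟩ := Finset.mem_image.1 (Finset.mem_coe.1 hc)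
      obtain ⟨q, hq, rfl⟩ := Finset.mem_image.1 (Finset.mem_coe.1 hd)
      simp only at hcd
      rw [Prod.mk.injEq]
      rcases le_total p.1 q.1 with h | h
      · have h3 := hf h
        have h4 : f p.2 ≤ f q.2 := hf (by rw [hP p hp, hP q hq]; nlinarith)
        omega
      · have h3 := hf h
        have h4 : f q.2 ≤ f p.2 := hf (by rw [hP p hp, hP q hq]; nlinarith)
        omega

lemma card_le_card_image_add_card_collisions_s7 {α β : Type*} [DecidableEq α] [DecidableEq β]
    (S : Finset α) (g : α → β) :
    S.card ≤ (S.image g).card +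
      ((S ×ˢ S).filter fun q => q.1 ≠ q.2 ∧ g q.1 = g q.2).card := by
  rcases S.eq_empty_or_nonempty with rfl | ⟨a₀, -⟩
  · simp
  have : Nonempty α := ⟨a₀⟩
  let rep : β → α := Function.invFunOn g S
  have hmem : ∀ p ∈ S, rep (g p) ∈ S := fun p hp => Function.invFunOn_apply_mem (f := g) hp
  have heq : ∀ p ∈ S, g (rep (g p)) = g p := fun p hp => Function.invFunOn_apply_eq (f := g) hp
  rw [← Finset.card_filter_add_card_filter_not (s := S) fun p => rep (g p) = p]
  refine Nat.add_le_add ?_ ?_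
  · refine Finset.card_le_card_of_injOn g ?_ ?_
    · intro p hp
      exact Finset.mem_coe.2 (Finset.mem_image_of_mem g (Finset.mem_filter.1 hp).1)
    · intro p hp q hq hpq
      rw [← (Finset.mem_filter.1 hp).2, ← (Finset.mem_filter.1 hq).2, hpq]
  · refine Finset.card_le_card_of_injOn (fun p => (p, rep (g p))) ?_ ?_
    · intro p hp
      obtain ⟨hpS, hp⟩ := Finset.mem_filter.1 hp
      exact Finset.mem_coe.2 (Finset.mem_filter.2
        ⟨Finset.mem_product.2 ⟨hpS, hmem p hpS⟩, Ne.symm hp, (heq p hpS).symm⟩)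
    · intro p _ q _ hpq
      exact (Prod.mk.inj hpq).1

/-- Incidences between the grid `A × A` and lines `y = l.1 * x + l.2` of nonzero slope. -/
lemma card_incidences_le (A : Finset ℝ) (L : Finset (ℝ × ℝ)) (hL : ∀ l ∈ L, l.1 ≠ 0)
    {s : ℕ} (hs : 0 < s) :
    ((L ×ˢ (A ×ˢ A)).filter fun w => w.2.2 = w.1.1 * w.2.1 + w.1.2).card ≤
      L.card * (2 * (A.card / s) + 1) + A.card ^ 2 * s ^ 2 := by
  classical
  obtain ⟨f, hf, hr, hb⟩ := exists_monotone_blocks A hs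
  let g : ℝ × ℝ → ℕ × ℕ := fun p => (f p.1, f p.2)
  let S : ℝ × ℝ → Finset (ℝ × ℝ) := fun l => (A ×ˢ A).filter fun p => p.2 = l.1 * p.1 + l.2
  let T : ℝ × ℝ → Finset ((ℝ × ℝ) × (ℝ × ℝ)) := fun l =>
    (S l ×ˢ S l).filter fun q => q.1 ≠ q.2 ∧ g q.1 = g q.2
  have hsum : ((L ×ˢ (A ×ˢ A)).filter fun w => w.2.2 = w.1.1 * w.2.1 + w.1.2).card =
      ∑ l ∈ L, (S l).card := by
    simp only [S, Finset.card_filter]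
    rw [Finset.sum_product]
  have hline : ∀ l ∈ L, (S l).card ≤ (2 * (A.card / s) + 1) + (T l).card := fun l hl =>
    (card_le_card_image_add_card_collisions_s7 (S l) g).trans (Nat.add_le_add_right
      (card_image_cells_le_s7 hf hr (hL l hl) (S l) fun p hp => (Finset.mem_filter.1 hp).2) _)
  have hdisj : (L : Set (ℝ × ℝ)).PairwiseDisjoint T := by
    intro l _ l' _ hne
    refine Finset.disjoint_left.2 fun q hq hq' => hne ?_
    simp only [T, S, Finset.mem_filter, Finset.mem_product] at hq hq'
    obtain ⟨⟨⟨-, h1⟩, ⟨-, h2⟩⟩, hpq, -⟩ := hq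
    obtain ⟨⟨⟨-, h3⟩, ⟨-, h4⟩⟩, -⟩ := hq'
    have hx : q.1.1 - q.2.1 ≠ 0 := by
      intro h
      have h := sub_eq_zero.1 h
      exact hpq (Prod.ext h (by rw [h1, h2, h]))
    have h5 : l.1 = l'.1 := by
      apply mul_right_cancel₀ hx
      linarith
    exact Prod.ext h5 (by rw [h5] at h1; linarith)
  have hcells : (L.biUnion T).card ≤ A.card ^ 2 * s ^ 2 := by
    have hsub : L.biUnion T ⊆
        ((A ×ˢ A) ×ˢ (A ×ˢ A)).filter fun q => g q.2 = g q.1 := by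
      intro q hq
      simp only [T, S, Finset.mem_biUnion, Finset.mem_filter, Finset.mem_product] at hq
      obtain ⟨l, -, ⟨⟨h1, -⟩, ⟨h2, -⟩⟩, -, h3⟩ := hq
      simp only [Finset.mem_filter, Finset.mem_product]
      exact ⟨⟨h1, h2⟩, h3.symm⟩
    refine (Finset.card_le_card hsub).trans ?_
    rw [Finset.card_filter, Finset.sum_product]
    simp only [← Finset.card_filter]
    have hcell : ∀ p ∈ A ×ˢ A, ((A ×ˢ A).filter fun q => g q = g p).card ≤ s ^ 2 := by
      intro p _
      have : ((A ×ˢ A).filter fun q => g q = g p) =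
          (A.filter fun t => f t = f p.1) ×ˢ (A.filter fun t => f t = f p.2) := by
        ext q
        simp only [g, Finset.mem_filter, Finset.mem_product, Prod.mk.injEq]
        tauto
      rw [this, Finset.card_product, sq]
      exact Nat.mul_le_mul (hb _) (hb _)
    refine (Finset.sum_le_card_nsmul _ _ _ hcell).trans ?_
    simp [sq]
  rw [hsum]
  calc ∑ l ∈ L, (S l).card ≤ ∑ l ∈ L, ((2 * (A.card / s) + 1) + (T l).card) :=
        Finset.sum_le_sum hline
    _ = L.card * (2 * (A.card / s) + 1) + (L.biUnion T).card := by
        rw [Finset.sum_add_distrib, Finset.card_biUnion hdisj]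
        simp
    _ ≤ _ := Nat.add_le_add_left hcells _

/-- Cauchy–Schwarz for the fibres of a map. -/
lemma card_sq_le_card_image_mul_card_pairs {α β : Type*} [DecidableEq α] [DecidableEq β]
    (E : Finset α) (g : α → β) :
    E.card ^ 2 ≤ (E.image g).card * ((E ×ˢ E).filter fun w => g w.1 = g w.2).card := by
  have hpairs : ((E ×ˢ E).filter fun w => g w.1 = g w.2).card =
      ∑ b ∈ E.image g, (E.filter fun e => g e = b).card ^ 2 := by
    rw [Finset.card_eq_sum_card_fiberwise (f := fun w => g w.1) (t := E.image g)]
    · refine Finset.sum_congr rfl fun b _ => ?_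
      rw [sq, ← Finset.card_product]
      congr 1
      ext w
      simp only [Finset.mem_filter, Finset.mem_product]
      constructor
      · rintro ⟨⟨⟨h1, h2⟩, h3⟩, h4⟩
        exact ⟨⟨h1, h4⟩, h2, h3 ▸ h4⟩
      · rintro ⟨⟨h1, h2⟩, h3, h4⟩
        exact ⟨⟨⟨h1, h3⟩, h2.trans h4.symm⟩, h2⟩
    · intro w hw
      simp only [Finset.coe_filter, Finset.mem_product, Set.mem_ofPred_eq] at hw
      exact Finset.mem_coe.2 (Finset.mem_image_of_mem g hw.1.1)
  rw [hpairs, Finset.card_eq_sum_card_image g E]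
  exact sq_sum_le_card_mul_sum_sq

lemma exists_block_size {n : ℕ} (hn : 0 < n) :
    ∃ s : ℕ, 0 < s ∧
      ((n ^ 2 * (2 * (n / s) + 1) + n ^ 2 * s ^ 2 : ℕ) : ℝ) ≤ 8 * (n : ℝ) ^ ((8 : ℝ) / 3) := by
  have hn1 : (1 : ℝ) ≤ n := by exact_mod_cast hn
  have hn0 : (0 : ℝ) < n := by linarith
  obtain ⟨t, ht⟩ : ∃ t : ℝ, t = (n : ℝ) ^ ((1 : ℝ) / 3) := ⟨_, rfl⟩
  have ht1 : 1 ≤ t := ht ▸ Real.one_le_rpow hn1 (by norm_num)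
  have ht3 : (n : ℝ) = t ^ 3 := by
    rw [ht, ← Real.rpow_natCast, ← Real.rpow_mul hn0.le]; norm_num
  have ht8 : (n : ℝ) ^ ((8 : ℝ) / 3) = t ^ 8 := by
    rw [ht, ← Real.rpow_natCast, ← Real.rpow_mul hn0.le]; norm_num
  have hle : t ≤ ⌈t⌉₊ := Nat.le_ceil t
  have hlt : (⌈t⌉₊ : ℝ) ≤ 2 * t := by
    have := Nat.ceil_lt_add_one (show 0 ≤ t by linarith)
    linarith
  refine ⟨⌈t⌉₊, Nat.ceil_pos.2 (by linarith), ?_⟩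
  have hdiv : ((n / ⌈t⌉₊ : ℕ) : ℝ) ≤ t ^ 2 := by
    refine Nat.cast_div_le.trans ?_
    rw [div_le_iff₀ (by linarith), ht3]
    nlinarith [sq_nonneg t]
  have h1 : 1 ≤ t ^ 2 := one_le_pow₀ ht1
  have h2 : (⌈t⌉₊ : ℝ) ^ 2 ≤ (2 * t) ^ 2 := by gcongr
  push_cast
  rw [ht8, ht3]
  calc (t ^ 3) ^ 2 * (2 * ((n / ⌈t⌉₊ : ℕ) : ℝ) + 1) + (t ^ 3) ^ 2 * (⌈t⌉₊ : ℝ) ^ 2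
      ≤ (t ^ 3) ^ 2 * (2 * t ^ 2 + t ^ 2) + (t ^ 3) ^ 2 * (2 * t) ^ 2 := by gcongr
    _ ≤ 8 * t ^ 8 := by nlinarith [pow_pos (show 0 < t by linarith) 8]

/-- The case of two centres at different heights, with no edge on an axis through a centre. -/
lemma card_edges_le_of_ne {n : ℕ} (hn : 0 < n) {x₁ y₁ x₂ y₂ : ℝ} (hy : y₁ ≠ y₂)
    (E : Finset (ℝ × ℝ))
    (hE : ∀ e ∈ E, e.1 ≠ x₁ ∧ e.1 ≠ x₂ ∧ e.2 ≠ y₁ ∧ e.2 ≠ y₂)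
    (hA : (E.image Prod.fst).card ≤ n) (hB : (E.image Prod.snd).card ≤ n)
    (h₁ : (ratioShift E x₁ y₁).card ≤ n) (h₂ : (ratioShift E x₂ y₂).card ≤ n) :
    (E.card : ℝ) ≤ 3 * (n : ℝ) ^ ((11 : ℝ) / 6) := by
  classical
  obtain ⟨s, hs, hbound⟩ := exists_block_size hn
  let c : ℝ × ℝ → ℝ := fun e => (e.1 - x₁) / (e.2 - y₁)
  let d : ℝ × ℝ → ℝ := fun e => (e.1 - x₂) / (e.2 - y₂)
  let line : ℝ × ℝ → ℝ × ℝ := fun w =>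
    (w.2 / w.1, x₂ + w.2 * (y₁ - y₂) - w.2 / w.1 * x₁)
  have hc : ∀ e ∈ E, c e ≠ 0 := fun e he =>
    div_ne_zero (sub_ne_zero.2 (hE e he).1) (sub_ne_zero.2 (hE e he).2.2.1)
  have hd : ∀ e ∈ E, d e ≠ 0 := fun e he =>
    div_ne_zero (sub_ne_zero.2 (hE e he).2.1) (sub_ne_zero.2 (hE e he).2.2.2)
  have hce : ∀ e ∈ E, c e * (e.2 - y₁) = e.1 - x₁ := fun e he =>
    div_mul_cancel₀ _ (sub_ne_zero.2 (hE e he).2.2.1)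
  have hde : ∀ e ∈ E, d e * (e.2 - y₂) = e.1 - x₂ := fun e he =>
    div_mul_cancel₀ _ (sub_ne_zero.2 (hE e he).2.2.2)
  let A := E.image Prod.fst
  let L := (ratioShift E x₁ y₁ ×ˢ ratioShift E x₂ y₂).image line
  have hL : L.card ≤ n ^ 2 := by
    refine Finset.card_image_le.trans ?_
    rw [Finset.card_product, sq]
    exact Nat.mul_le_mul h₁ h₂
  have hL0 : ∀ l ∈ L, l.1 ≠ 0 := by
    intro l hl
    simp only [L, ratioShift, Finset.mem_image, Finset.mem_product] at hl
    obtain ⟨w, ⟨⟨e, he, h1⟩, ⟨e', he', h2⟩⟩, rfl⟩ := hl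
    have h3 := hc e he
    have h4 := hd e' he'
    simp only [c, d] at h3 h4
    rw [h1] at h3
    rw [h2] at h4
    exact div_ne_zero h4 h3
  have hpairs : ((E ×ˢ E).filter fun w => w.1.2 = w.2.2).card ≤
      ((L ×ˢ (A ×ˢ A)).filter fun w => w.2.2 = w.1.1 * w.2.1 + w.1.2).card := by
    apply Finset.card_le_card_of_injOn fun w => (line (c w.1, d w.2), (w.1.1, w.2.1))
    · rintro ⟨e, e'⟩ hw
      simp only [Finset.coe_filter, Finset.mem_product, Set.mem_ofPred_eq] at hw
      obtain ⟨⟨he, he'⟩, hb⟩ := hw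
      simp only [Finset.coe_filter, Finset.mem_product, Set.mem_ofPred_eq]
      refine ⟨⟨Finset.mem_image_of_mem _ (Finset.mem_product.2
        ⟨Finset.mem_image_of_mem _ he, Finset.mem_image_of_mem _ he'⟩),
        Finset.mem_image_of_mem _ he, Finset.mem_image_of_mem _ he'⟩, ?_⟩
      have h1 := hce e he
      have h2 := hde e' he'
      have h3 := hc e he
      have h4 : d e' / c e * (e.1 - x₁) = d e' * (e.2 - y₁) := by
        rw [← h1]; field_simp
      simp only [line]
      rw [← hb] at h2
      linarith
    · rintro ⟨e, e'⟩ hw ⟨p, p'⟩ hv h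
      simp only [Finset.coe_filter, Finset.mem_product, Set.mem_ofPred_eq] at hw hv
      obtain ⟨⟨he, he'⟩, hb⟩ := hw
      obtain ⟨⟨hp, hp'⟩, hb'⟩ := hv
      simp only [line, Prod.mk.injEq] at h
      obtain ⟨⟨hm, hk⟩, ha, ha'⟩ := h
      have hdd : d e' = d p' := by
        rw [hm] at hk
        apply mul_right_cancel₀ (sub_ne_zero.2 hy)
        linarith
      have hcc : c e = c p := by
        rw [hdd] at hm
        have h1 := hc e he
        have h2 := hc p hp
        have h3 := hd p' hp'
        rw [div_eq_div_iff h1 h2] at hm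
        exact (mul_left_cancel₀ h3 hm).symm
      have h1 := hce e he
      have h2 := hce p hp
      rw [hcc, ha, ← h2] at h1
      have h3 : e.2 = p.2 := by
        have := mul_left_cancel₀ (hc p hp) h1
        linarith
      rw [Prod.mk.injEq]
      exact ⟨Prod.ext ha h3, Prod.ext ha' (by rw [← hb, ← hb', h3])⟩
  have hA' : A.card ≤ n := hA
  have hinc : ((L ×ˢ (A ×ˢ A)).filter fun w => w.2.2 = w.1.1 * w.2.1 + w.1.2).card ≤
      n ^ 2 * (2 * (n / s) + 1) + n ^ 2 * s ^ 2 :=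
    (card_incidences_le A L hL0 hs).trans (by gcongr)
  have hsq : E.card ^ 2 ≤ n * (n ^ 2 * (2 * (n / s) + 1) + n ^ 2 * s ^ 2) :=
    (card_sq_le_card_image_mul_card_pairs E Prod.snd).trans
      (Nat.mul_le_mul hB (hpairs.trans hinc))
  have hn0 : (0 : ℝ) < n := by exact_mod_cast hn
  have hsq' : (E.card : ℝ) ^ 2 ≤ n * (8 * (n : ℝ) ^ ((8 : ℝ) / 3)) :=
    (show (E.card : ℝ) ^ 2 ≤ n * ((n ^ 2 * (2 * (n / s) + 1) + n ^ 2 * s ^ 2 : ℕ) : ℝ) by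
      exact_mod_cast hsq).trans (by gcongr)
  have hpow : ((n : ℝ) ^ ((11 : ℝ) / 6)) ^ 2 = n * (n : ℝ) ^ ((8 : ℝ) / 3) := by
    rw [← Real.rpow_natCast, ← Real.rpow_mul hn0.le]
    nth_rewrite 2 [← Real.rpow_one (n : ℝ)]
    rw [← Real.rpow_add hn0]
    norm_num
  refine le_of_sq_le_sq ?_ (by positivity)
  rw [mul_pow, hpow]
  have : 0 < (n : ℝ) * (n : ℝ) ^ ((8 : ℝ) / 3) := by positivity
  linarith

lemma card_ratioShift_image_swap (E : Finset (ℝ × ℝ)) (x y : ℝ) :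
    (ratioShift (E.image Prod.swap) y x).card ≤ (ratioShift E x y).card := by
  classical
  have : ratioShift (E.image Prod.swap) y x = (ratioShift E x y).image fun t => t⁻¹ := by
    simp only [ratioShift, Finset.image_image]
    refine Finset.image_congr fun e _ => ?_
    simp
  rw [this]
  exact Finset.card_image_le

theorem edges_upper_bound_from_small_ratio_sets :
    ∃ C : ℝ, 0 < C ∧ ∀ (n : ℕ) (A B : Finset ℝ) (x₁ y₁ x₂ y₂ : ℝ) (E : Finset (ℝ × ℝ)),
      A.card = n → B.card = n → (x₁, y₁) ≠ (x₂, y₂) → y₁ ∉ B → y₂ ∉ B → E ⊆ A ×ˢ B →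
      (ratioShift E x₁ y₁).card ≤ n → (ratioShift E x₂ y₂).card ≤ n →
      (E.card : ℝ) ≤ C * (n : ℝ) ^ ((11 : ℝ) / 6) := by
  classical
  refine ⟨5, by norm_num, ?_⟩
  intro n A B x₁ y₁ x₂ y₂ E hA hB hne hy₁ hy₂ hE h₁ h₂
  rcases Nat.eq_zero_or_pos n with rfl | hn
  · have hA0 : A = ∅ := Finset.card_eq_zero.1 hA
    have hE0 : E = ∅ := by
      rw [hA0, Finset.empty_product] at hE
      exact Finset.subset_empty.1 hE
    simp [hE0]
  have hAmem : ∀ e ∈ E, e.1 ∈ A := fun e he => (Finset.mem_product.1 (hE he)).1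
  have hBmem : ∀ e ∈ E, e.2 ∈ B := fun e he => (Finset.mem_product.1 (hE he)).2
  let F := E.filter fun e => e.1 ≠ x₁ ∧ e.1 ≠ x₂
  have hFE : F ⊆ E := Finset.filter_subset _ _
  have hF : ∀ e ∈ F, e.1 ≠ x₁ ∧ e.1 ≠ x₂ ∧ e.2 ≠ y₁ ∧ e.2 ≠ y₂ := by
    intro e he
    obtain ⟨he, h1, h2⟩ := Finset.mem_filter.1 he
    exact ⟨h1, h2, fun h => hy₁ (h ▸ hBmem e he), fun h => hy₂ (h ▸ hBmem e he)⟩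
  have hFA : (F.image Prod.fst).card ≤ n :=
    hA ▸ Finset.card_le_card (Finset.image_subset_iff.2 fun e he => hAmem e (hFE he))
  have hFB : (F.image Prod.snd).card ≤ n :=
    hB ▸ Finset.card_le_card (Finset.image_subset_iff.2 fun e he => hBmem e (hFE he))
  have hF₁ : (ratioShift F x₁ y₁).card ≤ n :=
    (Finset.card_le_card (Finset.image_subset_image hFE)).trans h₁
  have hF₂ : (ratioShift F x₂ y₂).card ≤ n :=
    (Finset.card_le_card (Finset.image_subset_image hFE)).trans h₂
  have hFcard : (F.card : ℝ) ≤ 3 * (n : ℝ) ^ ((11 : ℝ) / 6) := by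
    by_cases hy : y₁ = y₂
    · have hx : x₁ ≠ x₂ := fun hx => hne (by rw [hx, hy])
      have hswap : (F.image Prod.swap).card = F.card :=
        Finset.card_image_of_injective _ Prod.swap_injective
      rw [← hswap]
      refine card_edges_le_of_ne hn hx (F.image Prod.swap) ?_ ?_ ?_
        ((card_ratioShift_image_swap F x₁ y₁).trans hF₁)
        ((card_ratioShift_image_swap F x₂ y₂).trans hF₂)
      · intro e he
        obtain ⟨p, hp, rfl⟩ := Finset.mem_image.1 he
        obtain ⟨h1, h2, h3, h4⟩ := hF p hp
        exact ⟨h3, h4, h1, h2⟩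
      · rw [Finset.image_image]
        exact hFB
      · rw [Finset.image_image]
        exact hFA
    · exact card_edges_le_of_ne hn hy F hF hFA hFB hF₁ hF₂
  have hrest : E.card ≤ F.card + 2 * n := by
    have hsub : E ⊆ F ∪ ({x₁, x₂} : Finset ℝ) ×ˢ B := by
      intro e he
      have := hBmem e he
      simp only [F, Finset.mem_union, Finset.mem_filter, Finset.mem_product,
        Finset.mem_insert, Finset.mem_singleton]
      tauto
    refine (Finset.card_le_card hsub).trans ((Finset.card_union_le _ _).trans ?_)
    rw [Finset.card_product, hB]
    gcongr
    exact Finset.card_le_two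
  have hn1 : (n : ℝ) ≤ (n : ℝ) ^ ((11 : ℝ) / 6) :=
    Real.self_le_rpow_of_one_le (by exact_mod_cast hn) (by norm_num)
  have hrest' : (E.card : ℝ) ≤ F.card + 2 * n := by exact_mod_cast hrest
  linarith
end

section
/- There is an absolute constant C > 0 such that for every integer n ≥ 2, the product set of A = {1, 2, ..., n} satisfies |A·A| ≤ C · n² / (log n)^{43/500}, where A·A = {a·b : a, b ∈ A}. -/
open Finset ArithmeticFunction

theorem sum_vonMangoldt_div_le :
    ∃ C : ℝ, 0 < C ∧ ∀ N : ℕ, 0 < N →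
      ∑ d ∈ Ioc 0 N, vonMangoldt d / d ≤ Real.log N + C := by
  refine ⟨Real.log 4 + 4, by positivity, fun N hN => ?_⟩
  have hN0 : (0 : ℝ) < N := by exact_mod_cast hN
  have hlog : ∑ m ∈ Ioc 0 N, Real.log m ≤ N * Real.log N := by
    calc ∑ m ∈ Ioc 0 N, Real.log m ≤ ∑ m ∈ Ioc 0 N, Real.log N := by
          refine sum_le_sum fun m hm => ?_
          have := mem_Ioc.1 hm
          exact Real.log_le_log (by exact_mod_cast this.1) (by exact_mod_cast this.2)
      _ = N * Real.log N := by simp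
  have hsum : ∑ m ∈ Ioc 0 N, Real.log m = ∑ d ∈ Ioc 0 N, vonMangoldt d * (N / d : ℕ) := by
    rw [← sum_Ioc_mul_zeta_eq_sum, vonMangoldt_mul_zeta]
    rfl
  have hpsi : ∑ d ∈ Ioc 0 N, vonMangoldt d ≤ (Real.log 4 + 4) * N := by
    simpa [Chebyshev.psi] using Chebyshev.psi_le_const_mul_self hN0.le
  have hfloor : ∑ d ∈ Ioc 0 N, (vonMangoldt d * (N / d) - vonMangoldt d) ≤
      ∑ d ∈ Ioc 0 N, vonMangoldt d * (N / d : ℕ) := by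
    refine sum_le_sum fun d hd => ?_
    have h1 : (N : ℝ) / d ≤ (N / d : ℕ) + 1 := by
      rw [← Nat.floor_div_eq_div (K := ℝ)]
      exact (Nat.lt_floor_add_one _).le
    nlinarith [vonMangoldt_nonneg (n := d)]
  have heq : ∑ d ∈ Ioc 0 N, vonMangoldt d * ((N : ℝ) / d) =
      N * ∑ d ∈ Ioc 0 N, vonMangoldt d / d := by
    rw [mul_sum]
    exact sum_congr rfl fun d _ => by ring
  rw [sum_sub_distrib, heq] at hfloor
  refine le_of_mul_le_mul_left ?_ hN0
  nlinarith

theorem sum_one_div_rpow_le {s : ℝ} (hs : 1 < s) :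
    ∑' n : ℕ, 1 / (n + 1 : ℝ) ^ s ≤ 1 + 1 / (s - 1) := by
  have h := ZetaAsymptotics.zeta_limit_aux1 hs
  have h2 : 0 ≤ ZetaAsymptotics.termTSum s :=
    tsum_nonneg fun n => ZetaAsymptotics.term_nonneg _ _
  nlinarith

/-- `n ↦ n ^ (-s)` as a monoid homomorphism. -/
noncomputable def rpowNegHom (s : ℝ) : ℕ →* ℝ where
  toFun n := (n : ℝ) ^ (-s)
  map_one' := by simp
  map_mul' a b := by
    push_cast
    exact Real.mul_rpow a.cast_nonneg b.cast_nonneg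

theorem prod_primesBelow_one_sub_rpow_inv_le {s : ℝ} (hs : 1 < s) (N : ℕ) :
    ∏ p ∈ N.primesBelow, (1 - (p : ℝ) ^ (-s))⁻¹ ≤ 1 + 1 / (s - 1) := by
  have hsm : Summable (rpowNegHom s) := by
    simpa [rpowNegHom] using Real.summable_nat_rpow.2 (by linarith : -s < -1)
  have h := EulerProduct.prod_primesBelow_geometric_eq_tsum_smoothNumbers hsm N
  have h2 : ∑' m : N.smoothNumbers, rpowNegHom s m ≤ ∑' n : ℕ, rpowNegHom s n :=
    hsm.tsum_subtype_le (f := fun n => rpowNegHom s n) _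
      (fun n => by simp only [rpowNegHom, MonoidHom.coe_mk, OneHom.coe_mk]; positivity)
  have h3 : ∑' n : ℕ, rpowNegHom s n = ∑' n : ℕ, 1 / (n + 1 : ℝ) ^ s := by
    rw [hsm.tsum_eq_zero_add]
    simpa [rpowNegHom, Real.rpow_neg] using Real.zero_rpow (by linarith)
  calc _ = _ := h
    _ ≤ _ := h2
    _ = _ := h3
    _ ≤ _ := sum_one_div_rpow_le hs

theorem sum_primesBelow_inv_le :
    ∃ C : ℝ, ∀ N : ℕ, 2 ≤ N →
      ∑ p ∈ (N + 1).primesBelow, 1 / (p : ℝ) ≤ Real.log (Real.log N) + C := by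
  obtain ⟨C, hC, h⟩ := sum_vonMangoldt_div_le
  refine ⟨Real.log (1 + 1 / Real.log 2) + (1 + C / Real.log 2), fun N hN => ?_⟩
  have hl2 : 0 < Real.log 2 := Real.log_pos one_lt_two
  have hL2 : Real.log 2 ≤ Real.log N := Real.log_le_log two_pos (by exact_mod_cast hN)
  set L := Real.log N with hL
  have hL0 : 0 < L := hl2.trans_le hL2
  have hs : 1 < 1 + 1 / L := by
    have : 0 < 1 / L := by positivity
    linarith
  have hlt : ∀ p ∈ (N + 1).primesBelow, 0 < 1 - (p : ℝ) ^ (-(1 + 1 / L)) := by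
    intro p hp
    have := (Nat.prime_of_mem_primesBelow hp).one_lt
    have : (1 : ℝ) < p := by exact_mod_cast this
    linarith [Real.rpow_lt_one_of_one_lt_of_neg this (by linarith : -(1 + 1 / L) < 0)]
  have hA : ∑ p ∈ (N + 1).primesBelow, (p : ℝ) ^ (-(1 + 1 / L)) ≤
      Real.log (1 + 1 / Real.log 2) + Real.log L := by
    rw [← Real.log_mul (by positivity) hL0.ne', Real.le_log_iff_exp_le (by positivity),
      Real.exp_sum]
    calc _ ≤ ∏ p ∈ (N + 1).primesBelow, (1 - (p : ℝ) ^ (-(1 + 1 / L)))⁻¹ := by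
          refine prod_le_prod (fun _ _ => (Real.exp_pos _).le) fun p hp => ?_
          rw [le_inv_comm₀ (Real.exp_pos _) (hlt p hp), ← Real.exp_neg]
          exact Real.one_sub_le_exp_neg _
      _ ≤ 1 + 1 / (1 + 1 / L - 1) := prod_primesBelow_one_sub_rpow_inv_le hs _
      _ = 1 + L := by simp
      _ ≤ (1 + 1 / Real.log 2) * L := by
          have : 1 ≤ 1 / Real.log 2 * L := by
            rw [div_mul_eq_mul_div, one_mul, le_div_iff₀ hl2]; linarith
          linarith
  have hB : ∑ p ∈ (N + 1).primesBelow, (1 / (p : ℝ) - (p : ℝ) ^ (-(1 + 1 / L))) ≤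
      1 + C / Real.log 2 := by
    calc _ ≤ ∑ p ∈ (N + 1).primesBelow, (1 / L) * (vonMangoldt p / p) := by
          refine sum_le_sum fun p hp => ?_
          have hpp := Nat.prime_of_mem_primesBelow hp
          have hp0 : (0 : ℝ) < p := by exact_mod_cast hpp.pos
          rw [vonMangoldt_apply_prime hpp, neg_add, Real.rpow_add hp0, Real.rpow_neg_one,
            Real.rpow_def_of_pos hp0, mul_neg]
          have := Real.one_sub_le_exp_neg (Real.log p * (1 / L))
          have hpi : 0 < (p : ℝ)⁻¹ := by positivity
          have h3 := mul_le_mul_of_nonneg_left this hpi.le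
          calc _ ≤ 1 / (p : ℝ) - (p : ℝ)⁻¹ * (1 - Real.log p * (1 / L)) := by linarith
            _ = _ := by ring
      _ ≤ ∑ d ∈ Ioc 0 N, (1 / L) * (vonMangoldt d / d) := by
          refine sum_le_sum_of_subset_of_nonneg ?_ fun d _ _ => ?_
          · intro p hp
            have := Nat.lt_of_mem_primesBelow hp
            exact mem_Ioc.2 ⟨(Nat.prime_of_mem_primesBelow hp).pos, by omega⟩
          · have := vonMangoldt_nonneg (n := d)
            positivity
      _ ≤ (1 / L) * (L + C) := by
          rw [← mul_sum]
          exact mul_le_mul_of_nonneg_left (h N (by omega)) (by positivity)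
      _ = 1 + C / L := by field_simp
      _ ≤ _ := by gcongr
  rw [sum_sub_distrib] at hB
  linarith

/-- The arithmetic function `n ↦ z ^ Ω(n)`. -/
noncomputable def powCardFactors (z : ℝ) : ArithmeticFunction ℝ :=
  ⟨fun n => if n = 0 then 0 else z ^ cardFactors n, by simp⟩

theorem powCardFactors_apply {z : ℝ} {n : ℕ} (hn : n ≠ 0) :
    powCardFactors z n = z ^ cardFactors n := by
  simp [powCardFactors, hn]

theorem powCardFactors_mul (z : ℝ) (a b : ℕ) :
    powCardFactors z (a * b) = powCardFactors z a * powCardFactors z b := by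
  rcases eq_or_ne a 0 with rfl | ha
  · simp
  rcases eq_or_ne b 0 with rfl | hb
  · simp
  rw [powCardFactors_apply (mul_ne_zero ha hb), powCardFactors_apply ha, powCardFactors_apply hb,
    cardFactors_mul ha hb, pow_add]

theorem powCardFactors_nonneg {z : ℝ} (hz : 0 ≤ z) (n : ℕ) : 0 ≤ powCardFactors z n := by
  rcases eq_or_ne n 0 with rfl | hn
  · simp
  · rw [powCardFactors_apply hn]; positivity

theorem powCardFactors_prime_pow {z : ℝ} {p : ℕ} (hp : p.Prime) (k : ℕ) :
    powCardFactors z (p ^ k) = z ^ k := by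
  rw [powCardFactors_apply (pow_ne_zero _ hp.ne_zero), cardFactors_apply_prime_pow hp]

theorem powCardFactors_prime {z : ℝ} {p : ℕ} (hp : p.Prime) : powCardFactors z p = z := by
  simpa using powCardFactors_prime_pow (z := z) hp 1

theorem sum_Ioc_one_pow_le {u : ℝ} (h0 : 0 ≤ u) (h1 : u < 1) (n : ℕ) :
    ∑ k ∈ Ioc 1 (n + 1), u ^ k ≤ u ^ 2 / (1 - u) := by
  have h : (∑ k ∈ Ioc 1 (n + 1), u ^ k) * (1 - u) = u ^ 2 - u ^ (n + 2) := by
    induction n with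
    | zero => simp
    | succ n ih =>
      rw [sum_Ioc_succ_top (by omega), add_mul, ih]
      ring
  rw [le_div_iff₀ (by linarith), h]
  linarith [pow_nonneg h0 (n + 2)]

theorem sum_log_mul_inv_sq_le :
    ∃ C : ℝ, 0 ≤ C ∧ ∀ s : Finset ℕ, ∑ p ∈ s, Real.log p * (1 / (p : ℝ) ^ 2) ≤ C := by
  have hs : Summable fun n : ℕ => 2 * (n : ℝ) ^ (-(3 / 2) : ℝ) :=
    (Real.summable_nat_rpow.2 (by norm_num)).mul_left 2
  refine ⟨∑' n : ℕ, 2 * (n : ℝ) ^ (-(3 / 2) : ℝ), tsum_nonneg fun n => by positivity,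
    fun s => ?_⟩
  · refine le_trans (sum_le_sum fun p _ => ?_) (hs.sum_le_tsum s fun n _ => by positivity)
    rcases Nat.eq_zero_or_pos p with rfl | hp
    · simp
    have hp0 : (0 : ℝ) < p := by exact_mod_cast hp
    have h := Real.log_le_rpow_div hp0.le (ε := 1 / 2) (by norm_num)
    calc Real.log p * (1 / (p : ℝ) ^ 2) ≤ (p : ℝ) ^ (1 / 2 : ℝ) / (1 / 2) * (1 / (p : ℝ) ^ 2) := by
          gcongr
      _ = 2 * ((p : ℝ) ^ (1 / 2 : ℝ) * (p : ℝ) ^ (-2 : ℝ)) := by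
          rw [Real.rpow_neg hp0.le, Real.rpow_two]; ring
      _ = _ := by rw [← Real.rpow_add hp0]; norm_num

theorem sum_inv_sq_le_s8 :
    ∃ C : ℝ, 0 ≤ C ∧ ∀ s : Finset ℕ, ∑ p ∈ s, 1 / (p : ℝ) ^ 2 ≤ C :=
  ⟨_, tsum_nonneg fun _ => by positivity, fun s =>
    (Real.summable_one_div_nat_pow.2 one_lt_two).sum_le_tsum s fun _ _ => by positivity⟩

theorem sum_powCardFactors_mul_vonMangoldt_le {z : ℝ} (hz : 0 < z) (hz2 : z < 2) :
    ∃ C : ℝ, 0 < C ∧ ∀ M : ℕ,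
      ∑ d ∈ Ioc 0 M, (powCardFactors z).pmul vonMangoldt d ≤ C * M := by
  obtain ⟨B, hB, hBs⟩ := sum_log_mul_inv_sq_le
  have hr : 0 < 1 - z / 2 := by linarith
  refine ⟨z * Real.log 4 + z ^ 2 / (1 - z / 2) * B, by positivity, fun M => ?_⟩
  have hM : (0 : ℝ) ≤ M := M.cast_nonneg
  set K := ⌊Real.log M / Real.log 2⌋₊
  have key := Chebyshev.sum_PrimePow_eq_sum_sum' (fun d => (powCardFactors z).pmul vonMangoldt d)
    hM (N := K + 1) (by omega)
  rw [Nat.floor_natCast, sum_filter_of_ne fun d _ hd => by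
    by_contra h
    exact hd (by simp [vonMangoldt_eq_zero_iff.2 h])] at key
  rw [key, ← add_sum_Ioc_eq_sum_Icc (by omega), add_mul]
  have hval : ∀ {p k : ℕ}, p.Prime → k ≠ 0 →
      (powCardFactors z).pmul vonMangoldt (p ^ k) = z ^ k * Real.log p := by
    intro p k hp hk
    rw [pmul_apply, powCardFactors_prime_pow hp, vonMangoldt_apply_pow hk,
      vonMangoldt_apply_prime hp]
  refine add_le_add ?_ ?_
  · calc _ = z * Chebyshev.theta M := by
          rw [Chebyshev.theta, mul_sum]
          simp only [Nat.cast_one, div_one, Real.rpow_one]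
          refine sum_congr rfl fun p hp => ?_
          rw [hval (mem_filter.1 hp).2 one_ne_zero, pow_one]
      _ ≤ z * (Real.log 4 * M) := by
          gcongr
          exact Chebyshev.theta_le_log4_mul_x hM
      _ = _ := by ring
  · calc _ ≤ ∑ k ∈ Ioc 1 (K + 1), ∑ p ∈ Ioc 0 M with p.Prime,
            M * (Real.log p * (z / p) ^ k) := by
          refine sum_le_sum fun k hk => ?_
          have hk1 := (mem_Ioc.1 hk).1
          have hk0 : (0 : ℝ) < k := by exact_mod_cast (by omega : 0 < k)
          have hpM : ∀ p : ℕ, p ≤ ⌊(M : ℝ) ^ ((1 : ℝ) / k)⌋₊ → p ^ k ≤ M := by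
            intro p hp
            have h1 : (p : ℝ) ≤ (M : ℝ) ^ ((1 : ℝ) / k) :=
              (Nat.le_floor_iff (by positivity)).1 hp
            rw [one_div, Real.le_rpow_inv_iff_of_pos (by positivity) hM hk0,
              Real.rpow_natCast] at h1
            exact_mod_cast h1
          calc _ ≤ ∑ p ∈ Ioc 0 ⌊(M : ℝ) ^ ((1 : ℝ) / k)⌋₊ with p.Prime,
                M * (Real.log p * (z / p) ^ k) := by
                refine sum_le_sum fun p hp => ?_
                obtain ⟨hp1, hpp⟩ := mem_filter.1 hp
                have h1 : (p : ℝ) ^ k ≤ M := by exact_mod_cast hpM p (mem_Ioc.1 hp1).2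
                have hp0 : (0 : ℝ) < p := by exact_mod_cast hpp.pos
                have hlog := Real.log_natCast_nonneg p
                rw [hval hpp (by omega), div_pow]
                calc z ^ k * Real.log p = (p : ℝ) ^ k * (Real.log p * (z ^ k / (p : ℝ) ^ k)) := by
                      field_simp
                  _ ≤ _ := by gcongr
            _ ≤ _ := by
                refine sum_le_sum_of_subset_of_nonneg ?_ fun p _ _ => ?_
                · intro p hp
                  obtain ⟨hp1, hpp⟩ := mem_filter.1 hp
                  refine mem_filter.2 ⟨mem_Ioc.2 ⟨hpp.pos, ?_⟩, hpp⟩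
                  exact (Nat.le_self_pow (by omega) p).trans (hpM p (mem_Ioc.1 hp1).2)
                · have hlog := Real.log_natCast_nonneg p
                  positivity
      _ = M * ∑ p ∈ Ioc 0 M with p.Prime, Real.log p * ∑ k ∈ Ioc 1 (K + 1), (z / p) ^ k := by
          rw [sum_comm, mul_sum]
          exact sum_congr rfl fun p _ => by rw [mul_sum, mul_sum]
      _ ≤ M * ∑ p ∈ Ioc 0 M with p.Prime,
            z ^ 2 / (1 - z / 2) * (Real.log p * (1 / (p : ℝ) ^ 2)) := by
          refine mul_le_mul_of_nonneg_left (sum_le_sum fun p hp => ?_) hM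
          have hpp := (mem_filter.1 hp).2
          have hp2 : (2 : ℝ) ≤ p := by exact_mod_cast hpp.two_le
          have hlog := Real.log_natCast_nonneg p
          have hle : z / p ≤ z / 2 := by gcongr
          calc _ ≤ Real.log p * ((z / p) ^ 2 / (1 - z / p)) := by
                gcongr
                exact sum_Ioc_one_pow_le (by positivity) (by linarith) _
            _ ≤ Real.log p * ((z / p) ^ 2 / (1 - z / 2)) := by gcongr
            _ = _ := by ring
      _ ≤ _ := by
          rw [← mul_sum, mul_comm]
          gcongr
          exact hBs _

theorem sum_powCardFactors_div_le {z : ℝ} (hz : 0 < z) (hz2 : z < 2) :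
    ∃ C : ℝ, 0 < C ∧ ∀ N : ℕ, 2 ≤ N →
      ∑ m ∈ Ioc 0 N, powCardFactors z m / m ≤ C * Real.log N ^ z := by
  obtain ⟨A, hA⟩ := sum_primesBelow_inv_le
  obtain ⟨B, hB, hBs⟩ := sum_inv_sq_le_s8
  have hr : 0 < 1 - z / 2 := by linarith
  refine ⟨Real.exp (z * A + z ^ 2 / (1 - z / 2) * B), Real.exp_pos _, fun N hN => ?_⟩
  have hL0 : 0 < Real.log N := Real.log_pos (by exact_mod_cast (by omega : 1 < N))
  let g : ℕ →* ℝ :=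
    { toFun := fun n => powCardFactors z n / n
      map_one' := by simp [powCardFactors]
      map_mul' := fun a b => by
        rw [powCardFactors_mul, Nat.cast_mul, mul_div_mul_comm] }
  have hg : ∀ n, g n = powCardFactors z n / n := fun n => rfl
  have hg0 : ∀ n, 0 ≤ g n := fun n => by
    have := powCardFactors_nonneg hz.le n
    rw [hg]; positivity
  have hgp : ∀ {p : ℕ}, p.Prime → g p = z / p := fun hp => by rw [hg, powCardFactors_prime hp]
  have hgle : ∀ {p : ℕ}, p.Prime → g p ≤ z / 2 := fun hp => by
    rw [hgp hp]
    have := hp.two_le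
    gcongr
    exact_mod_cast this
  obtain ⟨-, hsum⟩ := EulerProduct.summable_and_hasSum_smoothNumbers_prod_primesBelow_geometric
    (f := g) (fun hp => by rw [Real.norm_of_nonneg (hg0 _)]; linarith [hgle hp]) (N + 1)
  have hfin : ∑ m ∈ Ioc 0 N, g m ≤ ∏ p ∈ (N + 1).primesBelow, (1 - g p)⁻¹ := by
    have hmem : ∀ m ∈ Ioc 0 N, m ∈ (N + 1).smoothNumbers := fun m hm => by
      have := mem_Ioc.1 hm
      exact Nat.mem_smoothNumbers_of_lt this.1 (by omega)
    rw [← sum_subtype_of_mem (p := fun m => m ∈ (N + 1).smoothNumbers) _ hmem]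
    exact sum_le_hasSum _ (fun _ _ => hg0 _) hsum
  calc _ ≤ ∏ p ∈ (N + 1).primesBelow, (1 - g p)⁻¹ := hfin
    _ ≤ ∏ p ∈ (N + 1).primesBelow,
          Real.exp (z * (1 / p) + z ^ 2 / (1 - z / 2) * (1 / (p : ℝ) ^ 2)) := by
        refine prod_le_prod (fun p hp => ?_) fun p hp => ?_
        · have := hgle (Nat.prime_of_mem_primesBelow hp)
          exact inv_nonneg.2 (by linarith)
        · have hpp := Nat.prime_of_mem_primesBelow hp
          have hle := hgle hpp
          have h1 : 0 < 1 - g p := by linarith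
          calc (1 - g p)⁻¹ = (g p + g p ^ 2 / (1 - g p)) + 1 := by field_simp; ring
            _ ≤ Real.exp (g p + g p ^ 2 / (1 - g p)) := Real.add_one_le_exp _
            _ ≤ Real.exp (g p + g p ^ 2 / (1 - z / 2)) := by gcongr
            _ = _ := by rw [hgp hpp]; ring_nf
    _ ≤ Real.exp (z * (Real.log (Real.log N) + A) + z ^ 2 / (1 - z / 2) * B) := by
        rw [← Real.exp_sum, sum_add_distrib, ← mul_sum, ← mul_sum]
        gcongr
        · exact hA N hN
        · exact hBs _
    _ = _ := by
        rw [Real.rpow_def_of_pos hL0, ← Real.exp_add]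
        ring_nf

theorem sum_powCardFactors_le {z : ℝ} (hz : 0 < z) (hz2 : z < 2) :
    ∃ C : ℝ, 0 < C ∧ ∀ N : ℕ, 2 ≤ N →
      ∑ m ∈ Ioc 0 N, powCardFactors z m ≤ C * N * Real.log N ^ (z - 1) := by
  obtain ⟨A, hA, hAs⟩ := sum_powCardFactors_mul_vonMangoldt_le hz hz2
  obtain ⟨B, hB, hBs⟩ := sum_powCardFactors_div_le hz hz2
  refine ⟨(A + 1) * B, by positivity, fun N hN => ?_⟩
  have hN0 : (0 : ℝ) < N := by exact_mod_cast (by omega : 0 < N)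
  have hL0 : 0 < Real.log N := Real.log_pos (by exact_mod_cast (by omega : 1 < N))
  have hf := powCardFactors_nonneg hz.le
  have hconv : powCardFactors z * (powCardFactors z).pmul vonMangoldt =
      (powCardFactors z).pmul log := by
    ext n
    rw [mul_apply, pmul_apply, log_apply, ← vonMangoldt_sum, mul_sum,
      ← Nat.sum_divisorsAntidiagonal' (fun _ d => powCardFactors z n * vonMangoldt d)]
    refine sum_congr rfl fun x hx => ?_
    rw [pmul_apply, ← (Nat.mem_divisorsAntidiagonal.1 hx).1, powCardFactors_mul]
    ring
  have h1 : ∑ m ∈ Ioc 0 N, powCardFactors z m * Real.log m ≤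
      A * N * ∑ m ∈ Ioc 0 N, powCardFactors z m / m := by
    calc _ = ∑ m ∈ Ioc 0 N, (powCardFactors z * (powCardFactors z).pmul vonMangoldt) m := by
          rw [hconv]; rfl
      _ ≤ ∑ m ∈ Ioc 0 N, powCardFactors z m * (A * (N / m)) := by
          rw [sum_Ioc_mul_eq_sum_sum]
          refine sum_le_sum fun m _ => mul_le_mul_of_nonneg_left ?_ (hf m)
          exact (hAs _).trans (mul_le_mul_of_nonneg_left Nat.cast_div_le hA.le)
      _ = _ := by
          rw [mul_sum]
          exact sum_congr rfl fun m _ => by ring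
  have h2 : ∑ m ∈ Ioc 0 N, powCardFactors z m * (Real.log N - Real.log m) ≤
      N * ∑ m ∈ Ioc 0 N, powCardFactors z m / m := by
    rw [mul_sum]
    refine sum_le_sum fun m hm => ?_
    have hm0 : (0 : ℝ) < m := by exact_mod_cast (mem_Ioc.1 hm).1
    rw [← Real.log_div hN0.ne' hm0.ne']
    calc _ ≤ powCardFactors z m * (N / m) :=
          mul_le_mul_of_nonneg_left (Real.log_le_self (by positivity)) (hf m)
      _ = _ := by ring
  have h3 : (∑ m ∈ Ioc 0 N, powCardFactors z m) * Real.log N =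
      ∑ m ∈ Ioc 0 N, powCardFactors z m * Real.log m +
        ∑ m ∈ Ioc 0 N, powCardFactors z m * (Real.log N - Real.log m) := by
    rw [← sum_add_distrib, sum_mul]
    exact sum_congr rfl fun m _ => by ring
  rw [Real.rpow_sub_one hL0.ne', ← mul_div_assoc, le_div_iff₀ hL0, h3]
  calc _ ≤ (A + 1) * N * ∑ m ∈ Ioc 0 N, powCardFactors z m / m := by linarith
    _ ≤ (A + 1) * N * (B * Real.log N ^ z) := by gcongr; exact hBs N hN
    _ = _ := by ring

theorem exponent_le :
    1 / Real.log 2 - 1 - 1 / Real.log 2 * Real.log (1 / Real.log 2) ≤ -(43 / 500) := by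
  have h1 := Real.log_two_gt_d9
  have h2 := Real.log_two_lt_d9
  have h0 : 0 < Real.log 2 := by linarith
  have hexp : Real.exp 0.3664634773 ≤ 1 / 0.6931471808 := by
    refine (Real.exp_bound' (by norm_num) (by norm_num) (n := 8) (by norm_num)).trans ?_
    norm_num [sum_range_succ, Nat.factorial]
  have hlog : 0.3664634773 ≤ Real.log (1 / Real.log 2) := by
    rw [Real.le_log_iff_exp_le (by positivity)]
    exact hexp.trans (by gcongr)
  have : 1 / Real.log 2 - 1 - 1 / Real.log 2 * Real.log (1 / Real.log 2) =
      (1 - Real.log 2 - Real.log (1 / Real.log 2)) / Real.log 2 := by field_simp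
  rw [this, div_le_iff₀ h0]
  linarith

theorem rpow_le_const_mul_rpow {a b x y : ℝ} (hx : 0 < x) (hxy : x ≤ y) (hab : a ≤ b) :
    y ^ a ≤ x ^ (a - b) * y ^ b := by
  have hy : 0 < y := hx.trans_le hxy
  calc y ^ a = y ^ (a - b) * y ^ b := by rw [← Real.rpow_add hy]; ring_nf
    _ ≤ _ := by
      exact mul_le_mul_of_nonneg_right
        (Real.rpow_le_rpow_of_nonpos hx hxy (sub_nonpos.2 hab)) (by positivity)

/-- The multiplication table is covered by the integers with at least `K` prime factors and the
products of pairs with at most `K` prime factors in total. -/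
theorem card_mul_table_le {z w : ℝ} (hz : 1 ≤ z) (hw : 0 < w) (hw1 : w ≤ 1) (n : ℕ) (K : ℝ) :
    ((((Icc 1 n) ×ˢ (Icc 1 n)).image fun p => p.1 * p.2).card : ℝ) ≤
      z ^ (-K) * ∑ m ∈ Ioc 0 (n ^ 2), powCardFactors z m +
        w ^ (-K) * (∑ m ∈ Ioc 0 n, powCardFactors w m) ^ 2 := by
  classical
  have hz0 : 0 < z := by linarith
  set T := (Ioc 0 (n ^ 2)).filter fun m => K ≤ (cardFactors m : ℝ) with hT
  set P := ((Icc 1 n) ×ˢ (Icc 1 n)).filter fun p => (cardFactors (p.1 * p.2) : ℝ) ≤ K with hP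
  have hsub : ((Icc 1 n) ×ˢ (Icc 1 n)).image (fun p => p.1 * p.2) ⊆
      T ∪ P.image fun p => p.1 * p.2 := by
    intro m hm
    obtain ⟨p, hp, rfl⟩ := mem_image.1 hm
    obtain ⟨ha, hb⟩ := mem_product.1 hp
    rw [mem_Icc] at ha hb
    rcases le_total K (cardFactors (p.1 * p.2) : ℝ) with h | h
    · refine mem_union_left _ (mem_filter.2 ⟨mem_Ioc.2 ⟨Nat.mul_pos ha.1 hb.1, ?_⟩, h⟩)
      rw [sq]
      exact Nat.mul_le_mul ha.2 hb.2
    · exact mem_union_right _ (mem_image_of_mem _ (mem_filter.2 ⟨hp, h⟩))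
  have hcard : ((((Icc 1 n) ×ˢ (Icc 1 n)).image fun p => p.1 * p.2).card : ℝ) ≤
      T.card + P.card := by
    exact_mod_cast (card_le_card hsub).trans ((card_union_le _ _).trans
      (Nat.add_le_add_left card_image_le _))
  refine hcard.trans (add_le_add ?_ ?_)
  · rw [card_eq_sum_ones, Nat.cast_sum, mul_sum]
    refine le_trans (sum_le_sum (g := fun m => z ^ (-K) * powCardFactors z m) fun m hm => ?_)
      (sum_le_sum_of_subset_of_nonneg (filter_subset _ _) fun m _ _ => ?_)
    · obtain ⟨hm1, hm2⟩ := mem_filter.1 hm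
      rw [powCardFactors_apply (mem_Ioc.1 hm1).1.ne', ← Real.rpow_natCast,
        ← Real.rpow_add hz0, Nat.cast_one]
      exact Real.one_le_rpow hz (by linarith)
    · have := powCardFactors_nonneg hz0.le m
      positivity
  · rw [card_eq_sum_ones, Nat.cast_sum, sq, sum_mul_sum, ← sum_product', mul_sum]
    refine le_trans (sum_le_sum (g := fun p : ℕ × ℕ =>
        w ^ (-K) * (powCardFactors w p.1 * powCardFactors w p.2)) fun p hp => ?_)
      (sum_le_sum_of_subset_of_nonneg (filter_subset _ _) fun p _ _ => ?_)
    · obtain ⟨hp1, hp2⟩ := mem_filter.1 hp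
      obtain ⟨ha, hb⟩ := mem_product.1 hp1
      have ha0 := (mem_Icc.1 ha).1
      have hb0 := (mem_Icc.1 hb).1
      rw [← powCardFactors_mul, powCardFactors_apply (Nat.mul_pos ha0 hb0).ne',
        ← Real.rpow_natCast, ← Real.rpow_add hw, Nat.cast_one]
      exact Real.one_le_rpow_of_pos_of_le_one_of_nonpos hw hw1 (by linarith)
    · have h1 := powCardFactors_nonneg hw.le p.1
      have h2 := powCardFactors_nonneg hw.le p.2
      positivity

theorem multiplication_table_upper_bound :
    ∃ C : ℝ, 0 < C ∧ ∀ n : ℕ, 2 ≤ n →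
      (((((Finset.Icc 1 n) ×ˢ (Finset.Icc 1 n)).image fun p => p.1 * p.2).card : ℕ) : ℝ)
        ≤ C * (n : ℝ) ^ 2 / (Real.log n) ^ ((43 : ℝ) / 500) := by
  have hl1 := Real.log_two_gt_d9
  have hl2 := Real.log_two_lt_d9
  have hl0 : 0 < Real.log 2 := by linarith
  have hE := exponent_le
  set α := 1 / Real.log 2 with hα
  have hα0 : 0 < α := by positivity
  have hα1 : 1 ≤ α := by rw [hα, le_div_iff₀ hl0]; linarith
  have hα2 : α < 2 := by rw [hα, div_lt_iff₀ hl0]; linarith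
  have hαl : α * Real.log 2 = 1 := by rw [hα]; field_simp
  obtain ⟨A, hA, hAs⟩ := sum_powCardFactors_le hα0 hα2
  obtain ⟨B, hB, hBs⟩ := sum_powCardFactors_le (z := α / 2) (by linarith) (by linarith)
  set E := α - 1 - α * Real.log α with hEdef
  set D := Real.log 2 ^ (E - -(43 / 500)) with hD
  have hD0 : 0 < D := by positivity
  refine ⟨(A * 2 ^ (α - 1) + B ^ 2) * D, by positivity, fun n hn => ?_⟩
  have hL2 : Real.log 2 ≤ Real.log n := Real.log_le_log two_pos (by exact_mod_cast hn)
  set L := Real.log n with hL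
  have hL0 : 0 < L := hl0.trans_le hL2
  have hpow : ∀ z : ℝ, 0 < z → z ^ (-(α * Real.log L)) = L ^ (-(α * Real.log z)) := by
    intro z hz
    rw [Real.rpow_def_of_pos hz, Real.rpow_def_of_pos hL0]
    ring_nf
  have h1 : α ^ (-(α * Real.log L)) * ∑ m ∈ Ioc 0 (n ^ 2), powCardFactors α m ≤
      A * 2 ^ (α - 1) * (n : ℝ) ^ 2 * L ^ E := by
    have h := hAs (n ^ 2) (by nlinarith)
    rw [Nat.cast_pow, Real.log_pow, Nat.cast_two, Real.mul_rpow two_pos.le hL0.le] at h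
    rw [hpow α hα0]
    calc _ ≤ L ^ (-(α * Real.log α)) * (A * (n : ℝ) ^ 2 * (2 ^ (α - 1) * L ^ (α - 1))) := by
          gcongr
      _ = A * 2 ^ (α - 1) * (n : ℝ) ^ 2 * (L ^ (-(α * Real.log α)) * L ^ (α - 1)) := by ring
      _ = _ := by rw [← Real.rpow_add hL0, hEdef]; ring_nf
  have h2 : (α / 2) ^ (-(α * Real.log L)) * (∑ m ∈ Ioc 0 n, powCardFactors (α / 2) m) ^ 2 ≤
      B ^ 2 * (n : ℝ) ^ 2 * L ^ E := by
    have hnn : 0 ≤ ∑ m ∈ Ioc 0 n, powCardFactors (α / 2) m :=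
      sum_nonneg fun m _ => powCardFactors_nonneg (by linarith) m
    rw [hpow _ (by linarith), Real.log_div hα0.ne' two_ne_zero]
    calc _ ≤ L ^ (-(α * (Real.log α - Real.log 2))) * (B * n * L ^ (α / 2 - 1)) ^ 2 := by
          gcongr
          exact hBs n hn
      _ = B ^ 2 * (n : ℝ) ^ 2 * (L ^ (-(α * (Real.log α - Real.log 2))) *
            (L ^ (α / 2 - 1) * L ^ (α / 2 - 1))) := by ring
      _ = _ := by
          rw [← Real.rpow_add hL0, ← Real.rpow_add hL0]
          congr 2
          rw [hEdef]
          linarith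
  calc _ ≤ _ := card_mul_table_le hα1 (w := α / 2) (by linarith) (by linarith) n (α * Real.log L)
    _ ≤ (A * 2 ^ (α - 1) + B ^ 2) * (n : ℝ) ^ 2 * L ^ E := by linarith
    _ ≤ (A * 2 ^ (α - 1) + B ^ 2) * (n : ℝ) ^ 2 * (D * L ^ (-(43 / 500) : ℝ)) := by
        gcongr
        exact rpow_le_const_mul_rpow hl0 hL2 hE
    _ = _ := by
        rw [Real.rpow_neg hL0.le]
        ring
end
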